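/- There is no computable function f mapping (codes of) finite rule sets to (codes of) finite rule sets all of whose rules have atomic heads such that, for every rule set 𝓡, 𝓡 ∈ CT_R^∀ if and only if f(𝓡) ∈ CT_R^∀; that is, no computable normalisation into atomic-head rules exactly preserves termination and non-termination of the restricted chase. -/

import Mathlib

namespace ExRules

open scoped Classical

noncomputable section

/-- Terms: constants or variables, each indexed by a natural number. -/
inductive Term where
  | const : ℕ → Term
  | var : ℕ → Term
deriving DecidableEq

/-- An atom: a predicate symbol applied to a list of terms (the arity of the
predicate is the length of the argument list). -/
structure Atom where
  pred : ℕ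
  args : List Term
deriving DecidableEq

/-- A factbase is a finite set of atoms. -/
abbrev FactBase := Finset Atom

/-- A substitution: a map on variables (extended by the identity on constants). -/
abbrev Subst := ℕ → Term

def applyTerm (σ : Subst) : Term → Term
  | .const c => .const c
  | .var v => σ v

def Atom.subst (σ : Subst) (a : Atom) : Atom := ⟨a.pred, a.args.map (applyTerm σ)⟩

def Term.vars : Term → Finset ℕ
  | .const _ => ∅
  | .var v => {v}

def Atom.vars (a : Atom) : Finset ℕ := a.args.foldr (fun t s => t.vars ∪ s) ∅

def FactBase.vars (F : FactBase) : Finset ℕ := F.sup Atom.vars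

/-- The variables occurring in a (possibly infinite) set of atoms. -/
def setVars (S : Set Atom) : Set ℕ := {v | ∃ a ∈ S, v ∈ a.vars}

/-- `σ` is a homomorphism from the atom set `S` to the atom set `S'`. -/
def IsHom (σ : Subst) (S S' : Set Atom) : Prop := ∀ a ∈ S, a.subst σ ∈ S'

/-- A retraction is a homomorphism that is the identity on the common variables. -/
def IsRetraction (σ : Subst) (S S' : Set Atom) : Prop :=
  IsHom σ S S' ∧ ∀ v, v ∈ setVars S → v ∈ setVars S' → σ v = Term.var v

/-- An existential rule `B → ∃z.H` with nonempty body and head.  The frontier and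
the existential variables are determined by the variables shared between body and
head. -/
structure Rule where
  body : Finset Atom
  head : Finset Atom
  body_nonempty : body.Nonempty
  head_nonempty : head.Nonempty

instance : DecidableEq Rule := fun R S =>
  decidable_of_iff (R.body = S.body ∧ R.head = S.head) (by
    constructor
    · rintro ⟨h1, h2⟩
      cases R; cases S; simp_all
    · rintro rfl; exact ⟨rfl, rfl⟩)

/-- The frontier of a rule: the variables shared by body and head. -/
def Rule.frontier (R : Rule) : Finset ℕ := FactBase.vars R.body ∩ FactBase.vars R.head

/-- The existential variables of a rule: head variables not occurring in the body. -/
def Rule.exVars (R : Rule) : Finset ℕ := FactBase.vars R.head \ FactBase.vars R.body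

/-- A rule is Datalog if it has no existential variable. -/
def Rule.IsDatalog (R : Rule) : Prop := R.exVars = ∅

/-- A rule has an atomic head if its head is a single atom. -/
def Rule.IsAtomicHead (R : Rule) : Prop := R.head.card = 1

/-- A rule set is a finite set of existential rules. -/
abbrev RuleSet := Finset Rule

instance : Encodable Term :=
  Encodable.ofEquiv (ℕ ⊕ ℕ)
    { toFun := fun t => match t with | .const c => .inl c | .var v => .inr v
      invFun := fun s => match s with | .inl c => .const c | .inr v => .var v
      left_inv := by intro t; cases t <;> rfl
      right_inv := by intro s; cases s <;> rfl }

instance : Encodable Atom :=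
  Encodable.ofEquiv (ℕ × List Term)
    { toFun := fun a => (a.pred, a.args)
      invFun := fun p => ⟨p.1, p.2⟩
      left_inv := fun _ => rfl
      right_inv := fun _ => rfl }

instance : Encodable Rule :=
  Encodable.ofEquiv {p : Finset Atom × Finset Atom // p.1.Nonempty ∧ p.2.Nonempty}
    { toFun := fun R => ⟨(R.body, R.head), R.body_nonempty, R.head_nonempty⟩
      invFun := fun p => ⟨p.1.1, p.1.2, p.2.1, p.2.2⟩
      left_inv := fun _ => rfl
      right_inv := fun _ => rfl }

/-- A trigger `(R, π)`: a rule together with a substitution. -/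
structure Trigger where
  rule : Rule
  map : Subst

/-- The canonical fresh variable `z_t` associated to a trigger `t` and an
existential variable `z`: it is unique for `z` and (the relevant part of) `t`. -/
def Trigger.freshVar (t : Trigger) (z : ℕ) : ℕ :=
  Nat.pair
    (Encodable.encode (t.rule, ((FactBase.vars t.rule.body).sort (· ≤ ·)).map t.map)) z

/-- The extension `π_R` of the substitution of a trigger, mapping each existential
variable `z` to the fresh variable `z_t`. -/
def Trigger.ext (t : Trigger) : Subst := fun v =>
  if v ∈ t.rule.exVars then Term.var (t.freshVar v) else t.map v

/-- The output of a trigger: `out(t) = π_R(H)`. -/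
def Trigger.out (t : Trigger) : Finset Atom := t.rule.head.image (Atom.subst t.ext)

/-- `t` is a trigger on the factbase `F`: its substitution is a homomorphism from
the body of its rule to `F`. -/
def Trigger.IsOn (t : Trigger) (F : FactBase) : Prop := IsHom t.map ↑t.rule.body ↑F

/-- The chase variants: oblivious, semi-oblivious, restricted, equivalent. -/
inductive Variant where
  | O | SO | R | E

/-- Applicability of a trigger on a factbase, for each chase variant. -/
def Applicable : Variant → Trigger → FactBase → Prop
  | .O, t, F => ¬ t.out ⊆ F
  | .SO, t, F => ∀ t' : Trigger, t'.rule = t.rule →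
      (∀ v ∈ t.rule.frontier, t'.map v = t.map v) → ¬ t'.out ⊆ F
  | .R, t, F => ¬ ∃ σ : Subst, IsRetraction σ ↑(F ∪ t.out) ↑F
  | .E, t, F => ¬ ∃ σ : Subst, IsHom σ ↑(F ∪ t.out) ↑F

/-- An atom set `M` satisfies a rule `B → ∃z.H` if every homomorphism from `B`
to `M` extends to a homomorphism mapping `H` into `M`. -/
def SatisfiesRule (M : Set Atom) (R : Rule) : Prop :=
  ∀ σ : Subst, IsHom σ ↑R.body M →
    ∃ σ' : Subst, (∀ v ∈ FactBase.vars R.body, σ' v = σ v) ∧ IsHom σ' ↑R.head M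

/-- A (finite or infinite) derivation from the knowledge base `⟨𝓡, F⟩`:
`len` is the number of triggers (possibly `⊤`), `fb i` is the `i`-th factbase and,
for `i < len`, `tr i` is the trigger producing `fb (i+1)` from `fb i`. -/
structure Derivation (𝓡 : RuleSet) (F : FactBase) where
  len : ℕ∞
  fb : ℕ → FactBase
  tr : ℕ → Trigger
  fb_zero : fb 0 = F
  rule_mem : ∀ i : ℕ, (i : ℕ∞) < len → (tr i).rule ∈ 𝓡
  trig_on : ∀ i : ℕ, (i : ℕ∞) < len → (tr i).IsOn (fb i)
  trig_new : ∀ i : ℕ, (i : ℕ∞) < len → ¬ (tr i).out ⊆ fb i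
  fb_succ : ∀ i : ℕ, (i : ℕ∞) < len → fb (i + 1) = fb i ∪ (tr i).out
  fb_stall : ∀ i : ℕ, ¬ (i : ℕ∞) < len → fb (i + 1) = fb i

namespace Derivation

variable {𝓡 : RuleSet} {F : FactBase}

/-- An `X`-derivation: every applied trigger is `X`-applicable when applied. -/
def IsX (X : Variant) (D : Derivation 𝓡 F) : Prop :=
  ∀ i : ℕ, (i : ℕ∞) < D.len → Applicable X (D.tr i) (D.fb i)

/-- Datalog-first: a non-Datalog rule is only applied when all Datalog rules of
the rule set are satisfied. -/
def DatalogFirst (D : Derivation 𝓡 F) : Prop :=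
  ∀ i : ℕ, (i : ℕ∞) < D.len → ¬ (D.tr i).rule.IsDatalog →
    ∀ R ∈ 𝓡, R.IsDatalog → SatisfiesRule ↑(D.fb i) R

/-- Fairness: every trigger `X`-applicable on some factbase of the derivation is
eventually not `X`-applicable. -/
def Fair (X : Variant) (D : Derivation 𝓡 F) : Prop :=
  ∀ i : ℕ, (i : ℕ∞) ≤ D.len → ∀ t : Trigger, t.rule ∈ 𝓡 → t.IsOn (D.fb i) →
    Applicable X t (D.fb i) →
    ∃ j : ℕ, i < j ∧ (j : ℕ∞) ≤ D.len ∧ ¬ Applicable X t (D.fb j)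

/-- A derivation is finite if its length is not `⊤`. -/
def Finite (D : Derivation 𝓡 F) : Prop := D.len ≠ ⊤

end Derivation

/-- `CT_X^∀` (non-Datalog-first): every fair `X`-derivation from every KB is finite. -/
def CTall (X : Variant) (𝓡 : RuleSet) : Prop :=
  ∀ F : FactBase, ∀ D : Derivation 𝓡 F, D.IsX X → D.Fair X → D.Finite

/-- `CT_X^∃`: some fair `X`-derivation from every KB is finite. -/
def CTex (X : Variant) (𝓡 : RuleSet) : Prop :=
  ∀ F : FactBase, ∃ D : Derivation 𝓡 F, D.IsX X ∧ D.Fair X ∧ D.Finite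

/-- `CT_{df-X}^∀`: every fair Datalog-first `X`-derivation from every KB is finite. -/
def CTallDF (X : Variant) (𝓡 : RuleSet) : Prop :=
  ∀ F : FactBase, ∀ D : Derivation 𝓡 F, D.IsX X → D.DatalogFirst → D.Fair X → D.Finite

/-- `CT_{df-X}^∃`: some fair Datalog-first `X`-derivation from every KB is finite. -/
def CTexDF (X : Variant) (𝓡 : RuleSet) : Prop :=
  ∀ F : FactBase, ∃ D : Derivation 𝓡 F, D.IsX X ∧ D.DatalogFirst ∧ D.Fair X ∧ D.Finite

/-! ### Single-piece decomposition -/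

/-- Adjacency in the piece graph of a rule: two head atoms sharing an existential
variable. -/
def PieceAdj (R : Rule) (a b : Atom) : Prop :=
  a ∈ R.head ∧ b ∈ R.head ∧ (a.vars ∩ b.vars ∩ R.exVars).Nonempty

/-- The piece (connected component of the piece graph) containing a given head atom. -/
def pieceOf (R : Rule) (a : Atom) : Finset Atom :=
  R.head.filter fun b => Relation.ReflTransGen (PieceAdj R) a b

theorem self_mem_pieceOf {R : Rule} {a : Atom} (h : a ∈ R.head) : a ∈ pieceOf R a := by
  rw [pieceOf, Finset.mem_filter]
  exact ⟨h, Relation.ReflTransGen.refl⟩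

/-- The single-piece decomposition of a rule. -/
def Rule.sp (R : Rule) : Finset Rule :=
  R.head.attach.image fun a =>
    ⟨R.body, pieceOf R a.1, R.body_nonempty, ⟨a.1, self_mem_pieceOf a.2⟩⟩

/-- The single-piece decomposition of a rule set. -/
def spSet (𝓡 : RuleSet) : RuleSet := 𝓡.biUnion Rule.sp

/-! ### Atomic decompositions -/

/-- The predicates occurring in a rule set. -/
def RuleSet.predsF (𝓡 : RuleSet) : Finset ℕ :=
  𝓡.sup fun R => (R.body.image Atom.pred) ∪ (R.head.image Atom.pred)

/-- A fresh predicate `X_R`, unique for `R` and not occurring in `𝓡`. -/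
def freshPred (𝓡 : RuleSet) (R : Rule) : ℕ :=
  (RuleSet.predsF 𝓡).sup id + 1 + Encodable.encode R

/-- The atom `X_R(x, z)` over the fresh predicate, whose arguments are the frontier
variables followed by the existential variables of `R`. -/
def xAtom (𝓡 : RuleSet) (R : Rule) : Atom :=
  ⟨freshPred 𝓡 R,
    ((R.frontier.sort (· ≤ ·)).map Term.var) ++ ((R.exVars.sort (· ≤ ·)).map Term.var)⟩

/-- The one-way atomic decomposition of a rule `R = B → ∃z.H` (relative to `𝓡`):
the rule `B → ∃z.X_R(x,z)` together with a rule `X_R(x,z) → P(t)` for each head atom. -/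
def oneAdRule (𝓡 : RuleSet) (R : Rule) : Finset Rule :=
  insert ⟨R.body, {xAtom 𝓡 R}, R.body_nonempty, Finset.singleton_nonempty _⟩
    (R.head.attach.image fun a =>
      ⟨{xAtom 𝓡 R}, {a.1}, Finset.singleton_nonempty _, Finset.singleton_nonempty _⟩)

/-- The one-way atomic decomposition of a rule set. -/
def oneAd (𝓡 : RuleSet) : RuleSet := 𝓡.biUnion (oneAdRule 𝓡)

/-- The two-way atomic decomposition: `2ad(R) = 1ad(R) ∪ {H[x,z] → X_R(x,z)}`. -/
def twoAd (𝓡 : RuleSet) : RuleSet :=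
  oneAd 𝓡 ∪ 𝓡.image fun R =>
    ⟨R.head, {xAtom 𝓡 R}, R.head_nonempty, Finset.singleton_nonempty _⟩

/-! ### Models, entailment, BDDP -/

/-- `M` is a model of the rule set `𝓡`. -/
def IsModelOfRules (𝓡 : RuleSet) (M : Set Atom) : Prop := ∀ R ∈ 𝓡, SatisfiesRule M R

/-- `M` is a model of the knowledge base `⟨𝓡, F⟩`. -/
def IsModelOfKB (𝓡 : RuleSet) (F : FactBase) (M : Set Atom) : Prop :=
  IsModelOfRules 𝓡 M ∧ ∃ σ : Subst, IsHom σ ↑F M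

/-- `M` is a universal model of `⟨𝓡, F⟩`: a model mapping homomorphically into
every model. -/
def IsUniversalModel (𝓡 : RuleSet) (F : FactBase) (M : Set Atom) : Prop :=
  IsModelOfKB 𝓡 F M ∧ ∀ N : Set Atom, IsModelOfKB 𝓡 F N → ∃ σ : Subst, IsHom σ M N

/-- An atom set entails a Boolean conjunctive query `Q` if `Q` maps
homomorphically into it. -/
def EntailsQ (S : Set Atom) (Q : Finset Atom) : Prop := ∃ σ : Subst, IsHom σ ↑Q S

/-- `⟨𝓡, F⟩ ⊨ Q`: every model of the KB entails `Q`. -/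
def KBEntails (𝓡 : RuleSet) (F : FactBase) (Q : Finset Atom) : Prop :=
  ∀ M : Set Atom, IsModelOfKB 𝓡 F M → EntailsQ M Q

/-- `R(F)`: the minimal atom set including `F` and `out(t)` for every trigger `t`
with rule `R` on `F`. -/
def ruleStep (R : Rule) (S : Set Atom) : Set Atom :=
  S ∪ {a | ∃ t : Trigger, t.rule = R ∧ IsHom t.map ↑R.body S ∧ a ∈ t.out}

/-- `𝓡(F) = ⋃_{R ∈ 𝓡} R(F)` (together with `F`). -/
def setStep (𝓡 : RuleSet) (S : Set Atom) : Set Atom := S ∪ ⋃ R ∈ 𝓡, ruleStep R S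

/-- The breadth-first chase `Ch_i(⟨𝓡, F⟩)`. -/
def ch (𝓡 : RuleSet) (F : FactBase) : ℕ → Set Atom
  | 0 => ↑F
  | i + 1 => setStep 𝓡 (ch 𝓡 F i)

/-- The bounded derivation depth property. -/
def BDDP (𝓡 : RuleSet) : Prop :=
  ∀ Q : Finset Atom, ∃ k : ℕ, ∀ F : FactBase, KBEntails 𝓡 F Q ↔ EntailsQ (ch 𝓡 F k) Q

/-! ### Conservative extensions -/

/-- The restriction of an atom set to the atoms over a given set of predicates. -/
def restrictTo (M : Set Atom) (P : Set ℕ) : Set Atom := {a ∈ M | a.pred ∈ P}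

/-- The terms (domain elements) of an atom set. -/
def termsOf (M : Set Atom) : Set Term := {u | ∃ a ∈ M, u ∈ a.args}

/-- `𝓡'` is a conservative extension of `𝓡`. -/
def ConservativeExt (𝓡 𝓡' : RuleSet) : Prop :=
  (↑(RuleSet.predsF 𝓡) : Set ℕ) ⊆ ↑(RuleSet.predsF 𝓡') ∧
  (∀ M : Set Atom, IsModelOfRules 𝓡' M →
    IsModelOfRules 𝓡 (restrictTo M ↑(RuleSet.predsF 𝓡))) ∧
  (∀ M : Set Atom, IsModelOfRules 𝓡 M →
    ∃ M' : Set Atom, M ⊆ M' ∧ IsModelOfRules 𝓡' M' ∧ termsOf M' = termsOf M ∧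
      restrictTo M' ↑(RuleSet.predsF 𝓡) = restrictTo M ↑(RuleSet.predsF 𝓡))

/-- `𝓡'` is a universal-conservative extension of `𝓡`. -/
def UnivConservativeExt (𝓡 𝓡' : RuleSet) : Prop :=
  (↑(RuleSet.predsF 𝓡) : Set ℕ) ⊆ ↑(RuleSet.predsF 𝓡') ∧
  ∀ F : FactBase, (∀ a ∈ F, a.pred ∈ RuleSet.predsF 𝓡) →
    (∀ M : Set Atom, IsUniversalModel 𝓡' F M →
      IsUniversalModel 𝓡 F (restrictTo M ↑(RuleSet.predsF 𝓡))) ∧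
    (∀ M : Set Atom, IsUniversalModel 𝓡 F M →
      ∃ M' : Set Atom, M ⊆ M' ∧ IsUniversalModel 𝓡' F M' ∧ termsOf M' = termsOf M ∧
        restrictTo M' ↑(RuleSet.predsF 𝓡) = restrictTo M ↑(RuleSet.predsF 𝓡))

/-! ### Substitutions and variables -/

@[simp] theorem applyTerm_const (σ : Subst) (c : ℕ) : applyTerm σ (.const c) = .const c := rfl

@[simp] theorem applyTerm_var (σ : Subst) (v : ℕ) : applyTerm σ (.var v) = σ v := rfl

theorem Atom.mem_vars {a : Atom} {v : ℕ} : v ∈ a.vars ↔ Term.var v ∈ a.args := by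
  obtain ⟨p, l⟩ := a
  simp only [Atom.vars]
  induction l with
  | nil => simp
  | cons t l ih =>
    simp only [List.foldr_cons, Finset.mem_union, ih, List.mem_cons]
    cases t <;> simp [Term.vars]

theorem FactBase.mem_vars {F : FactBase} {v : ℕ} :
    v ∈ FactBase.vars F ↔ ∃ a ∈ F, Term.var v ∈ a.args := by
  simp [FactBase.vars, Finset.mem_sup, Atom.mem_vars]

theorem FactBase.vars_mono {F G : FactBase} (h : F ⊆ G) : FactBase.vars F ⊆ FactBase.vars G :=
  Finset.sup_mono h

theorem FactBase.vars_union (F G : FactBase) :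
    FactBase.vars (F ∪ G) = FactBase.vars F ∪ FactBase.vars G :=
  Finset.sup_union

theorem mem_setVars {F : FactBase} {v : ℕ} : v ∈ setVars (F : Set Atom) ↔ v ∈ FactBase.vars F := by
  simp [setVars, FactBase.mem_vars, Atom.mem_vars]

theorem Atom.subst_congr {σ τ : Subst} {a : Atom} (h : ∀ v, Term.var v ∈ a.args → σ v = τ v) :
    a.subst σ = a.subst τ := by
  simp only [Atom.subst, Atom.mk.injEq, true_and]
  apply List.map_congr_left
  intro t ht
  cases t with
  | const c => rfl
  | var v => exact h v ht

theorem Atom.subst_var (a : Atom) : a.subst Term.var = a := by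
  obtain ⟨p, l⟩ := a
  simp only [Atom.subst, Atom.mk.injEq, true_and]
  conv_rhs => rw [← List.map_id l]
  apply List.map_congr_left
  intro t _
  cases t <;> rfl

theorem Atom.subst_eq_self {σ : Subst} {a : Atom}
    (h : ∀ v, Term.var v ∈ a.args → σ v = Term.var v) : a.subst σ = a := by
  rw [Atom.subst_congr h, Atom.subst_var]

theorem isHom_congr {σ τ : Subst} {F : FactBase} {S : Set Atom}
    (h : ∀ v ∈ FactBase.vars F, σ v = τ v) : IsHom σ (F : Set Atom) S ↔ IsHom τ (F : Set Atom) S := by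
  refine forall₂_congr fun a ha => ?_
  rw [Atom.subst_congr fun v hv => h v (FactBase.mem_vars.2 ⟨a, ha, hv⟩)]

/-! ### Restricted applicability -/

theorem applicable_iff {t : Trigger} {F : FactBase} :
    Applicable .R t F ↔
      ¬ ∃ σ : Subst, (∀ v ∈ FactBase.vars F, σ v = .var v) ∧ ∀ a ∈ t.out, a.subst σ ∈ F := by
  refine not_congr (exists_congr fun σ => ?_)
  constructor
  · rintro ⟨h1, h2⟩
    refine ⟨fun v hv => h2 v ?_ (mem_setVars.2 hv), fun a ha => by
      simpa using h1 a (by simp [ha])⟩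
    exact mem_setVars.2 (FactBase.vars_mono Finset.subset_union_left hv)
  · rintro ⟨h1, h2⟩
    refine ⟨fun a ha => ?_, fun v _ hv => h1 v (mem_setVars.1 hv)⟩
    rcases Finset.mem_union.1 (Finset.mem_coe.1 ha) with ha | ha
    · rw [Atom.subst_eq_self fun v hv => h1 v (FactBase.mem_vars.2 ⟨a, ha, hv⟩)]
      exact ha
    · exact h2 a ha

theorem Applicable.not_subset {t : Trigger} {F : FactBase} (h : Applicable .R t F) :
    ¬ t.out ⊆ F := fun hs =>
  applicable_iff.1 h ⟨Term.var, fun _ _ => rfl, fun a ha => by rw [Atom.subst_var]; exact hs ha⟩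

/-- Two triggers with the same rule that agree on the body variables. -/
def Trigger.Equiv (t s : Trigger) : Prop :=
  t.rule = s.rule ∧ ∀ v ∈ FactBase.vars t.rule.body, t.map v = s.map v

theorem Trigger.Equiv.freshVar {t s : Trigger} (h : t.Equiv s) (z : ℕ) :
    t.freshVar z = s.freshVar z := by
  obtain ⟨R, π⟩ := t
  obtain ⟨R', π'⟩ := s
  obtain ⟨h1, h2⟩ := h
  simp only at h1 h2
  subst h1
  simp only [Trigger.freshVar]
  congr 3
  exact List.map_congr_left fun v hv => h2 v (by simpa using hv)

theorem Trigger.equiv_of_freshVar {t s : Trigger} {z z' : ℕ} (h : t.freshVar z = s.freshVar z') :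
    t.Equiv s ∧ z = z' := by
  obtain ⟨R, π⟩ := t
  obtain ⟨R', π'⟩ := s
  simp only [Trigger.freshVar, Nat.pair_eq_pair, Encodable.encode_inj, Prod.mk.injEq] at h
  obtain ⟨⟨rfl, h2⟩, h3⟩ := h
  refine ⟨⟨rfl, fun v hv => ?_⟩, h3⟩
  rw [List.map_inj_left] at h2
  exact h2 v (by simpa using hv)

theorem Rule.mem_head_vars {R : Rule} {a : Atom} {v : ℕ} (ha : a ∈ R.head)
    (hv : Term.var v ∈ a.args) : v ∈ R.exVars ∨ v ∈ FactBase.vars R.body := by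
  by_cases h : v ∈ FactBase.vars R.body
  · exact .inr h
  · exact .inl (Finset.mem_sdiff.2 ⟨FactBase.mem_vars.2 ⟨a, ha, hv⟩, h⟩)

theorem Trigger.Equiv.out {t s : Trigger} (h : t.Equiv s) : t.out = s.out := by
  have hf := h.freshVar
  obtain ⟨R, π⟩ := t
  obtain ⟨R', π'⟩ := s
  obtain ⟨h1, h2⟩ := h
  simp only at h1 h2
  subst h1
  refine Finset.image_congr fun a ha => Atom.subst_congr fun v hv => ?_
  simp only [Trigger.ext]
  split_ifs with hx
  · rw [hf]
  · exact h2 v ((Rule.mem_head_vars ha hv).resolve_left hx)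

theorem Trigger.Equiv.isOn {t s : Trigger} (h : t.Equiv s) (F : FactBase) :
    t.IsOn F ↔ s.IsOn F := by
  obtain ⟨R, π⟩ := t
  obtain ⟨R', π'⟩ := s
  obtain ⟨h1, h2⟩ := h
  simp only at h1 h2
  subst h1
  exact isHom_congr h2

theorem Trigger.Equiv.applicable {t s : Trigger} (h : t.Equiv s) (F : FactBase) :
    Applicable .R t F ↔ Applicable .R s F := by
  rw [applicable_iff, applicable_iff, h.out]

theorem Trigger.Equiv.symm {t s : Trigger} (h : t.Equiv s) : s.Equiv t :=
  ⟨h.1.symm, fun v hv => (h.2 v (h.1 ▸ hv)).symm⟩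

/-- The substitution sending the `i`-th element of `vs` to the `i`-th element of `ts`. -/
def assign (vs : List ℕ) (ts : List Term) : Subst := fun v => ts.getD (vs.idxOf v) (.const 0)

theorem assign_map {vs : List ℕ} {σ : Subst} {v : ℕ} (h : v ∈ vs) :
    assign vs (vs.map σ) v = σ v := by
  have h1 : vs.idxOf v < vs.length := List.idxOf_lt_length_iff.2 h
  simp [assign, List.getD_eq_getElem?_getD, h1]

/-- The sorted list of the variables of a factbase. -/
def FactBase.varList (F : FactBase) : List ℕ := (FactBase.vars F).sort (· ≤ ·)

theorem FactBase.mem_varList {F : FactBase} {v : ℕ} :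
    v ∈ FactBase.varList F ↔ v ∈ FactBase.vars F := by
  simp [FactBase.varList]

/-- The trigger with the given rule and list of images of the body variables. -/
def Trigger.ofCode (c : Rule × List Term) : Trigger :=
  ⟨c.1, assign (FactBase.varList c.1.body) c.2⟩

theorem Trigger.equiv_ofCode (t : Trigger) :
    t.Equiv (Trigger.ofCode (t.rule, (FactBase.varList t.rule.body).map t.map)) :=
  ⟨rfl, fun _ hv => (assign_map (FactBase.mem_varList.2 hv)).symm⟩

/-! ### Runs -/

/-- `t` yields a step of a restricted chase from `F`. -/
def CanApply (𝓡 : RuleSet) (F : FactBase) (t : Trigger) : Prop :=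
  t.rule ∈ 𝓡 ∧ t.IsOn F ∧ Applicable .R t F

/-- An infinite restricted derivation. -/
def IsRun (𝓡 : RuleSet) (fb : ℕ → FactBase) (tr : ℕ → Trigger) : Prop :=
  ∀ i, CanApply 𝓡 (fb i) (tr i) ∧ fb (i + 1) = fb i ∪ (tr i).out

/-- Fairness of an infinite restricted derivation. -/
def FairRun (𝓡 : RuleSet) (fb : ℕ → FactBase) : Prop :=
  ∀ i t, CanApply 𝓡 (fb i) t → ∃ j, i < j ∧ ¬ Applicable .R t (fb j)

theorem not_CTall_iff {𝓡 : RuleSet} :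
    ¬ CTall .R 𝓡 ↔ ∃ fb tr, IsRun 𝓡 fb tr ∧ FairRun 𝓡 fb := by
  simp only [CTall, Derivation.Finite, not_forall, not_not]
  constructor
  · rintro ⟨F, D, hX, hf, hl⟩
    have hlt : ∀ i : ℕ, (i : ℕ∞) < D.len := fun i => by rw [hl]; exact ENat.natCast_lt_top i
    refine ⟨D.fb, D.tr, fun i => ⟨⟨D.rule_mem i (hlt i), D.trig_on i (hlt i), hX i (hlt i)⟩,
      D.fb_succ i (hlt i)⟩, fun i t ht => ?_⟩
    obtain ⟨j, hj, _, h⟩ := hf i (hlt i).le t ht.1 ht.2.1 ht.2.2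
    exact ⟨j, hj, h⟩
  · rintro ⟨fb, tr, hr, hf⟩
    refine ⟨fb 0, ⟨⊤, fb, tr, rfl, fun i _ => (hr i).1.1, fun i _ => (hr i).1.2.1,
      fun i _ => (hr i).1.2.2.not_subset, fun i _ => (hr i).2,
      fun i h => absurd (ENat.natCast_lt_top i) h⟩, fun i _ => (hr i).1.2.2, ?_, rfl⟩
    intro i _ t h1 h2 h3
    obtain ⟨j, hj, h⟩ := hf i t ⟨h1, h2, h3⟩
    exact ⟨j, hj, le_top, h⟩

/-- One step of the restricted chase. -/
def Step (𝓡 : RuleSet) (F G : FactBase) : Prop := ∃ t, CanApply 𝓡 F t ∧ G = F ∪ t.out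

theorem exists_path_of_transGen {α : Type*} {r : α → α → Prop} {a b : α}
    (h : Relation.TransGen r a b) :
    ∃ (n : ℕ) (p : ℕ → α), p 0 = a ∧ p (n + 1) = b ∧ ∀ i ≤ n, r (p i) (p (i + 1)) := by
  induction h with
  | single h =>
    rename_i b
    refine ⟨0, fun i => if i = 0 then a else b, by simp, by simp, fun i hi => ?_⟩
    obtain rfl : i = 0 := by omega
    simpa using h
  | tail _ h ih =>
    rename_i b c _
    obtain ⟨n, p, h0, h1, h2⟩ := ih
    refine ⟨n + 1, fun i => if i ≤ n + 1 then p i else c, by simp [h0], by simp, fun i hi => ?_⟩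
    rcases Nat.lt_or_ge i (n + 1) with hlt | hge
    · simp only [if_pos hi, if_pos (show i + 1 ≤ n + 1 by omega)]
      exact h2 i (by omega)
    · obtain rfl : i = n + 1 := by omega
      simpa [h1] using h

/-- A sequence related by the transitive closure of `r` extends to an `r`-sequence. -/
theorem exists_seq_of_transGen {α : Type*} {r : α → α → Prop} {H : ℕ → α}
    (h : ∀ k, Relation.TransGen r (H k) (H (k + 1))) :
    ∃ (f : ℕ → α) (φ : ℕ → ℕ), StrictMono φ ∧ (∀ i, r (f i) (f (i + 1))) ∧
      ∀ k, f (φ k) = H k := by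
  choose n p h0 h1 h2 using fun k => exists_path_of_transGen (h k)
  let nxt : ℕ × ℕ → ℕ × ℕ := fun s => if s.2 < n s.1 then (s.1, s.2 + 1) else (s.1 + 1, 0)
  let st : ℕ → ℕ × ℕ := fun i => nxt^[i] (0, 0)
  have hst : ∀ i, st (i + 1) = nxt (st i) := fun i => Function.iterate_succ_apply' _ _ _
  have hle : ∀ i, (st i).2 ≤ n (st i).1 := by
    intro i
    induction i with
    | zero => simp [st]
    | succ i ih =>
      rw [hst]
      simp only [nxt]
      split_ifs with hlt
      · exact hlt
      · exact Nat.zero_le _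
  let φ : ℕ → ℕ := fun k => Nat.rec 0 (fun k m => m + (n k + 1)) k
  have hφ : ∀ k, φ (k + 1) = φ k + (n k + 1) := fun k => rfl
  have key : ∀ k, st (φ k) = (k, 0) ∧ ∀ j ≤ n k, st (φ k + j) = (k, j) := by
    have aux : ∀ k, st (φ k) = (k, 0) → ∀ j ≤ n k, st (φ k + j) = (k, j) := by
      intro k hk j
      induction j with
      | zero => intro _; simpa using hk
      | succ j ih =>
        intro hj
        rw [← add_assoc, hst, ih (by omega)]
        simp only [nxt]
        rw [if_pos (by omega)]
    intro k
    induction k with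
    | zero => exact ⟨rfl, aux 0 rfl⟩
    | succ k ih =>
      have : st (φ (k + 1)) = (k + 1, 0) := by
        rw [hφ, ← add_assoc, hst, ih.2 _ le_rfl]
        simp [nxt]
      exact ⟨this, aux _ this⟩
  refine ⟨fun i => p (st i).1 (st i).2, φ, strictMono_nat_of_lt_succ fun k => by rw [hφ]; omega,
    fun i => ?_, fun k => by simp [(key k).1, h0]⟩
  have := h2 (st i).1 (st i).2 (hle i)
  convert this using 1
  change p (st (i + 1)).1 (st (i + 1)).2 = _
  rw [hst]
  simp only [nxt]
  split_ifs with hlt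
  · rfl
  · have : (st i).2 = n (st i).1 := le_antisymm (hle i) (not_lt.1 hlt)
    rw [this, h1, h0]

/-- If from every live factbase one can reach, for any given trigger, another live factbase on
which this trigger is not applicable, then there is an infinite fair derivation. -/
theorem not_CTall_of_live {𝓡 : RuleSet} (Live : FactBase → Prop) {F : FactBase} (hF : Live F)
    (h : ∀ G, Live G → ∀ t, ∃ G', Live G' ∧ Relation.TransGen (Step 𝓡) G G' ∧
      (CanApply 𝓡 G t → ¬ Applicable .R t G')) : ¬ CTall .R 𝓡 := by
  have : Nonempty (Rule × List Term) :=
    ⟨⟨{⟨0, []⟩}, {⟨0, []⟩}, Finset.singleton_nonempty _, Finset.singleton_nonempty _⟩, []⟩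
  obtain ⟨e, he⟩ := exists_surjective_nat (Rule × List Term)
  choose nx hl ht hn using fun (G : {G // Live G}) (k : ℕ) =>
    h G.1 G.2 (Trigger.ofCode (e k.unpair.1))
  let H : ℕ → {G // Live G} := fun k => Nat.rec ⟨F, hF⟩ (fun k G => ⟨nx G k, hl G k⟩) k
  have hH : ∀ k, (H (k + 1)).1 = nx (H k) k := fun k => rfl
  obtain ⟨f, φ, hφ, hs, hk⟩ := exists_seq_of_transGen (H := fun k => (H k).1)
    fun k => by rw [hH]; exact ht _ _
  choose tr htr using hs
  refine not_CTall_iff.2 ⟨f, tr, htr, fun i t hi => ?_⟩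
  obtain ⟨c, hc⟩ := he (t.rule, (FactBase.varList t.rule.body).map t.map)
  have hφk : Nat.pair c i ≤ φ (Nat.pair c i) := hφ.le_apply
  have hik : i ≤ φ (Nat.pair c i) := (Nat.right_le_pair c i).trans hφk
  have hlt : i < φ (Nat.pair c i + 1) := lt_of_le_of_lt hik (hφ (Nat.lt_succ_self _))
  have heq := t.equiv_ofCode
  by_cases ha : CanApply 𝓡 (f (φ (Nat.pair c i))) t
  · refine ⟨_, hlt, ?_⟩
    rw [hk, hH, heq.applicable]
    have := hn (H (Nat.pair c i)) (Nat.pair c i)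
    rw [Nat.unpair_pair, hc] at this
    apply this
    rw [hk] at ha
    exact ⟨heq.1 ▸ ha.1, (heq.isOn _).1 ha.2.1, (heq.applicable _).1 ha.2.2⟩
  · have hmono : Monotone f := monotone_nat_of_le_succ fun i => by
      rw [(htr i).2]; exact Finset.subset_union_left
    have hne : i ≠ φ (Nat.pair c i) := fun h' => ha (h' ▸ hi)
    exact ⟨_, lt_of_le_of_ne hik hne, fun hap => ha ⟨hi.1, fun a h' => hmono hik (hi.2.1 a h'), hap⟩⟩

/-! ### Infinite runs -/

theorem IsRun.mono {𝓡 : RuleSet} {fb : ℕ → FactBase} {tr : ℕ → Trigger} (h : IsRun 𝓡 fb tr) :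
    Monotone fb :=
  monotone_nat_of_le_succ fun i => by rw [(h i).2]; exact Finset.subset_union_left

theorem IsRun.shift {𝓡 : RuleSet} {fb : ℕ → FactBase} {tr : ℕ → Trigger} (h : IsRun 𝓡 fb tr)
    (k : ℕ) : IsRun 𝓡 (fun i => fb (k + i)) (fun i => tr (k + i)) := fun i => h (k + i)

theorem IsRun.reflTransGen {𝓡 : RuleSet} {fb : ℕ → FactBase} {tr : ℕ → Trigger}
    (h : IsRun 𝓡 fb tr) (n : ℕ) : Relation.ReflTransGen (Step 𝓡) (fb 0) (fb n) := by
  induction n with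
  | zero => exact .refl
  | succ n ih => exact ih.tail ⟨tr n, (h n).1, (h n).2⟩

theorem IsRun.out_subset {𝓡 : RuleSet} {fb : ℕ → FactBase} {tr : ℕ → Trigger}
    (h : IsRun 𝓡 fb tr) {i j : ℕ} (hij : i < j) : (tr i).out ⊆ fb j :=
  fun a ha => h.mono (Nat.succ_le_of_lt hij) (by rw [(h i).2]; exact Finset.mem_union_right _ ha)

theorem IsRun.not_equiv {𝓡 : RuleSet} {fb : ℕ → FactBase} {tr : ℕ → Trigger}
    (h : IsRun 𝓡 fb tr) {i j : ℕ} (hij : i < j) : ¬ (tr i).Equiv (tr j) := fun he =>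
  (h j).1.2.2.not_subset (he.out ▸ h.out_subset hij)

theorem Trigger.mem_out {t : Trigger} {b : Atom} :
    b ∈ t.out ↔ ∃ a ∈ t.rule.head, a.subst t.ext = b := by
  simp [Trigger.out]

theorem Trigger.ext_exVar {t : Trigger} {v : ℕ} (h : v ∈ t.rule.exVars) :
    t.ext v = .var (t.freshVar v) := if_pos h

theorem Trigger.ext_body {t : Trigger} {v : ℕ} (h : v ∈ FactBase.vars t.rule.body) :
    t.ext v = t.map v := if_neg fun h' => (Finset.mem_sdiff.1 h').2 h

theorem Trigger.IsOn.map_mem {t : Trigger} {F : FactBase} (h : t.IsOn F) {v w : ℕ}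
    (hv : v ∈ FactBase.vars t.rule.body) (hw : t.map v = .var w) : w ∈ FactBase.vars F := by
  obtain ⟨a, ha, hva⟩ := FactBase.mem_vars.1 hv
  refine FactBase.mem_vars.2 ⟨_, h a ha, ?_⟩
  rw [← hw]
  exact List.mem_map_of_mem (f := applyTerm t.map) hva

theorem Trigger.IsOn.vars_out {t : Trigger} {F : FactBase} (h : t.IsOn F) {v : ℕ}
    (hv : v ∈ FactBase.vars t.out) :
    v ∈ FactBase.vars F ∨ ∃ z ∈ t.rule.exVars, v = t.freshVar z := by
  obtain ⟨b, hb, hvb⟩ := FactBase.mem_vars.1 hv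
  obtain ⟨a, ha, rfl⟩ := Trigger.mem_out.1 hb
  obtain ⟨u, hu, huv⟩ := List.mem_map.1 hvb
  cases u with
  | const c => cases huv
  | var w =>
    change t.ext w = _ at huv
    rcases Rule.mem_head_vars ha hu with hw | hw
    · rw [Trigger.ext_exVar hw] at huv
      exact .inr ⟨w, hw, (Term.var.inj huv).symm⟩
    · rw [Trigger.ext_body hw] at huv
      exact .inl (h.map_mem hw huv)

theorem IsRun.vars {𝓡 : RuleSet} {fb : ℕ → FactBase} {tr : ℕ → Trigger}
    (h : IsRun 𝓡 fb tr) {j v : ℕ} (hv : v ∈ FactBase.vars (fb j)) :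
    v ∈ FactBase.vars (fb 0) ∨ ∃ i < j, ∃ z, v = (tr i).freshVar z := by
  induction j with
  | zero => exact .inl hv
  | succ j ih =>
    have key : v ∈ FactBase.vars (fb j) →
        v ∈ FactBase.vars (fb 0) ∨ ∃ i < j + 1, ∃ z, v = (tr i).freshVar z := fun hv =>
      (ih hv).imp_right fun ⟨i, hi, hz⟩ => ⟨i, hi.trans (Nat.lt_succ_self j), hz⟩
    rw [(h j).2, FactBase.vars_union, Finset.mem_union] at hv
    rcases hv with hv | hv
    · exact key hv
    · rcases (h j).1.2.1.vars_out hv with hv | ⟨z, _, hz⟩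
      · exact key hv
      · exact .inr ⟨j, Nat.lt_succ_self j, z, hz⟩

/-- From some point on, the fresh variables of a run do not occur in the current factbase. -/
theorem IsRun.exists_fresh {𝓡 : RuleSet} {fb : ℕ → FactBase} {tr : ℕ → Trigger}
    (h : IsRun 𝓡 fb tr) : ∃ k, ∀ j ≥ k, ∀ z, (tr j).freshVar z ∉ FactBase.vars (fb j) := by
  have hfin : {j | ∃ z, (tr j).freshVar z ∈ FactBase.vars (fb 0)}.Finite := by
    have : ∀ j : {j | ∃ z, (tr j).freshVar z ∈ FactBase.vars (fb 0)}, ∃ v : FactBase.vars (fb 0),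
        ∃ z, (tr j).freshVar z = v.1 := fun ⟨j, z, hz⟩ => ⟨⟨_, hz⟩, z, rfl⟩
    choose f z hz using this
    refine Set.finite_coe_iff.1 (Finite.of_injective f fun i j hij => ?_)
    have he := (Trigger.equiv_of_freshVar ((hz i).trans (by rw [hij, hz j]))).1
    rcases lt_trichotomy i.1 j.1 with hlt | heq | hlt
    · exact absurd he (h.not_equiv hlt)
    · exact Subtype.ext heq
    · exact absurd he.symm (h.not_equiv hlt)
  obtain ⟨k, hk⟩ := hfin.bddAbove
  refine ⟨k + 1, fun j hj z hz => ?_⟩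
  rcases h.vars hz with hv | ⟨i, hi, z', hz'⟩
  · exact absurd (hk ⟨z, hv⟩) (by omega)
  · exact h.not_equiv hi (Trigger.equiv_of_freshVar hz').1.symm

/-- There is an infinite run starting from `F`. -/
def HasRun (𝓡 : RuleSet) (F : FactBase) : Prop := ∃ fb tr, IsRun 𝓡 fb tr ∧ fb 0 = F

/-- With atomic heads, a trigger blocked by the addition of an atom determines the images of its
frontier variables. -/
theorem blocked_unique {𝓡 : RuleSet} {fb : ℕ → FactBase} {tr : ℕ → Trigger} (h : IsRun 𝓡 fb tr)
    {t : Trigger} {a : Atom} (hto : t.out = {a}) {i j : ℕ} (hij : i < j)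
    (hat : ∀ R ∈ 𝓡, R.IsAtomicHead) (hr : (tr i).rule = (tr j).rule)
    (hf : ∀ z, (tr j).freshVar z ∉ FactBase.vars (fb j))
    (hi : ¬ Applicable .R (tr i) (fb i ∪ t.out)) (hj : ¬ Applicable .R (tr j) (fb j ∪ t.out)) :
    False := by
  have image : ∀ i, ¬ Applicable .R (tr i) (fb i ∪ t.out) → ∃ σ : Subst,
      (∀ v ∈ FactBase.vars (fb i), σ v = .var v) ∧
      ∀ b ∈ (tr i).rule.head, (b.subst (tr i).ext).subst σ = a := by
    intro i hi
    rw [applicable_iff, not_not] at hi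
    obtain ⟨σ, h1, h2⟩ := hi
    have h1' : ∀ v ∈ FactBase.vars (fb i), σ v = .var v := fun v hv =>
      h1 v (FactBase.vars_mono Finset.subset_union_left hv)
    refine ⟨σ, h1', fun b hb => ?_⟩
    obtain ⟨c, hc⟩ := Finset.card_eq_one.1 (hat _ (h i).1.1)
    rw [hc, Finset.mem_singleton] at hb
    subst hb
    have hout : (tr i).out = {b.subst (tr i).ext} := by rw [Trigger.out, hc, Finset.image_singleton]
    rw [hout] at h2
    rcases Finset.mem_union.1 (h2 _ (Finset.mem_singleton_self _)) with hm | hm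
    · exact absurd ⟨σ, h1', fun x hx => by
        rw [hout, Finset.mem_singleton] at hx; rwa [hx]⟩ (applicable_iff.1 (h i).1.2.2)
    · rwa [hto, Finset.mem_singleton] at hm
  obtain ⟨σ, hσ, hσa⟩ := image i hi
  obtain ⟨τ, hτ, hτa⟩ := image j hj
  have frontier : ∀ b ∈ (tr i).rule.head, ∀ v, Term.var v ∈ b.args →
      v ∈ FactBase.vars (tr i).rule.body → (tr i).map v = (tr j).map v := by
    intro b hb v hv hvb
    have heq := (hσa b hb).trans (hτa b (hr ▸ hb)).symm
    simp only [Atom.subst, Atom.mk.injEq, true_and, List.map_map, List.map_inj_left] at heq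
    have := heq _ hv
    change applyTerm σ ((tr i).ext v) = applyTerm τ ((tr j).ext v) at this
    rw [Trigger.ext_body hvb, Trigger.ext_body (hr ▸ hvb)] at this
    have fix : ∀ k (σ : Subst), (∀ v ∈ FactBase.vars (fb k), σ v = .var v) →
        v ∈ FactBase.vars (tr k).rule.body → applyTerm σ ((tr k).map v) = (tr k).map v := by
      intro k σ hσ hv
      cases hw : (tr k).map v with
      | const c => rfl
      | var w => exact hσ w ((h k).1.2.1.map_mem hv hw)
    rwa [fix i σ hσ hvb, fix j τ hτ (hr ▸ hvb)] at this
  refine applicable_iff.1 (h j).1.2.2 ⟨fun v => if ∃ z, v = (tr j).freshVar z then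
    .var ((tr i).freshVar v.unpair.2) else .var v, fun v hv => ?_, fun x hx => ?_⟩
  · refine if_neg ?_
    rintro ⟨z, rfl⟩
    exact hf z hv
  · obtain ⟨b, hb, rfl⟩ := Trigger.mem_out.1 hx
    refine h.out_subset hij (Trigger.mem_out.2 ⟨b, hr ▸ hb, ?_⟩)
    simp only [Atom.subst, Atom.mk.injEq, true_and, List.map_map, List.map_inj_left]
    intro u hu
    cases u with
    | const c => rfl
    | var v =>
      simp only [Function.comp, applyTerm]
      rcases Rule.mem_head_vars hb hu with hv | hv
      · rw [Trigger.ext_exVar hv, Trigger.ext_exVar (hr ▸ hv)]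
        simp only
        rw [if_pos ⟨v, rfl⟩]
        simp [Trigger.freshVar]
      · rw [Trigger.ext_body hv, Trigger.ext_body (hr ▸ hv),
          frontier b (hr ▸ hb) v hu (hr ▸ hv)]
        cases hw : (tr j).map v with
        | const c => rfl
        | var w =>
          refine (if_neg ?_).symm
          rintro ⟨z, rfl⟩
          exact hf z ((h j).1.2.1.map_mem hv hw)

theorem HasRun.insert {𝓡 : RuleSet} (hat : ∀ R ∈ 𝓡, R.IsAtomicHead) {F : FactBase}
    (hF : HasRun 𝓡 F) {t : Trigger} (ht : CanApply 𝓡 F t) :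
    ∃ G, HasRun 𝓡 G ∧ Relation.TransGen (Step 𝓡) F G ∧ ¬ Applicable .R t G := by
  obtain ⟨fb, tr, h, rfl⟩ := hF
  by_cases hall : ∃ j, ¬ Applicable .R t (fb j)
  · obtain ⟨j, hj⟩ := hall
    cases j with
    | zero => exact absurd ht.2.2 hj
    | succ j =>
      exact ⟨fb (j + 1), ⟨_, _, h.shift (j + 1), rfl⟩,
        .tail' (h.reflTransGen j) ⟨tr j, (h j).1, (h j).2⟩, hj⟩
  push Not at hall
  obtain ⟨b, hb⟩ := Finset.card_eq_one.1 (hat _ ht.1)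
  have hto : t.out = {b.subst t.ext} := by rw [Trigger.out, hb, Finset.image_singleton]
  obtain ⟨k, hk⟩ := h.exists_fresh
  have hfin : {j | k ≤ j ∧ ¬ Applicable .R (tr j) (fb j ∪ t.out)}.Finite := by
    refine Set.Finite.of_injOn (f := fun j => (tr j).rule) (t := (𝓡 : Set Rule))
      (fun j _ => (h j).1.1) (fun i hi j hj hr => ?_) (Finset.finite_toSet 𝓡)
    rcases lt_trichotomy i j with hlt | heq | hlt
    · exact (blocked_unique h hto hlt hat hr (hk j hj.1) hi.2 hj.2).elim
    · exact heq
    · exact (blocked_unique h hto hlt hat hr.symm (hk i hi.1) hj.2 hi.2).elim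
  obtain ⟨n, hn⟩ := hfin.bddAbove
  let m := n + k + 1
  have happ : ∀ i, Applicable .R (tr (m + i)) (fb (m + i) ∪ t.out) := fun i => by
    by_contra hc
    have := hn ⟨show k ≤ m + i by omega, hc⟩
    omega
  have hon : ∀ j, t.IsOn (fb j) := fun j a ha => h.mono (Nat.zero_le j) (ht.2.1 a ha)
  refine ⟨fb m ∪ t.out, ⟨fun i => fb (m + i) ∪ t.out, fun i => tr (m + i), fun i =>
    ⟨⟨(h _).1.1, fun a ha => Finset.mem_union_left _ ((h _).1.2.1 a ha), happ i⟩, ?_⟩, rfl⟩,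
    .tail' (h.reflTransGen m) ⟨t, ⟨ht.1, hon m, hall m⟩, rfl⟩,
    fun hc => hc.not_subset Finset.subset_union_right⟩
  change fb (m + i + 1) ∪ t.out = fb (m + i) ∪ t.out ∪ (tr (m + i)).out
  rw [(h (m + i)).2, Finset.union_right_comm]

/-- For atomic-head rule sets, an infinite restricted derivation yields a fair one. -/
theorem not_CTall_of_run {𝓡 : RuleSet} (hat : ∀ R ∈ 𝓡, R.IsAtomicHead) {F : FactBase}
    (hF : HasRun 𝓡 F) : ¬ CTall .R 𝓡 := by
  refine not_CTall_of_live (HasRun 𝓡) hF fun G hG t => ?_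
  by_cases ht : CanApply 𝓡 G t
  · obtain ⟨G', h1, h2, h3⟩ := hG.insert hat ht
    exact ⟨G', h1, h2, fun _ => h3⟩
  · obtain ⟨fb, tr, h, rfl⟩ := hG
    exact ⟨fb 1, ⟨_, _, h.shift 1, rfl⟩, .single ⟨tr 0, (h 0).1, (h 0).2⟩, fun hc => absurd hc ht⟩

theorem CTall_iff_no_run {𝓡 : RuleSet} (hat : ∀ R ∈ 𝓡, R.IsAtomicHead) :
    CTall .R 𝓡 ↔ ∀ F, ¬ HasRun 𝓡 F := by
  refine ⟨fun h F hF => not_CTall_of_run hat hF h, fun h => ?_⟩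
  by_contra hc
  obtain ⟨fb, tr, hr, _⟩ := not_CTall_iff.1 hc
  exact h _ ⟨fb, tr, hr, rfl⟩

/-! ### Codes of finite sets -/

theorem sort_spec {α : Type*} {r : α → α → Prop} {_ : DecidableRel r} {_ : IsTrans α r}
    {_ : Std.Antisymm r} {_ : Std.Total r} (s : Multiset α) :
    (s.sort r : Multiset α) = s ∧ (s.sort r).Pairwise r :=
  ⟨Multiset.sort_eq s r, Multiset.pairwise_sort s r⟩

theorem encode_multiset {α : Type*} [Encodable α] (s : Multiset α) :
    ∃ l : List α, (l : Multiset α) = s ∧ Encodable.encode s = Encodable.encode l ∧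
      l.Pairwise (fun a b => Encodable.encode a ≤ Encodable.encode b) :=
  ⟨_, (sort_spec s).1, rfl, (sort_spec s).2⟩

theorem encode_finset {α : Type*} [Encodable α] (s : Finset α) :
    ∃ l : List α, (∀ a, a ∈ l ↔ a ∈ s) ∧ l.Nodup ∧ Encodable.encode s = Encodable.encode l ∧
      l.Pairwise (fun a b => Encodable.encode a ≤ Encodable.encode b) := by
  obtain ⟨l, h1, h2, h3⟩ := encode_multiset s.1
  refine ⟨l, fun a => by rw [← Finset.mem_val, ← h1]; simp, ?_, h2 ▸ rfl, h3⟩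
  have := s.2
  rwa [← h1] at this

/-! ### The restricted chase on lists of atoms -/

def Term.varL : Term → List ℕ
  | .const _ => []
  | .var v => [v]

def varsL (l : List Atom) : List ℕ := l.flatMap fun a => a.args.flatMap Term.varL

def termsL (l : List Atom) : List Term := l.flatMap Atom.args

/-- The increasing list of the variables of a list of atoms. -/
def vlist (l : List Atom) : List ℕ := (List.range ((varsL l).sum + 1)).filter (· ∈ varsL l)

/-- All lists of length `k` over `L`. -/
def tuples (L : List Term) : ℕ → List (List Term)
  | 0 => [[]]
  | k + 1 => (tuples L k).flatMap fun ts => L.map (· :: ts)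

abbrev RuleL := List Atom × List Atom

def IsHomL (r : RuleL) (F : List Atom) (ts : List Term) : Prop :=
  ∀ a ∈ r.1, a.subst (assign (vlist r.1) ts) ∈ F

def extL (r : RuleL) (ts : List Term) : Subst := fun v =>
  if v ∈ vlist r.1 then assign (vlist r.1) ts v else .var (Nat.pair (Encodable.encode (r, ts)) v)

def outL (r : RuleL) (ts : List Term) : List Atom := r.2.map (Atom.subst (extL r ts))

def IsBlocking (F o : List Atom) (us : List Term) : Prop :=
  (∀ v ∈ vlist o, v ∈ varsL F → assign (vlist o) us v = .var v) ∧
    ∀ a ∈ o, a.subst (assign (vlist o) us) ∈ F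

def Blocked (F o : List Atom) : Prop :=
  ∃ us ∈ tuples (termsL F) (vlist o).length, IsBlocking F o us

def succsOf (r : RuleL) (F : List Atom) : List (List Atom) :=
  ((tuples (termsL F) (vlist r.1).length).filter
    fun ts => IsHomL r F ts ∧ ¬ Blocked F (outL r ts)).map fun ts => F ++ outL r ts

def succs (rs : List RuleL) (F : List Atom) : List (List Atom) := rs.flatMap (succsOf · F)

def levels (rs : List RuleL) (n : ℕ) (L : List (List Atom)) : List (List Atom) :=
  (fun L => L.flatMap (succs rs))^[n] L

theorem mem_varsL {l : List Atom} {v : ℕ} : v ∈ varsL l ↔ v ∈ FactBase.vars l.toFinset := by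
  simp only [varsL, List.mem_flatMap, FactBase.mem_vars, List.mem_toFinset]
  refine exists_congr fun a => and_congr_right fun _ => ⟨?_, fun h => ⟨_, h, by simp [Term.varL]⟩⟩
  rintro ⟨t, ht, hv⟩
  cases t <;> simp [Term.varL] at hv
  exact hv ▸ ht

theorem mem_termsL {l : List Atom} {t : Term} : t ∈ termsL l ↔ ∃ a ∈ l, t ∈ a.args := by
  simp [termsL]

theorem mem_vlist {l : List Atom} {v : ℕ} : v ∈ vlist l ↔ v ∈ FactBase.vars l.toFinset := by
  rw [← mem_varsL]
  simp only [vlist, List.mem_filter, List.mem_range, decide_eq_true_eq, and_iff_right_iff_imp]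
  exact fun h => Nat.lt_succ_of_le (List.le_sum_of_mem h)

theorem vlist_eq (l : List Atom) : vlist l = FactBase.varList l.toFinset := by
  refine List.Perm.eq_of_pairwise (le := (· ≤ ·)) (fun a b _ _ h h' => le_antisymm h h') ?_ ?_ ?_
  · exact ((List.pairwise_lt_range (n := _)).imp fun h => h.le).filter _
  · exact Finset.pairwise_sort _ _
  · refine (List.perm_ext_iff_of_nodup (List.nodup_range.filter _) (Finset.sort_nodup _ _)).2 ?_
    intro v
    exact mem_vlist.trans FactBase.mem_varList.symm

theorem mem_tuples {L : List Term} {k : ℕ} {ts : List Term} :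
    ts ∈ tuples L k ↔ ts.length = k ∧ ∀ t ∈ ts, t ∈ L := by
  induction k generalizing ts with
  | zero => simp +contextual [tuples]
  | succ k ih =>
    simp only [tuples, List.mem_flatMap, List.mem_map]
    constructor
    · rintro ⟨us, hus, t, ht, rfl⟩
      have := ih.1 hus
      simp [this.1, ht]
      exact this.2
    · rintro ⟨h1, h2⟩
      cases ts with
      | nil => simp at h1
      | cons t ts =>
        exact ⟨ts, ih.2 ⟨by simpa using h1, fun u hu => h2 u (by simp [hu])⟩, t, h2 t (by simp), rfl⟩

/-- A list representation of a rule with the same code. -/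
def RuleL.Repr (r : RuleL) (R : Rule) : Prop :=
  r.1.toFinset = R.body ∧ r.2.toFinset = R.head ∧ Encodable.encode R = Encodable.encode r

theorem RuleL.exists_repr (R : Rule) : ∃ r : RuleL, r.Repr R := by
  obtain ⟨B, hB, _, hB', _⟩ := encode_finset R.body
  obtain ⟨H, hH, _, hH', _⟩ := encode_finset R.head
  refine ⟨(B, H), by ext; simp [hB], by ext; simp [hH], ?_⟩
  change Nat.pair (Encodable.encode R.body) (Encodable.encode R.head) = _
  rw [hB', hH', Encodable.encode_prod_val]

/-- A list representation of a rule set. -/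
def ReprSet (rs : List RuleL) (𝓡 : RuleSet) : Prop :=
  (∀ R ∈ 𝓡, ∃ r ∈ rs, r.Repr R) ∧ ∀ r ∈ rs, ∃ R ∈ 𝓡, r.Repr R

theorem encode_map {α β : Type*} [Encodable α] [Encodable β] {f : α → β}
    (hf : ∀ a, Encodable.encode (f a) = Encodable.encode a) (l : List α) :
    Encodable.encode (l.map f) = Encodable.encode l := by
  induction l with
  | nil => rfl
  | cons a l ih => simp [Encodable.encode_list_cons, hf, ih]

theorem exists_reprSet (𝓡 : RuleSet) :
    ∃ rs, ReprSet rs 𝓡 ∧ Encodable.encode 𝓡 = Encodable.encode rs := by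
  obtain ⟨l, hl, _, hc, _⟩ := encode_finset 𝓡
  choose f hf using RuleL.exists_repr
  refine ⟨l.map f, ⟨fun R hR => ⟨f R, List.mem_map_of_mem ((hl R).2 hR), hf R⟩, fun r hr => ?_⟩, ?_⟩
  · obtain ⟨R, hR, rfl⟩ := List.mem_map.1 hr
    exact ⟨R, (hl R).1 hR, hf R⟩
  · rw [hc, encode_map fun R => (hf R).2.2.symm]

theorem isBlocking_iff {F o : List Atom} :
    Blocked F o ↔ ∃ σ : Subst, (∀ v ∈ FactBase.vars F.toFinset, σ v = .var v) ∧
      ∀ a ∈ o, a.subst σ ∈ F := by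
  constructor
  · rintro ⟨us, _, h1, h2⟩
    refine ⟨fun v => if v ∈ vlist o then assign (vlist o) us v else .var v, fun v hv => ?_,
      fun a ha => ?_⟩
    · simp only
      split_ifs with h
      · exact h1 v h (mem_varsL.2 hv)
      · rfl
    · rw [Atom.subst_congr (τ := assign (vlist o) us)]
      · exact h2 a ha
      · intro v hv
        exact if_pos (mem_vlist.2 (FactBase.mem_vars.2 ⟨a, by simpa using ha, hv⟩))
  · rintro ⟨σ, h1, h2⟩
    have hs : ∀ a ∈ o, a.subst (assign (vlist o) ((vlist o).map σ)) = a.subst σ := fun a ha =>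
      Atom.subst_congr fun v hv =>
        assign_map (mem_vlist.2 (FactBase.mem_vars.2 ⟨a, by simpa using ha, hv⟩))
    refine ⟨(vlist o).map σ, mem_tuples.2 ⟨by simp, fun t ht => ?_⟩, fun v hv hF => ?_,
      fun a ha => by rw [hs a ha]; exact h2 a ha⟩
    · obtain ⟨v, hv, rfl⟩ := List.mem_map.1 ht
      obtain ⟨a, ha, hva⟩ := FactBase.mem_vars.1 (mem_vlist.1 hv)
      rw [List.mem_toFinset] at ha
      exact mem_termsL.2 ⟨_, h2 a ha, List.mem_map_of_mem (f := applyTerm σ) hva⟩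
    · rw [assign_map hv, h1 v (mem_varsL.1 hF)]

theorem out_eq {r : RuleL} {t : Trigger} (h : r.Repr t.rule) {ts : List Term}
    (hts : ts = (vlist r.1).map t.map) : (outL r ts).toFinset = t.out := by
  subst hts
  have hv : ∀ v, v ∈ vlist r.1 ↔ v ∈ FactBase.vars t.rule.body := fun v => by
    rw [mem_vlist, h.1]
  rw [Trigger.out, ← h.2.1]
  ext b
  simp only [outL, List.mem_toFinset, List.mem_map, Finset.mem_image]
  refine exists_congr fun a => and_congr_right fun ha => ?_
  rw [Atom.subst_congr fun v hva => ?_]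
  simp only [extL]
  split_ifs with hb
  · rw [assign_map hb, Trigger.ext_body ((hv v).1 hb)]
  · rw [Trigger.ext_exVar ((Rule.mem_head_vars (h.2.1 ▸ List.mem_toFinset.2 ha) hva).resolve_right
      fun hc => hb ((hv v).2 hc)), Trigger.freshVar, vlist_eq, h.1,
      Encodable.encode_prod_val r, Encodable.encode_prod_val t.rule, h.2.2]
    rfl

theorem applicable_iff_blocked {t : Trigger} {F o : List Atom} (h : o.toFinset = t.out) :
    Applicable .R t F.toFinset ↔ ¬ Blocked F o := by
  rw [applicable_iff, isBlocking_iff, ← h]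
  simp only [List.mem_toFinset]

theorem step_iff {𝓡 : RuleSet} {rs : List RuleL} (h : ReprSet rs 𝓡) {F : List Atom}
    {G : FactBase} : Step 𝓡 F.toFinset G ↔ ∃ l ∈ succs rs F, l.toFinset = G := by
  simp only [succs, List.mem_flatMap, succsOf, List.mem_map, List.mem_filter, decide_eq_true_eq]
  constructor
  · rintro ⟨t, ⟨h1, h2, h3⟩, rfl⟩
    obtain ⟨r, hr, hR⟩ := h.1 _ h1
    have ho := out_eq (t := t) hR rfl
    have hs : ∀ a ∈ r.1, a.subst (assign (vlist r.1) ((vlist r.1).map t.map)) = a.subst t.map :=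
      fun a ha => Atom.subst_congr fun v hv =>
        assign_map (mem_vlist.2 (FactBase.mem_vars.2 ⟨a, by simpa using ha, hv⟩))
    have hon : ∀ a ∈ r.1, a.subst t.map ∈ F := fun a ha => by
      have := h2 a (by rw [← hR.1]; simpa using ha)
      simpa using this
    refine ⟨_, ⟨r, hr, (vlist r.1).map t.map, ⟨mem_tuples.2 ⟨by simp, fun u hu => ?_⟩,
      fun a ha => by rw [hs a ha]; exact hon a ha, (applicable_iff_blocked ho).1 h3⟩, rfl⟩, ?_⟩
    · obtain ⟨v, hv, rfl⟩ := List.mem_map.1 hu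
      obtain ⟨a, ha, hva⟩ := FactBase.mem_vars.1 (mem_vlist.1 hv)
      rw [List.mem_toFinset] at ha
      exact mem_termsL.2 ⟨_, hon a ha, List.mem_map_of_mem (f := applyTerm t.map) hva⟩
    · rw [List.toFinset_append, ho]
  · rintro ⟨_, ⟨r, hr, ts, ⟨h1, h2, h3⟩, rfl⟩, rfl⟩
    obtain ⟨R, hR, hrR⟩ := h.2 r hr
    have hts : ts = (vlist r.1).map (assign (vlist r.1) ts) := by
      refine List.ext_getElem (by simp [(mem_tuples.1 h1).1]) fun i hi hi' => ?_
      have hn : (vlist r.1).Nodup := List.nodup_range.filter _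
      simp only [List.getElem_map, assign]
      rw [hn.idxOf_getElem]
      simp [List.getD_eq_getElem?_getD, hi]
    have ho := out_eq (t := ⟨R, assign (vlist r.1) ts⟩) hrR hts
    refine ⟨⟨R, assign (vlist r.1) ts⟩, ⟨hR, fun a ha => ?_, (applicable_iff_blocked ho).2 h3⟩, ?_⟩
    · have := h2 a (by rw [← hrR.1] at ha; simpa using ha)
      simpa using this
    · rw [List.toFinset_append, ho]

theorem hasRun_iff {𝓡 : RuleSet} {F : FactBase} :
    HasRun 𝓡 F ↔ ∃ fb : ℕ → FactBase, fb 0 = F ∧ ∀ i, Step 𝓡 (fb i) (fb (i + 1)) := by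
  constructor
  · rintro ⟨fb, tr, h, h0⟩
    exact ⟨fb, h0, fun i => ⟨tr i, h i⟩⟩
  · rintro ⟨fb, h0, h⟩
    choose tr htr using h
    exact ⟨fb, tr, htr, h0⟩

theorem levels_succ (rs : List RuleL) (n : ℕ) (L : List (List Atom)) :
    levels rs (n + 1) L = levels rs n (L.flatMap (succs rs)) := Function.iterate_succ_apply _ _ _

theorem levels_succ' (rs : List RuleL) (n : ℕ) (L : List (List Atom)) :
    levels rs (n + 1) L = (levels rs n L).flatMap (succs rs) :=
  Function.iterate_succ_apply' _ _ _

theorem levels_eq_nil {rs : List RuleL} {n : ℕ} {L : List (List Atom)} :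
    levels rs n L = [] ↔ ∀ l ∈ L, levels rs n [l] = [] := by
  induction n generalizing L with
  | zero => simp [levels, List.eq_nil_iff_forall_not_mem]
  | succ n ih =>
    simp only [levels_succ, List.flatMap_singleton]
    rw [ih]
    simp only [List.mem_flatMap]
    constructor
    · intro h l hl
      rw [ih]
      exact fun l' hl' => h l' ⟨l, hl, hl'⟩
    · rintro h l' ⟨l, hl, hl'⟩
      exact ih.1 (h l hl) l' hl'

theorem levels_nil_mono {rs : List RuleL} {m n : ℕ} (hmn : m ≤ n) {L : List (List Atom)}
    (h : levels rs m L = []) : levels rs n L = [] := by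
  induction n, hmn using Nat.le_induction with
  | base => exact h
  | succ n _ ih => rw [levels_succ', ih, List.flatMap_nil]

theorem not_hasRun_iff {𝓡 : RuleSet} {rs : List RuleL} (h : ReprSet rs 𝓡) {F : List Atom} :
    ¬ HasRun 𝓡 F.toFinset ↔ ∃ n, levels rs n [F] = [] := by
  rw [← not_iff_not, not_not, hasRun_iff]
  push Not
  constructor
  · rintro ⟨fb, h0, hs⟩ n
    suffices ∃ l ∈ levels rs n [F], l.toFinset = fb n by
      obtain ⟨l, hl, _⟩ := this
      exact List.ne_nil_of_mem hl
    induction n with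
    | zero => exact ⟨F, by simp [levels], h0.symm⟩
    | succ n ih =>
      obtain ⟨l, hl, hln⟩ := ih
      have := hs n
      rw [← hln, step_iff h] at this
      obtain ⟨l', hl', he⟩ := this
      exact ⟨l', by rw [levels_succ']; exact List.mem_flatMap.2 ⟨l, hl, hl'⟩, he⟩
  · intro hF
    have next : ∀ l : {l // ∀ n, levels rs n [l] ≠ []},
        ∃ l' : {l // ∀ n, levels rs n [l] ≠ []}, l'.1 ∈ succs rs l.1 := by
      rintro ⟨l, hl⟩
      by_contra hc
      have hc' : ∀ l' ∈ succs rs l, ∃ n, levels rs n [l'] = [] := by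
        intro l' hl'
        by_contra hn
        push Not at hn
        exact hc ⟨⟨l', hn⟩, hl'⟩
      choose! f hf using hc'
      refine hl (((succs rs l).map f).sum + 1) ?_
      rw [levels_succ, List.flatMap_singleton, levels_eq_nil]
      exact fun l' hl' => levels_nil_mono (List.le_sum_of_mem (List.mem_map_of_mem hl')) (hf l' hl')
    choose nx hnx using next
    refine ⟨fun i => (nx^[i] ⟨F, hF⟩).1.toFinset, rfl, fun i => (step_iff h).2 ⟨_, hnx _, ?_⟩⟩
    simp only
    rw [Function.iterate_succ_apply']

/-! ### Computability of the restricted chase -/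

def Term.equivSum : Term ≃ ℕ ⊕ ℕ where
  toFun := fun t => match t with | .const c => .inl c | .var v => .inr v
  invFun := fun s => match s with | .inl c => .const c | .inr v => .var v
  left_inv := by intro t; cases t <;> rfl
  right_inv := by intro s; cases s <;> rfl

def Atom.equivProd : Atom ≃ ℕ × List Term where
  toFun := fun a => (a.pred, a.args)
  invFun := fun p => ⟨p.1, p.2⟩
  left_inv := fun _ => rfl
  right_inv := fun _ => rfl

instance : Primcodable Term where
  toEncodable := inferInstance
  prim := (Primcodable.ofEquiv (ℕ ⊕ ℕ) Term.equivSum).prim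

instance : Primcodable Atom where
  toEncodable := inferInstance
  prim := (Primcodable.ofEquiv (ℕ × List Term) Atom.equivProd).prim

theorem Term.primrec_equivSum : Primrec Term.equivSum := Primrec.of_equiv (e := Term.equivSum)

theorem Term.primrec_equivSum_symm : Primrec Term.equivSum.symm :=
  Primrec.of_equiv_symm (e := Term.equivSum)

theorem Atom.primrec_equivProd : Primrec Atom.equivProd := Primrec.of_equiv (e := Atom.equivProd)

theorem Atom.primrec_equivProd_symm : Primrec Atom.equivProd.symm :=
  Primrec.of_equiv_symm (e := Atom.equivProd)

section

variable {α β : Type*} [Primcodable α] [Primcodable β]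

theorem primrec_const : Primrec Term.const := Term.primrec_equivSum_symm.comp Primrec.sumInl

theorem primrec_var : Primrec Term.var := Term.primrec_equivSum_symm.comp Primrec.sumInr

theorem primrec_pred : Primrec Atom.pred := Primrec.fst.comp Atom.primrec_equivProd

theorem primrec_args : Primrec Atom.args := Primrec.snd.comp Atom.primrec_equivProd

theorem primrec_atom : Primrec₂ Atom.mk := Atom.primrec_equivProd_symm.comp Primrec.id

theorem primrec_varL : Primrec Term.varL :=
  (Primrec.sumCasesOn Term.primrec_equivSum (Primrec.const []).to₂
    (Primrec.list_cons.comp Primrec.snd (Primrec.const [])).to₂).of_eq fun t => by cases t <;> rfl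

theorem primrec_applyTerm {σ : α → Subst} (hσ : Primrec₂ σ) :
    Primrec₂ fun a t => applyTerm (σ a) t :=
  (Primrec.sumCasesOn (Term.primrec_equivSum.comp Primrec.snd)
    (primrec_const.comp Primrec.snd).to₂
    (hσ.comp (Primrec.fst.comp Primrec.fst) Primrec.snd).to₂).of_eq fun ⟨_, t⟩ => by cases t <;> rfl

theorem primrec_subst {σ : α → Subst} (hσ : Primrec₂ σ) :
    Primrec₂ fun a (b : Atom) => b.subst (σ a) :=
  primrec_atom.comp (primrec_pred.comp Primrec.snd)
    (Primrec.list_map (primrec_args.comp Primrec.snd)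
      ((primrec_applyTerm hσ).comp (Primrec.fst.comp Primrec.fst) Primrec.snd).to₂)

theorem primrec_varsL : Primrec varsL :=
  Primrec.list_flatMap Primrec.id
    (Primrec.list_flatMap (primrec_args.comp Primrec.snd) (primrec_varL.comp Primrec.snd).to₂).to₂

theorem primrec_termsL : Primrec termsL :=
  Primrec.list_flatMap Primrec.id (primrec_args.comp Primrec.snd).to₂

theorem primrec_sum : Primrec (List.sum : List ℕ → ℕ) :=
  (Primrec.list_foldr Primrec.id (Primrec.const 0)
    (Primrec.nat_add.comp (Primrec.fst.comp Primrec.snd) (Primrec.snd.comp Primrec.snd)).to₂)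

theorem primrecRel_mem : PrimrecRel fun (a : α) (l : List α) => a ∈ l :=
  ((PrimrecRel.exists_mem_list (R := fun (a b : α) => a = b) Primrec.eq).comp
    Primrec.snd Primrec.fst).of_eq fun ⟨a, l⟩ => by simp

theorem primrec_vlist : Primrec vlist :=
  ((PrimrecRel.listFilter (R := fun (v : ℕ) (l : List ℕ) => v ∈ l) primrecRel_mem).comp
    (Primrec.list_range.comp (Primrec.succ.comp (primrec_sum.comp primrec_varsL)))
    primrec_varsL).of_eq fun l => by rw [vlist]

theorem primrec_tuples : Primrec₂ tuples :=
  (Primrec.nat_rec (f := fun _ : List Term => [[]])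
    (g := fun L x => x.2.flatMap fun ts => L.map (· :: ts)) (Primrec.const _)
    (Primrec.list_flatMap (Primrec.snd.comp Primrec.snd)
      (Primrec.list_map (Primrec.fst.comp Primrec.fst)
        (Primrec.list_cons.comp Primrec.snd (Primrec.snd.comp Primrec.fst)).to₂).to₂).to₂).of_eq
    fun L k => by
      induction k with
      | zero => rfl
      | succ k ih => rw [tuples, ← ih]

theorem primrec_assign : Primrec₂ fun (x : List ℕ × List Term) v => assign x.1 x.2 v :=
  (Primrec.list_getD (Term.const 0)).comp (Primrec.snd.comp Primrec.fst)
    (Primrec.list_idxOf.comp Primrec.snd (Primrec.fst.comp Primrec.fst))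

theorem primrec_extL : Primrec₂ fun (x : RuleL × List Term) v => extL x.1 x.2 v :=
  have hv : Primrec fun x : (RuleL × List Term) × ℕ => vlist x.1.1.1 :=
    primrec_vlist.comp (Primrec.fst.comp (Primrec.fst.comp Primrec.fst))
  Primrec.ite (primrecRel_mem.comp Primrec.snd hv)
    (primrec_assign.comp (hv.pair (Primrec.snd.comp Primrec.fst)) Primrec.snd)
    (primrec_var.comp (Primrec₂.natPair.comp (Primrec.encode.comp Primrec.fst) Primrec.snd))

theorem primrec_outL : Primrec₂ outL :=
  Primrec.list_map (Primrec.snd.comp Primrec.fst)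
    ((primrec_subst primrec_extL).comp Primrec.fst Primrec.snd).to₂

theorem primrecPred_forall_mem {p : α → β → Prop} (hp : PrimrecRel p) {f : α → List β}
    (hf : Primrec f) : PrimrecPred fun a => ∀ b ∈ f a, p a b :=
  (PrimrecRel.forall_mem_list (R := fun b a => p a b) hp.swap).comp hf Primrec.id

theorem primrecPred_exists_mem {p : α → β → Prop} (hp : PrimrecRel p) {f : α → List β}
    (hf : Primrec f) : PrimrecPred fun a => ∃ b ∈ f a, p a b :=
  (PrimrecRel.exists_mem_list (R := fun b a => p a b) hp.swap).comp hf Primrec.id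

theorem primrec_filter {p : α → β → Prop} [∀ a b, Decidable (p a b)] (hp : PrimrecRel p) {f : α → List β}
    (hf : Primrec f) : Primrec fun a => (f a).filter fun b => p a b :=
  ((PrimrecRel.listFilter (R := fun b a => p a b) hp.swap).comp hf Primrec.id).of_eq
    fun a => by congr

end

theorem PrimrecPred.imp {α : Type*} [Primcodable α] {p q : α → Prop} (hp : PrimrecPred p)
    (hq : PrimrecPred q) : PrimrecPred fun a => p a → q a :=
  (hp.not.or hq).of_eq fun a => by tauto

theorem primrecPred_isHomL :
    PrimrecPred fun x : (RuleL × List Atom) × List Term => IsHomL x.1.1 x.1.2 x.2 := by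
  refine primrecPred_forall_mem (α := (RuleL × List Atom) × List Term) ?_
    (Primrec.fst.comp (Primrec.fst.comp Primrec.fst))
  have hx : Primrec fun x : (RuleL × List Atom) × List Term => (vlist x.1.1.1, x.2) :=
    (primrec_vlist.comp (Primrec.fst.comp (Primrec.fst.comp Primrec.fst))).pair Primrec.snd
  have hs : Primrec fun y : ((RuleL × List Atom) × List Term) × Atom =>
      y.2.subst (assign (vlist y.1.1.1.1) y.1.2) :=
    (primrec_subst primrec_assign).comp (hx.comp Primrec.fst) Primrec.snd
  exact primrecRel_mem.comp hs (Primrec.snd.comp (Primrec.fst.comp Primrec.fst))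

theorem primrecPred_isBlocking :
    PrimrecPred fun x : (List Atom × List Atom) × List Term => IsBlocking x.1.1 x.1.2 x.2 := by
  have ho : Primrec fun x : (List Atom × List Atom) × List Term => x.1.2 :=
    Primrec.snd.comp Primrec.fst
  have hF : Primrec fun x : (List Atom × List Atom) × List Term => x.1.1 :=
    Primrec.fst.comp Primrec.fst
  have hx := (primrec_vlist.comp ho).pair
    (Primrec.snd : Primrec fun x : (List Atom × List Atom) × List Term => x.2)
  refine PrimrecPred.and ?_ ?_
  · refine primrecPred_forall_mem ?_ (primrec_vlist.comp ho)
    refine PrimrecPred.imp (primrecRel_mem.comp Primrec.snd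
      (primrec_varsL.comp (hF.comp Primrec.fst))) (Primrec.eq.comp ?_ (primrec_var.comp Primrec.snd))
    exact primrec_assign.comp (hx.comp Primrec.fst) Primrec.snd
  · refine primrecPred_forall_mem ?_ ho
    exact primrecRel_mem.comp ((primrec_subst primrec_assign).comp (hx.comp Primrec.fst)
      Primrec.snd) (hF.comp Primrec.fst)

theorem primrecRel_blocked : PrimrecRel Blocked :=
  primrecPred_exists_mem (p := fun (x : List Atom × List Atom) us => IsBlocking x.1 x.2 us)
    primrecPred_isBlocking (primrec_tuples.comp (primrec_termsL.comp Primrec.fst)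
      (Primrec.list_length.comp (primrec_vlist.comp Primrec.snd)))

theorem primrec_succsOf : Primrec₂ succsOf := by
  refine Primrec.list_map ?_ ?_
  · refine primrec_filter (p := fun (x : RuleL × List Atom) ts =>
      IsHomL x.1 x.2 ts ∧ ¬ Blocked x.2 (outL x.1 ts)) ?_ ?_
    · refine PrimrecPred.and primrecPred_isHomL (PrimrecPred.not (primrecRel_blocked.comp
        (Primrec.snd.comp Primrec.fst) (primrec_outL.comp (Primrec.fst.comp Primrec.fst)
          Primrec.snd)))
    · exact primrec_tuples.comp (primrec_termsL.comp Primrec.snd)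
        (Primrec.list_length.comp (primrec_vlist.comp (Primrec.fst.comp Primrec.fst)))
  · exact Primrec.list_append.comp (Primrec.snd.comp Primrec.fst)
      (primrec_outL.comp (Primrec.fst.comp Primrec.fst) Primrec.snd)

theorem primrec_succs : Primrec₂ succs :=
  Primrec.list_flatMap Primrec.fst
    (primrec_succsOf.comp Primrec.snd (Primrec.snd.comp Primrec.fst)).to₂

theorem primrec_levels :
    Primrec fun x : (List RuleL × ℕ) × List (List Atom) => levels x.1.1 x.1.2 x.2 :=
  Primrec.nat_iterate (Primrec.snd.comp Primrec.fst) Primrec.snd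
    (Primrec.list_flatMap Primrec.snd (primrec_succs.comp
      (Primrec.fst.comp (Primrec.fst.comp (Primrec.fst.comp Primrec.fst))) Primrec.snd).to₂).to₂

/-- All restricted chases from the first `x` factbases end within `n` steps. -/
def StopsBy (e x n : ℕ) : Prop :=
  ∀ rs ∈ (Encodable.decode e : Option (List RuleL)).toList, ∀ i < x,
    ∀ F ∈ (Encodable.decode i : Option (List Atom)).toList, levels rs n [F] = []

theorem primrecPred_levels_eq_nil : PrimrecPred fun y : (List RuleL × ℕ) × List Atom =>
    levels y.1.1 y.1.2 [y.2] = [] := by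
  have h3 : Primrec fun y : (List RuleL × ℕ) × List Atom => [y.2] :=
    Primrec.list_cons.comp Primrec.snd (Primrec.const [])
  have h4 : Primrec fun y : (List RuleL × ℕ) × List Atom =>
      levels y.1.1 y.1.2 [y.2] := primrec_levels.comp (Primrec.fst.pair h3)
  exact Primrec.eq.comp h4 (Primrec.const [])

theorem primrecRel_forall_decode {α β : Type*} [Primcodable α] [Primcodable β] {p : α → β → Prop}
    (hp : PrimrecRel p) :
    PrimrecRel fun a (i : ℕ) => ∀ F ∈ (Encodable.decode i : Option β).toList, p a F :=
  primrecPred_forall_mem (α := α × ℕ) (p := fun x F => p x.1 F)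
    (hp.comp (Primrec.fst.comp Primrec.fst) Primrec.snd)
    (Primrec.optionToList.comp (Primrec.decode.comp Primrec.snd))

theorem primrecRel_forall_lt {α : Type*} [Primcodable α] {p : α → ℕ → Prop}
    (hp : PrimrecRel p) : PrimrecRel fun a (x : ℕ) => ∀ i < x, p a i :=
  (primrecPred_forall_mem (α := α × ℕ) (p := fun x F => p x.1 F)
    (hp.comp (Primrec.fst.comp Primrec.fst) Primrec.snd)
    (Primrec.list_range.comp Primrec.snd)).of_eq fun x => by simp

theorem primrecPred_stopsBy : PrimrecPred fun y : (ℕ × ℕ) × ℕ => StopsBy y.1.1 y.1.2 y.2 := by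
  have h1 : PrimrecRel fun (y : List RuleL × ℕ) (i : ℕ) =>
      ∀ F ∈ (Encodable.decode i : Option (List Atom)).toList, levels y.1 y.2 [F] = [] :=
    primrecRel_forall_decode (α := List RuleL × ℕ) (p := fun y F => levels y.1 y.2 [F] = [])
      primrecPred_levels_eq_nil
  have h2 := primrecRel_forall_lt h1
  have h3 : PrimrecRel fun (y : ℕ × ℕ) (rs : List RuleL) => ∀ i < y.1,
      ∀ F ∈ (Encodable.decode i : Option (List Atom)).toList, levels rs y.2 [F] = [] :=
    h2.comp (f := fun z : (ℕ × ℕ) × List RuleL => (z.2, z.1.2)) (g := fun z => z.1.1)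
      (Primrec.snd.pair (Primrec.snd.comp Primrec.fst)) (Primrec.fst.comp Primrec.fst)
  have h4 := primrecRel_forall_decode h3
  exact h4.comp (f := fun y : (ℕ × ℕ) × ℕ => (y.1.2, y.2)) (g := fun y => y.1.1)
    ((Primrec.snd.comp Primrec.fst).pair Primrec.snd) (Primrec.fst.comp Primrec.fst)

/-- For atomic-head rule sets, termination of the restricted chase on all factbases is equivalent
to the totality of a partial recursive function whose domain is an initial segment. -/
theorem exists_partrec_CTall : ∃ Ψ : ℕ → ℕ →. ℕ, Partrec₂ Ψ ∧
    ∀ 𝓡 : RuleSet, (∀ R ∈ 𝓡, R.IsAtomicHead) →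
      (CTall .R 𝓡 → ∀ x, (Ψ (Encodable.encode 𝓡) x).Dom) ∧
      ({x | (Ψ (Encodable.encode 𝓡) x).Dom}.Infinite → CTall .R 𝓡) := by
  refine ⟨fun e x => Nat.rfind fun n => Part.some (decide (StopsBy e x n)), ?_, fun 𝓡 h𝓡 => ?_⟩
  · exact Partrec.rfind (p := fun (y : ℕ × ℕ) n => Part.some (decide (StopsBy y.1 y.2 n)))
      (primrecPred_stopsBy.decide.to_comp.partrec)
  obtain ⟨rs, hrs, he⟩ := exists_reprSet 𝓡
  have hdom : ∀ x, (Nat.rfind fun n => Part.some (decide (StopsBy (Encodable.encode 𝓡) x n))).Dom ↔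
      ∃ n, ∀ i < x, ∀ F ∈ (Encodable.decode i : Option (List Atom)), levels rs n [F] = [] := by
    intro x
    exact Nat.rfind_dom.trans (by simp [StopsBy, he])
  rw [CTall_iff_no_run h𝓡]
  constructor
  · intro h
    refine fun x => (hdom x).2 ?_
    have : ∀ F : List Atom, ∃ n, levels rs n [F] = [] := fun F => (not_hasRun_iff hrs).1 (h _)
    choose f hf using this
    refine ⟨((List.range x).map fun i =>
      ((Encodable.decode i : Option (List Atom)).map f).getD 0).sum, fun i hi F hF => ?_⟩
    refine levels_nil_mono ?_ (hf F)
    refine List.le_sum_of_mem (List.mem_map.2 ⟨i, List.mem_range.2 hi, ?_⟩)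
    rw [Option.mem_def.1 hF]
    rfl
  · intro h F
    obtain ⟨x, hx, hlt⟩ := h.exists_gt (Encodable.encode F.toList)
    obtain ⟨n, hn⟩ := (hdom x).1 hx
    rw [← Finset.toList_toFinset F]
    exact (not_hasRun_iff hrs).2 ⟨n, hn _ hlt _ (by simp)⟩

/-! ### Codes of explicitly listed rule sets -/

/-- Insertion into a strictly increasing list. -/
def insL (a : ℕ) (l : List ℕ) : List ℕ := l.filter (· < a) ++ a :: l.filter (a < ·)

/-- The strictly increasing list with the same members as a given list. -/
def sortL (l : List ℕ) : List ℕ := l.foldr insL []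

theorem mem_sortL {l : List ℕ} {a : ℕ} : a ∈ sortL l ↔ a ∈ l := by
  induction l with
  | nil => simp [sortL]
  | cons b l ih =>
    change a ∈ insL b (sortL l) ↔ _
    simp only [insL, List.mem_append, List.mem_filter, List.mem_cons, ih, decide_eq_true_eq]
    constructor
    · rintro (h | h | h) <;> tauto
    · rintro (h | h)
      · tauto
      · rcases lt_trichotomy a b with h' | h' | h' <;> tauto

theorem pairwise_sortL (l : List ℕ) : (sortL l).Pairwise (· < ·) := by
  induction l with
  | nil => simp [sortL]
  | cons b l ih =>
    change (insL b (sortL l)).Pairwise _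
    rw [insL, List.pairwise_append, List.pairwise_cons]
    refine ⟨ih.filter _, ⟨fun a ha => ?_, ih.filter _⟩, fun a ha c hc => ?_⟩
    · simpa using (List.mem_filter.1 ha).2
    · have h1 : a < b := by simpa using (List.mem_filter.1 ha).2
      rcases List.mem_cons.1 hc with rfl | hc
      · exact h1
      · exact h1.trans (by simpa using (List.mem_filter.1 hc).2)

theorem encode_toFinset {α : Type*} [Encodable α] [DecidableEq α] (l : List α) :
    Encodable.encode l.toFinset = Encodable.encode (sortL (l.map Encodable.encode)) := by
  obtain ⟨l', h1, h2, h3, h4⟩ := encode_finset l.toFinset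
  rw [h3, ← encode_map (f := (Encodable.encode : α → ℕ)) (fun _ => rfl) l']
  congr 1
  have hs : (l'.map Encodable.encode).Pairwise (· < ·) := by
    rw [List.pairwise_map]
    refine (h4.and h2).imp fun ⟨h, h'⟩ => lt_of_le_of_ne h fun he => h' (Encodable.encode_injective he)
  refine List.Perm.eq_of_pairwise (le := (· < ·)) (fun a b _ _ h h' => absurd h h'.asymm) hs
    (pairwise_sortL _) ?_
  rw [List.perm_ext_iff_of_nodup (hs.imp ne_of_lt) ((pairwise_sortL _).imp ne_of_lt)]
  intro a
  simp [mem_sortL, h1]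

/-- The rule with the given lists of body and head atoms. -/
def Rule.ofL (r : RuleL) : Rule :=
  if h : r.1 ≠ [] ∧ r.2 ≠ [] then
    ⟨r.1.toFinset, r.2.toFinset, List.toFinset_nonempty_iff _ |>.2 h.1,
      List.toFinset_nonempty_iff _ |>.2 h.2⟩
  else ⟨{⟨0, []⟩}, {⟨0, []⟩}, Finset.singleton_nonempty _, Finset.singleton_nonempty _⟩

/-- The code of a listed rule. -/
def ruleCode (r : RuleL) : ℕ :=
  Nat.pair (Encodable.encode (sortL (r.1.map Encodable.encode)))
    (Encodable.encode (sortL (r.2.map Encodable.encode)))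

theorem encode_ofL {r : RuleL} (h : r.1 ≠ [] ∧ r.2 ≠ []) :
    Encodable.encode (Rule.ofL r) = ruleCode r := by
  rw [Rule.ofL, dif_pos h]
  change Nat.pair (Encodable.encode r.1.toFinset) (Encodable.encode r.2.toFinset) = _
  rw [encode_toFinset, encode_toFinset, ruleCode]

theorem encode_ruleSet {l : List RuleL} (h : ∀ r ∈ l, r.1 ≠ [] ∧ r.2 ≠ []) :
    Encodable.encode (l.map Rule.ofL).toFinset = Encodable.encode (sortL (l.map ruleCode)) := by
  rw [encode_toFinset, List.map_map]
  congr 2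
  exact List.map_congr_left fun r hr => encode_ofL (h r hr)

theorem primrec_insL : Primrec₂ insL :=
  Primrec.list_append.comp
    (primrec_filter (p := fun (x : ℕ × List ℕ) b => b < x.1)
      (Primrec.nat_lt.comp Primrec.snd (Primrec.fst.comp Primrec.fst)) Primrec.snd)
    (Primrec.list_cons.comp Primrec.fst
      (primrec_filter (p := fun (x : ℕ × List ℕ) b => x.1 < b)
        (Primrec.nat_lt.comp (Primrec.fst.comp Primrec.fst) Primrec.snd) Primrec.snd))

theorem primrec_sortL : Primrec sortL :=
  Primrec.list_foldr Primrec.id (Primrec.const [])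
    (primrec_insL.comp (Primrec.fst.comp Primrec.snd) (Primrec.snd.comp Primrec.snd)).to₂

theorem primrec_ruleCode : Primrec ruleCode :=
  have h : Primrec fun l : List Atom => Encodable.encode (sortL (l.map Encodable.encode)) :=
    Primrec.encode.comp (primrec_sortL.comp
      (Primrec.list_map Primrec.id (Primrec.encode.comp Primrec.snd).to₂))
  Primrec₂.natPair.comp (h.comp Primrec.fst) (h.comp Primrec.snd)

theorem primrec_ruleSetCode :
    Primrec fun l : List RuleL => Encodable.encode (sortL (l.map ruleCode)) :=
  Primrec.encode.comp (primrec_sortL.comp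
    (Primrec.list_map Primrec.id (primrec_ruleCode.comp Primrec.snd).to₂))

section simulation

open Nat.Partrec (Code)

/-! ### A logic program computing partial recursive functions -/

/-- A rule of a logic program: predicates are applied to lists of variables. -/
abbrev PRule := List (ℕ × List ℕ) × (ℕ × List ℕ)

/-- The predicate holding of the input-output pairs of a code. -/
def codePred (d : Code) : ℕ := 11 + Encodable.encode d

/-- The rules for order, pairing (`7`) and the basic functions, over successor (`4`) and zero
(`5`). -/
def baseProg : List PRule :=
  [([(4, [1, 2])], (6, [1, 2])),
   ([(6, [1, 2]), (4, [2, 3])], (6, [1, 3])),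
   ([(5, [1])], (7, [1, 1, 1])),
   ([(7, [1, 2, 3]), (4, [1, 4]), (6, [4, 2]), (4, [3, 5])], (7, [4, 2, 5])),
   ([(7, [1, 2, 3]), (4, [1, 2]), (4, [3, 5]), (5, [6])], (7, [2, 6, 5])),
   ([(7, [1, 2, 3]), (6, [2, 1]), (4, [2, 4]), (4, [3, 5])], (7, [1, 4, 5])),
   ([(7, [1, 1, 3]), (4, [1, 4]), (4, [3, 5]), (5, [6])], (7, [6, 4, 5])),
   ([(7, [1, 2, 3]), (5, [4])], (codePred .zero, [3, 4])),
   ([(4, [1, 2])], (codePred .succ, [1, 2])),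
   ([(7, [1, 2, 3])], (codePred .left, [3, 1])),
   ([(7, [1, 2, 3])], (codePred .right, [3, 2]))]

/-- The rules for the codes built from two given codes. -/
def codeProg (c d : Code) : List PRule :=
  [([(codePred c, [1, 2]), (codePred d, [1, 3]), (7, [2, 3, 4])], (codePred (c.pair d), [1, 4])),
   ([(codePred d, [1, 2]), (codePred c, [2, 3])], (codePred (c.comp d), [1, 3])),
   ([(7, [1, 2, 3]), (5, [2]), (codePred c, [1, 4])], (codePred (c.prec d), [3, 4])),
   ([(7, [1, 2, 3]), (codePred (c.prec d), [3, 4]), (4, [2, 5]), (7, [1, 5, 6]), (7, [2, 4, 7]),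
     (7, [1, 7, 8]), (codePred d, [8, 9])], (codePred (c.prec d), [6, 9])),
   ([(7, [1, 2, 3]), (codePred c, [3, 4]), (5, [4])], (codePred c.rfind', [3, 2])),
   ([(7, [1, 2, 3]), (codePred c, [3, 4]), (4, [5, 4]), (4, [2, 6]), (7, [1, 6, 7]),
     (codePred c.rfind', [7, 8])], (codePred c.rfind', [3, 8]))]

/-- The program for all codes built from codes less than `N`. -/
def prog (N : ℕ) : List PRule :=
  baseProg ++ (List.range N).flatMap fun m => (List.range N).flatMap fun k =>
    codeProg (Denumerable.ofNat Code m) (Denumerable.ofNat Code k)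

/-- Derivability of facts about natural numbers in `prog N`. -/
inductive Der (N : ℕ) : ℕ → List ℕ → Prop
  | succ (n : ℕ) : Der N 4 [n, n + 1]
  | zero : Der N 5 [0]
  | rule (r : PRule) (hr : r ∈ prog N) (ρ : ℕ → ℕ) (h : ∀ a ∈ r.1, Der N a.1 (a.2.map ρ)) :
      Der N r.2.1 (r.2.2.map ρ)

/-- The intended meaning of the predicates of `prog`. -/
def Meaning : ℕ → List ℕ → Prop
  | 4, [x, y] => y = x + 1
  | 5, [x] => x = 0
  | 6, [x, y] => x < y
  | 7, [x, y, z] => z = Nat.pair x y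
  | n + 11, [x, y] => y ∈ (Denumerable.ofNat Code n).eval x
  | _, _ => False

theorem meaning_succ {x y : ℕ} : Meaning 4 [x, y] ↔ y = x + 1 := Iff.rfl

theorem meaning_zero {x : ℕ} : Meaning 5 [x] ↔ x = 0 := Iff.rfl

theorem meaning_lt {x y : ℕ} : Meaning 6 [x, y] ↔ x < y := Iff.rfl

theorem meaning_pair {x y z : ℕ} : Meaning 7 [x, y, z] ↔ z = Nat.pair x y := Iff.rfl

theorem meaning_codePred {d : Code} {x y : ℕ} : Meaning (codePred d) [x, y] ↔ y ∈ d.eval x := by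
  rw [codePred, add_comm]
  simp [Meaning]

theorem mem_eval_rfind'_zero {c : Code} {a m : ℕ} (h : 0 ∈ c.eval (Nat.pair a m)) :
    m ∈ c.rfind'.eval (Nat.pair a m) := by
  obtain ⟨k, hk⟩ := Code.evaln_complete.1 h
  refine Code.evaln_complete.2 ⟨k, ?_⟩
  have hb := Code.evaln_bound hk
  obtain ⟨k, rfl⟩ : ∃ j, k = j + 1 := ⟨k - 1, by omega⟩
  simp [Code.evaln, Nat.lt_succ_iff.1 hb, Option.mem_def.1 hk]

theorem mem_eval_rfind'_succ {c : Code} {a m x y : ℕ} (h : x + 1 ∈ c.eval (Nat.pair a m))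
    (hy : y ∈ c.rfind'.eval (Nat.pair a (m + 1))) : y ∈ c.rfind'.eval (Nat.pair a m) := by
  obtain ⟨k, hk⟩ := Code.evaln_complete.1 h
  obtain ⟨l, hl⟩ := Code.evaln_complete.1 hy
  refine Code.evaln_complete.2 ⟨k + l + 1, ?_⟩
  have hb := Code.evaln_bound hk
  have h1 := Option.mem_def.1 (Code.evaln_mono (show k ≤ k + l + 1 by omega) hk)
  have h2 := Option.mem_def.1 (Code.evaln_mono (show l ≤ k + l by omega) hl)
  have hg : (guard (Nat.pair a m ≤ k + l) : Option Unit) = some () :=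
    if_pos (by omega)
  simp [Code.evaln, h1, h2, hg]

theorem mem_eval_pair {c d : Code} {x y z : ℕ} (hy : y ∈ c.eval x) (hz : z ∈ d.eval x) :
    Nat.pair y z ∈ (c.pair d).eval x := by
  rw [Part.mem_eq] at *
  simp [Code.eval, Seq.seq, Part.eq_some_iff.2 hy, Part.eq_some_iff.2 hz]

theorem pair_succ_left {a b : ℕ} (h : a + 1 < b) : Nat.pair (a + 1) b = Nat.pair a b + 1 := by
  rw [Nat.pair, Nat.pair, if_pos h, if_pos (by omega)]
  omega

theorem pair_succ_left_eq (a : ℕ) : Nat.pair (a + 1) 0 = Nat.pair a (a + 1) + 1 := by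
  rw [Nat.pair, Nat.pair, if_neg (by omega), if_pos (by omega)]
  ring

theorem pair_succ_right {a b : ℕ} (h : b < a) : Nat.pair a (b + 1) = Nat.pair a b + 1 := by
  rw [Nat.pair, Nat.pair, if_neg (by omega), if_neg (by omega)]
  omega

theorem pair_succ_right_eq (a : ℕ) : Nat.pair 0 (a + 1) = Nat.pair a a + 1 := by
  rw [Nat.pair, Nat.pair, if_pos (by omega), if_neg (by omega)]
  ring

theorem baseProg_sound {r : PRule} (hr : r ∈ baseProg) {ρ : ℕ → ℕ}
    (h : ∀ a ∈ r.1, Meaning a.1 (a.2.map ρ)) : Meaning r.2.1 (r.2.2.map ρ) := by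
  simp only [baseProg, List.mem_cons, List.not_mem_nil, or_false] at hr
  rcases hr with rfl | rfl | rfl | rfl | rfl | rfl | rfl | rfl | rfl | rfl | rfl <;>
    simp [meaning_succ, meaning_zero, meaning_lt, meaning_pair, meaning_codePred] at h ⊢
  · omega
  · omega
  · rw [h]; rfl
  · obtain ⟨h1, h2, h3, h4⟩ := h
    rw [h4, h1, h2, pair_succ_left (by omega)]
  · obtain ⟨h1, h2, h3, h4⟩ := h
    rw [h4, h3, h2, h1, h2, pair_succ_left_eq]
  · obtain ⟨h1, h2, h3, h4⟩ := h
    rw [h4, h1, h3, pair_succ_right h2]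
  · obtain ⟨h1, h2, h3, h4⟩ := h
    rw [h4, h3, h2, h1, pair_succ_right_eq]
  · simpa [Code.eval, pure, PFun.pure] using h.2
  · simp [Code.eval, h]
  · simp [Code.eval, h]
  · simp [Code.eval, h]

theorem codeProg_sound {c d : Code} {r : PRule} (hr : r ∈ codeProg c d) {ρ : ℕ → ℕ}
    (h : ∀ a ∈ r.1, Meaning a.1 (a.2.map ρ)) : Meaning r.2.1 (r.2.2.map ρ) := by
  simp only [codeProg, List.mem_cons, List.not_mem_nil, or_false] at hr
  rcases hr with rfl | rfl | rfl | rfl | rfl | rfl <;>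
    simp [meaning_succ, meaning_zero, meaning_pair, meaning_codePred] at h ⊢
  · rw [h.2.2]
    exact mem_eval_pair h.1 h.2.1
  · exact Part.mem_bind h.1 h.2
  · obtain ⟨h1, h2, h3⟩ := h
    rwa [h1, h2, Code.eval_prec_zero]
  · obtain ⟨h1, h2, h3, h4, h5, h6, h7⟩ := h
    rw [h4, h3, Code.eval_prec_succ]
    rw [h1] at h2
    rw [h6, h5] at h7
    exact Part.mem_bind h2 h7
  · obtain ⟨h1, h2, h3⟩ := h
    rw [h1]
    rw [h3, h1] at h2
    exact mem_eval_rfind'_zero h2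
  · obtain ⟨h1, h2, h3, h4, h5, h6⟩ := h
    rw [h1]
    rw [h3, h1] at h2
    rw [h5, h4] at h6
    exact mem_eval_rfind'_succ h2 h6

theorem Der.sound {N p : ℕ} {l : List ℕ} (h : Der N p l) : Meaning p l := by
  induction h with
  | succ n => rfl
  | zero => rfl
  | rule r hr ρ _ ih =>
    simp only [prog, List.mem_append, List.mem_flatMap] at hr
    rcases hr with hr | ⟨m, _, k, _, hr⟩
    · exact baseProg_sound hr ih
    · exact codeProg_sound hr ih

theorem Der.base {N p : ℕ} {l : List ℕ} {r : PRule} (i : ℕ) (hr : baseProg[i]? = some r)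
    (ρ : ℕ → ℕ) (h : ∀ a ∈ r.1, Der N a.1 (a.2.map ρ)) (hp : r.2.1 = p := by rfl)
    (hl : r.2.2.map ρ = l := by rfl) : Der N p l := by
  subst hp hl
  exact .rule r (List.mem_append_left _ (List.mem_of_getElem? hr)) ρ h

theorem Der.code {N p : ℕ} {l : List ℕ} {c d : Code} (hc : Encodable.encode c < N)
    (hd : Encodable.encode d < N) {r : PRule} (i : ℕ) (hr : (codeProg c d)[i]? = some r)
    (ρ : ℕ → ℕ) (h : ∀ a ∈ r.1, Der N a.1 (a.2.map ρ)) (hp : r.2.1 = p := by rfl)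
    (hl : r.2.2.map ρ = l := by rfl) : Der N p l := by
  subst hp hl
  refine .rule r (List.mem_append_right _ ?_) ρ h
  exact List.mem_flatMap.2 ⟨_, List.mem_range.2 hc, List.mem_flatMap.2 ⟨_, List.mem_range.2 hd,
    by rw [Denumerable.ofNat_encode, Denumerable.ofNat_encode]; exact List.mem_of_getElem? hr⟩⟩

/-- The assignment of the variables `1, 2, …` given by a list. -/
def valL (l : List ℕ) : ℕ → ℕ := fun v => (0 :: l).getD v 0

theorem der_lt {N x y : ℕ} (h : x < y) : Der N 6 [x, y] := by
  induction y, h using Nat.le_induction with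
  | base =>
    exact Der.base 0 rfl (valL [x, x + 1])
      (by simpa [valL] using Der.succ x)
  | succ y _ ih =>
    exact Der.base 1 rfl (valL [x, y, y + 1])
      (by simpa [valL] using ⟨ih, Der.succ y⟩)

theorem der_pair_unpair (N z : ℕ) : Der N 7 [z.unpair.1, z.unpair.2, z] := by
  induction z with
  | zero =>
    exact Der.base 2 rfl (valL [0])
      (by simpa [valL] using Der.zero)
  | succ z ih =>
    obtain ⟨a, b, rfl⟩ : ∃ a b, z = Nat.pair a b := ⟨_, _, z.pair_unpair.symm⟩
    simp only [Nat.unpair_pair] at ih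
    rcases lt_trichotomy (a + 1) b with h | rfl | h
    · rw [← pair_succ_left h, Nat.unpair_pair, pair_succ_left h]
      exact Der.base 3 rfl
        (valL [a, b, Nat.pair a b, a + 1, Nat.pair a b + 1])
        (by simpa [valL] using ⟨ih, Der.succ _, der_lt h, Der.succ _⟩)
    · rw [← pair_succ_left_eq, Nat.unpair_pair, pair_succ_left_eq]
      exact Der.base 4 rfl
        (valL [a, a + 1, Nat.pair a (a + 1), 0, Nat.pair a (a + 1) + 1, 0])
        (by simpa [valL] using ⟨ih, Der.succ _, Der.succ _, Der.zero⟩)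
    · rcases (Nat.lt_succ_iff.1 h).lt_or_eq with h | rfl
      · rw [← pair_succ_right h, Nat.unpair_pair, pair_succ_right h]
        exact Der.base 5 rfl
          (valL [a, b, Nat.pair a b, b + 1, Nat.pair a b + 1])
          (by simpa [valL] using ⟨ih, der_lt h, Der.succ _, Der.succ _⟩)
      · rw [← pair_succ_right_eq, Nat.unpair_pair, pair_succ_right_eq]
        exact Der.base 6 rfl
          (valL [b, b, Nat.pair b b, b + 1, Nat.pair b b + 1, 0])
          (by simpa [valL] using ⟨ih, Der.succ _, Der.succ _, Der.zero⟩)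

theorem der_pair (N a b : ℕ) : Der N 7 [a, b, Nat.pair a b] := by
  simpa using der_pair_unpair N (Nat.pair a b)

theorem der_evaln {N k x y : ℕ} {c : Code} (hc : Encodable.encode c ≤ N) (h : y ∈ c.evaln k x) :
    Der N (codePred c) [x, y] := by
  induction k generalizing c x y with
  | zero => simp [Code.evaln] at h
  | succ k ih =>
    induction c generalizing x y with
    | zero =>
      simp [Code.evaln, Option.bind_eq_some_iff] at h
      obtain ⟨-, rfl⟩ := h
      exact Der.base 7 rfl (valL [x.unpair.1, x.unpair.2, x, 0])
        (by simpa [valL] using ⟨der_pair_unpair N x, Der.zero⟩)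
    | succ =>
      simp [Code.evaln, Option.bind_eq_some_iff] at h
      obtain ⟨-, rfl⟩ := h
      exact Der.base 8 rfl (valL [x, x + 1])
        (by simpa [valL] using Der.succ x)
    | left =>
      simp [Code.evaln, Option.bind_eq_some_iff] at h
      obtain ⟨-, rfl⟩ := h
      exact Der.base 9 rfl (valL [x.unpair.1, x.unpair.2, x])
        (by simpa [valL] using der_pair_unpair N x)
    | right =>
      simp [Code.evaln, Option.bind_eq_some_iff] at h
      obtain ⟨-, rfl⟩ := h
      exact Der.base 10 rfl (valL [x.unpair.1, x.unpair.2, x])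
        (by simpa [valL] using der_pair_unpair N x)
    | pair c d hcd hdd =>
      have hlt := Code.encode_lt_pair c d
      simp [Code.evaln, Option.bind_eq_some_iff, Seq.seq] at h
      obtain ⟨-, u, hu, v, hv, rfl⟩ := h
      exact Der.code (c := c) (d := d) (by omega) (by omega) 0 rfl
        (valL [x, u, v, Nat.pair u v]) (by simpa [valL] using
          ⟨hcd (by omega) hu, hdd (by omega) hv, der_pair N u v⟩)
    | comp c d hcd hdd =>
      have hlt := Code.encode_lt_comp c d
      simp [Code.evaln, Option.bind_eq_some_iff] at h
      obtain ⟨-, u, hu, hv⟩ := h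
      exact Der.code (c := c) (d := d) (by omega) (by omega) 1 rfl
        (valL [x, u, y]) (by simpa [valL] using
          ⟨hdd (by omega) hu, hcd (by omega) hv⟩)
    | prec c d hcd hdd =>
      have hlt := Code.encode_lt_prec c d
      simp [Code.evaln, Option.bind_eq_some_iff] at h
      obtain ⟨-, h⟩ := h
      obtain ⟨a, n, rfl⟩ : ∃ a n, x = Nat.pair a n := ⟨_, _, x.pair_unpair.symm⟩
      simp only [Nat.unpair_pair] at h
      cases n with
      | zero =>
        exact Der.code (c := c) (d := d) (by omega) (by omega) 2 rfl
          (valL [a, 0, Nat.pair a 0, y]) (by simpa [valL] using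
            ⟨der_pair N a 0, Der.zero, hcd (by omega) h⟩)
      | succ n =>
        simp [Option.bind_eq_some_iff] at h
        obtain ⟨i, hi, h⟩ := h
        exact Der.code (c := c) (d := d) (by omega) (by omega) 3 rfl
          (valL [a, n, Nat.pair a n, i, n + 1, Nat.pair a (n + 1), Nat.pair n i,
            Nat.pair a (Nat.pair n i), y]) (by simpa [valL] using
            ⟨der_pair N a n, ih hc hi, Der.succ n, der_pair N _ _, der_pair N _ _, der_pair N _ _,
              hdd (by omega) h⟩)
    | rfind' c hcd =>
      have hlt := Code.encode_lt_rfind' c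
      simp [Code.evaln, Option.bind_eq_some_iff] at h
      obtain ⟨-, h⟩ := h
      obtain ⟨a, n, rfl⟩ : ∃ a n, x = Nat.pair a n := ⟨_, _, x.pair_unpair.symm⟩
      simp only [Nat.unpair_pair] at h
      obtain ⟨u, hu, h⟩ := h
      cases u with
      | zero =>
        simp at h
        subst h
        exact Der.code (c := c) (d := c) (by omega) (by omega) 4 rfl
          (valL [a, n, Nat.pair a n, 0]) (by simpa [valL] using
            ⟨der_pair N a n, hcd (by omega) hu, Der.zero⟩)
      | succ u =>
        simp at h
        exact Der.code (c := c) (d := c) (by omega) (by omega) 5 rfl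
          (valL [a, n, Nat.pair a n, u + 1, u, n + 1, Nat.pair a (n + 1), y])
          (by simpa [valL] using
            ⟨der_pair N a n, hcd (by omega) hu, Der.succ u, Der.succ n, der_pair N _ _, ih hc h⟩)

theorem der_codePred_iff {N x y : ℕ} {c : Code} (hc : Encodable.encode c ≤ N) :
    Der N (codePred c) [x, y] ↔ y ∈ c.eval x := by
  refine ⟨fun h => meaning_codePred.1 h.sound, fun h => ?_⟩
  obtain ⟨k, hk⟩ := Code.evaln_complete.1 h
  exact der_evaln hc hk

/-! ### Constant-free rules given by lists of variables -/

/-- A constant-free rule, given by the lists of predicates and variables of its body and head. -/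
abbrev SRule := List (ℕ × List ℕ) × List (ℕ × List ℕ)

/-- The instance of a schematic atom under a substitution. -/
def inst (τ : Subst) (x : ℕ × List ℕ) : Atom := ⟨x.1, x.2.map τ⟩

/-- The listed rule of a schematic rule. -/
def SRule.toL (r : SRule) : RuleL := (r.1.map (inst .var), r.2.map (inst .var))

/-- The rule of a schematic rule. -/
def Rule.ofS (r : SRule) : Rule := Rule.ofL r.toL

/-- The variables of the body. -/
def SRule.bodyVars (r : SRule) : List ℕ := r.1.flatMap Prod.snd

/-- The variables of the head. -/
def SRule.headVars (r : SRule) : List ℕ := r.2.flatMap Prod.snd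

/-- Body and head are nonempty. -/
def SRule.WF (r : SRule) : Prop := r.1 ≠ [] ∧ r.2 ≠ []

/-- No existential variables. -/
def SRule.IsD (r : SRule) : Prop := r.WF ∧ ∀ v ∈ r.headVars, v ∈ r.bodyVars

theorem SRule.WF.toL {r : SRule} (h : r.WF) : r.toL.1 ≠ [] ∧ r.toL.2 ≠ [] := by
  simpa [SRule.toL, SRule.WF] using h

theorem Rule.mem_body_ofS {r : SRule} (h : r.WF) {a : Atom} :
    a ∈ (Rule.ofS r).body ↔ ∃ x ∈ r.1, inst .var x = a := by
  rw [Rule.ofS, Rule.ofL, dif_pos h.toL]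
  simp [SRule.toL]

theorem Rule.mem_head_ofS {r : SRule} (h : r.WF) {a : Atom} :
    a ∈ (Rule.ofS r).head ↔ ∃ x ∈ r.2, inst .var x = a := by
  rw [Rule.ofS, Rule.ofL, dif_pos h.toL]
  simp [SRule.toL]

theorem Rule.mem_vars_body_ofS {r : SRule} (h : r.WF) {v : ℕ} :
    v ∈ FactBase.vars (Rule.ofS r).body ↔ v ∈ r.bodyVars := by
  simp only [FactBase.mem_vars, Rule.mem_body_ofS h, SRule.bodyVars, List.mem_flatMap]
  constructor
  · rintro ⟨_, ⟨x, hx, rfl⟩, hv⟩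
    exact ⟨x, hx, by simpa [inst] using hv⟩
  · rintro ⟨x, hx, hv⟩
    exact ⟨_, ⟨x, hx, rfl⟩, by simpa [inst] using hv⟩

theorem Rule.mem_exVars_ofS {r : SRule} (h : r.WF) {v : ℕ} :
    v ∈ (Rule.ofS r).exVars ↔ v ∈ r.headVars ∧ v ∉ r.bodyVars := by
  rw [Rule.exVars, Finset.mem_sdiff, Rule.mem_vars_body_ofS h]
  refine and_congr_left fun _ => ?_
  simp only [FactBase.mem_vars, Rule.mem_head_ofS h, SRule.headVars, List.mem_flatMap]
  constructor
  · rintro ⟨_, ⟨x, hx, rfl⟩, hv⟩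
    exact ⟨x, hx, by simpa [inst] using hv⟩
  · rintro ⟨x, hx, hv⟩
    exact ⟨_, ⟨x, hx, rfl⟩, by simpa [inst] using hv⟩

theorem inst_subst (σ : Subst) (x : ℕ × List ℕ) : (inst .var x).subst σ = inst σ x := by
  simp [inst, Atom.subst]

section
variable {t : Trigger} {r : SRule} {F : FactBase}

theorem Trigger.isOn_ofS (h : r.WF) (ht : t.rule = Rule.ofS r) :
    t.IsOn F ↔ ∀ x ∈ r.1, inst t.map x ∈ F := by
  constructor
  · intro ho x hx
    rw [← inst_subst]
    exact ho _ (by rw [ht]; exact (Rule.mem_body_ofS h).2 ⟨x, hx, rfl⟩)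
  · intro ho a ha
    rw [ht] at ha
    obtain ⟨x, hx, rfl⟩ := (Rule.mem_body_ofS h).1 ha
    rw [inst_subst]
    exact ho x hx

theorem Trigger.mem_out_ofS (h : r.WF) (ht : t.rule = Rule.ofS r) {a : Atom} :
    a ∈ t.out ↔ ∃ x ∈ r.2, inst t.ext x = a := by
  rw [Trigger.mem_out, ht]
  constructor
  · rintro ⟨b, hb, rfl⟩
    obtain ⟨x, hx, rfl⟩ := (Rule.mem_head_ofS h).1 hb
    exact ⟨x, hx, (inst_subst _ _).symm⟩
  · rintro ⟨x, hx, rfl⟩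
    exact ⟨_, (Rule.mem_head_ofS h).2 ⟨x, hx, rfl⟩, inst_subst _ _⟩

theorem Trigger.ext_bodyVar (h : r.WF) (ht : t.rule = Rule.ofS r) {v : ℕ} (hv : v ∈ r.bodyVars) :
    t.ext v = t.map v :=
  Trigger.ext_body (by rw [ht]; exact (Rule.mem_vars_body_ofS h).2 hv)

theorem Trigger.ext_headVar (h : r.WF) (ht : t.rule = Rule.ofS r) {v : ℕ} (hv : v ∈ r.headVars)
    (hv' : v ∉ r.bodyVars) : t.ext v = .var (t.freshVar v) :=
  Trigger.ext_exVar (by rw [ht]; exact (Rule.mem_exVars_ofS h).2 ⟨hv, hv'⟩)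

theorem Trigger.mem_out_datalog (h : r.IsD) (ht : t.rule = Rule.ofS r) {a : Atom} :
    a ∈ t.out ↔ ∃ x ∈ r.2, inst t.map x = a := by
  rw [Trigger.mem_out_ofS h.1 ht]
  refine exists_congr fun x => and_congr_right fun hx => ?_
  have : inst t.ext x = inst t.map x := by
    simp only [inst, Atom.mk.injEq, true_and]
    exact List.map_congr_left fun v hv =>
      Trigger.ext_bodyVar h.1 ht (h.2 v (List.mem_flatMap.2 ⟨x, hx, hv⟩))
  rw [this]

theorem SRule.IsD.exVars (h : r.IsD) : (Rule.ofS r).exVars = ∅ := by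
  ext v
  simp only [Rule.mem_exVars_ofS h.1, Finset.notMem_empty, iff_false, not_and, not_not]
  exact h.2 v

theorem applicable_of_datalog (h : r.IsD) (ht : t.rule = Rule.ofS r) (ho : t.IsOn F) :
    Applicable .R t F ↔ ¬ t.out ⊆ F := by
  refine ⟨Applicable.not_subset, fun hn => applicable_iff.2 ?_⟩
  rintro ⟨σ, h1, h2⟩
  refine hn fun a ha => ?_
  have := h2 a ha
  rwa [Atom.subst_eq_self] at this
  intro v hv
  rcases ho.vars_out (FactBase.mem_vars.2 ⟨a, ha, hv⟩) with h' | ⟨z, hz, -⟩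
  · exact h1 v h'
  · rw [ht, h.exVars] at hz
    simp at hz

/-- The terms of a factbase. -/
def FactBase.terms (F : FactBase) : Set Term := {u | ∃ a ∈ F, u ∈ a.args}

theorem FactBase.terms_finite (F : FactBase) : (FactBase.terms F).Finite := by
  have : FactBase.terms F = ⋃ a ∈ F, {u | u ∈ a.args} := by
    ext u; simp [FactBase.terms]
  rw [this]
  exact Set.Finite.biUnion F.finite_toSet fun a _ => a.args.finite_toSet

theorem Trigger.IsOn.map_mem_terms (ho : t.IsOn F) {v : ℕ}
    (hv : v ∈ FactBase.vars t.rule.body) : t.map v ∈ FactBase.terms F := by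
  obtain ⟨a, ha, hva⟩ := FactBase.mem_vars.1 hv
  refine ⟨_, ho a ha, ?_⟩
  exact List.mem_map.2 ⟨_, hva, rfl⟩

theorem terms_out_datalog (h : r.IsD) (ht : t.rule = Rule.ofS r) (ho : t.IsOn F) :
    FactBase.terms t.out ⊆ FactBase.terms F := by
  rintro u ⟨a, ha, hu⟩
  obtain ⟨x, hx, rfl⟩ := (Trigger.mem_out_datalog h ht).1 ha
  obtain ⟨v, hv, rfl⟩ := List.mem_map.1 hu
  refine ho.map_mem_terms ?_
  rw [ht, Rule.mem_vars_body_ofS h.1]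
  exact h.2 v (List.mem_flatMap.2 ⟨x, hx, hv⟩)

end

/-- Only finitely many triggers of a run have all their terms in a given finite set. -/
theorem IsRun.finite_of_terms {𝓡 : RuleSet} {fb : ℕ → FactBase} {tr : ℕ → Trigger}
    (h : IsRun 𝓡 fb tr) {T : Set Term} (hT : T.Finite) :
    {j | ∀ v ∈ FactBase.vars (tr j).rule.body, (tr j).map v ∈ T}.Finite := by
  let V : Finset ℕ := 𝓡.sup fun R => FactBase.vars R.body
  let φ : ℕ → Rule × (V → Term) := fun j =>
    ((tr j).rule, fun v => if v.1 ∈ FactBase.vars (tr j).rule.body then (tr j).map v else .const 0)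
  have hfin : ((𝓡 : Set Rule) ×ˢ Set.pi Set.univ fun _ : V => insert (Term.const 0) T).Finite :=
    𝓡.finite_toSet.prod (Set.Finite.pi fun _ => hT.insert _)
  refine Set.Finite.of_finite_image (f := φ) (hfin.subset ?_) ?_
  · rintro _ ⟨j, hj, rfl⟩
    refine ⟨(h j).1.1, fun v _ => ?_⟩
    by_cases hv : v.1 ∈ FactBase.vars (tr j).rule.body
    · simp only [φ, if_pos hv]
      exact .inr (hj v hv)
    · simp only [φ, if_neg hv]
      exact .inl rfl
  · intro i _ j _ hij
    have he : (tr i).Equiv (tr j) := by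
      obtain ⟨h1, h2⟩ := Prod.mk.inj hij
      refine ⟨h1, fun v hv => ?_⟩
      have hV : v ∈ V := Finset.mem_sup.2 ⟨_, (h i).1.1, hv⟩
      have := congrFun h2 ⟨v, hV⟩
      simpa [← h1, hv] using this
    rcases lt_trichotomy i j with hlt | rfl | hlt
    · exact (h.not_equiv hlt he).elim
    · rfl
    · exact (h.not_equiv hlt he.symm).elim

/-- Infinitely many steps of a run use rules that are not Datalog. -/
theorem IsRun.no_datalog {𝓡 : RuleSet} {fb : ℕ → FactBase} {tr : ℕ → Trigger}
    (h : IsRun 𝓡 fb tr) (k : ℕ) (hd : ∀ i ≥ k, ∃ r : SRule, r.IsD ∧ (tr i).rule = Rule.ofS r) :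
    False := by
  have hterms : ∀ i, FactBase.terms (fb (k + i)) ⊆ FactBase.terms (fb k) := by
    intro i
    induction i with
    | zero => exact subset_rfl
    | succ i ih =>
      obtain ⟨r, hr, hri⟩ := hd (k + i) (Nat.le_add_right _ _)
      rintro u ⟨a, ha, hu⟩
      rw [← add_assoc, (h (k + i)).2, Finset.mem_union] at ha
      rcases ha with ha | ha
      · exact ih ⟨a, ha, hu⟩
      · exact ih (terms_out_datalog hr hri (h _).1.2.1 ⟨a, ha, hu⟩)
  have hfin := h.finite_of_terms (FactBase.terms_finite (fb k))
  refine Set.Ici_infinite k (hfin.subset fun j hj v hv => ?_)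
  have := hterms (j - k)
  rw [Nat.add_sub_cancel' hj] at this
  exact this ((h j).1.2.1.map_mem_terms hv)

/-- Application of a rule from a list. -/
def LStep (𝓡 : RuleSet) (L : List SRule) (F G : FactBase) : Prop :=
  ∃ r ∈ L, ∃ t : Trigger, t.rule = Rule.ofS r ∧ CanApply 𝓡 F t ∧ G = F ∪ t.out

/-- Exhaustive application of Datalog rules. -/
theorem exists_saturation {𝓡 : RuleSet} {L : List SRule} (hL : ∀ r ∈ L, r.IsD)
    (hR : ∀ r ∈ L, Rule.ofS r ∈ 𝓡) (F : FactBase) :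
    ∃ G, Relation.ReflTransGen (LStep 𝓡 L) F G ∧
      ∀ t : Trigger, ∀ r ∈ L, t.rule = Rule.ofS r → t.IsOn G → t.out ⊆ G := by
  by_contra hc
  push Not at hc
  have hstep : ∀ G : {G // Relation.ReflTransGen (LStep 𝓡 L) F G},
      ∃ G' : {G // Relation.ReflTransGen (LStep 𝓡 L) F G}, ∃ t : Trigger,
        (∃ r ∈ L, t.rule = Rule.ofS r) ∧ CanApply 𝓡 G.1 t ∧ G'.1 = G.1 ∪ t.out := by
    intro G
    obtain ⟨t, r, hr, htr, ho, hout⟩ := hc G.1 G.2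
    have happ : CanApply 𝓡 G.1 t := by
      refine ⟨htr ▸ hR r hr, ho, ?_⟩
      exact (applicable_of_datalog (hL r hr) htr ho).2 hout
    exact ⟨⟨_, G.2.tail ⟨r, hr, t, htr, happ, rfl⟩⟩, t, ⟨r, hr, htr⟩, happ, rfl⟩
  choose nx tr h1 h2 h3 using hstep
  let f : ℕ → {G // Relation.ReflTransGen (LStep 𝓡 L) F G} := fun n => nx^[n] ⟨F, .refl⟩
  have hrun : IsRun 𝓡 (fun n => (f n).1) (fun n => tr (f n)) := fun i =>
    ⟨h2 _, by simp only [f, Function.iterate_succ_apply']; exact h3 _⟩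
  refine hrun.no_datalog 0 fun i _ => ?_
  obtain ⟨r, hr, hrr⟩ := h1 (f i)
  exact ⟨r, hL r hr, hrr⟩

theorem LStep.step {𝓡 : RuleSet} {L : List SRule} {F G : FactBase} (h : LStep 𝓡 L F G) :
    Step 𝓡 F G :=
  let ⟨_, _, t, _, h1, h2⟩ := h
  ⟨t, h1, h2⟩

/-! ### The rule set simulating a code -/

/-- Adding a label, the variable `0`, to an atom of a program. -/
def labelled (a : ℕ × List ℕ) : ℕ × List ℕ := (a.1, 0 :: a.2)

/-- Adding labels to a rule of a program. -/
def progRule (r : PRule) : SRule := (r.1.map labelled, [labelled r.2])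

/-- Every number of a stage (predicate `0`) has a successor (predicate `1`). -/
def rGrow : SRule := ([(0, [0, 1])], [(1, [0, 1, 2]), (0, [0, 2]), (1, [0, 2, 0]), (3, [2, 0, 0])])

/-- Every stage is eventually closed. -/
def rAct : SRule := ([(0, [0, 1])], [(0, [0, 0]), (2, [0, 0]), (1, [0, 0, 0]), (3, [0, 0, 0])])

/-- An event (predicate `10`) opens a stage with a zero (predicate `2`) and a link (predicate `3`)
to the number of the event. -/
def rEvent : SRule :=
  ([(10, [0, 1])], [(3, [1, 3, 2]), (0, [2, 3]), (2, [2, 3]), (1, [2, 3, 2]), (3, [3, 2, 2])])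

/-- Successor for the program. -/
def rSucc : SRule := ([(1, [0, 1, 2]), (0, [0, 1]), (0, [0, 2])], [(4, [0, 1, 2])])

/-- Zero for the program. -/
def rZero : SRule := ([(2, [0, 1]), (0, [0, 1])], [(5, [0, 1])])

/-- The descent along a link (predicate `8`) starts at the number of the event. -/
def rDescend : SRule := ([(3, [1, 2, 0]), (0, [0, 2]), (2, [0, 2])], [(8, [0, 2, 1])])

/-- The descent along a link counts up in the new stage and down in the old one. -/
def rCount : SRule := ([(8, [0, 1, 2]), (4, [0, 1, 3]), (1, [4, 5, 2])], [(8, [0, 3, 5])])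

/-- The successor of the number of the last event is a query (predicate `9`). -/
def rQuery : SRule := ([(8, [0, 1, 2]), (2, [4, 2]), (4, [0, 1, 3])], [(9, [0, 3])])

/-- An event happens when the computation for a query halts. -/
def rHalt (p : ℕ) : SRule := ([(9, [0, 1]), (p, [0, 1, 2])], [(10, [0, 1])])

/-- The Datalog rules other than `rAct`. -/
def dlRules (c : Code) : List SRule :=
  [rSucc, rZero, rDescend, rCount, rQuery, rHalt (codePred c)] ++
    (prog (Encodable.encode c)).map progRule

/-- All rules. -/
def allRules (c : Code) : List SRule := [rGrow, rAct, rEvent] ++ dlRules c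

/-- The rule set simulating a code. -/
def rset (c : Code) : RuleSet := ((allRules c).map Rule.ofS).toFinset

theorem mem_rset {c : Code} {R : Rule} : R ∈ rset c ↔ ∃ r ∈ allRules c, Rule.ofS r = R := by
  simp [rset]

theorem rGrow_wf : rGrow.WF := by simp [SRule.WF, rGrow]

theorem rEvent_wf : rEvent.WF := by simp [SRule.WF, rEvent]

theorem rAct_isD : rAct.IsD := by
  simp [SRule.IsD, SRule.WF, SRule.headVars, SRule.bodyVars, rAct]

theorem mem_prog {N : ℕ} {r : PRule} (h : r ∈ prog N) :
    r ∈ baseProg ∨ ∃ c d, r ∈ codeProg c d := by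
  simp only [prog, List.mem_append, List.mem_flatMap] at h
  rcases h with h | ⟨m, _, k, _, h⟩
  · exact .inl h
  · exact .inr ⟨_, _, h⟩

theorem progRule_isD {N : ℕ} {r : PRule} (h : r ∈ prog N) : (progRule r).IsD := by
  rcases mem_prog h with h | ⟨c, d, h⟩
  · simp only [baseProg, List.mem_cons, List.not_mem_nil, or_false] at h
    rcases h with rfl | rfl | rfl | rfl | rfl | rfl | rfl | rfl | rfl | rfl | rfl <;>
      simp [SRule.IsD, SRule.WF, SRule.headVars, SRule.bodyVars, progRule, labelled]
  · simp only [codeProg, List.mem_cons, List.not_mem_nil, or_false] at h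
    rcases h with rfl | rfl | rfl | rfl | rfl | rfl <;>
      simp [SRule.IsD, SRule.WF, SRule.headVars, SRule.bodyVars, progRule, labelled]

/-- The predicates of the program. -/
def IsProgPred (p : ℕ) : Prop := (4 ≤ p ∧ p ≤ 7) ∨ 11 ≤ p

theorem isProgPred_codePred (c : Code) : IsProgPred (codePred c) :=
  .inr (by simp [codePred])

theorem prog_preds {N : ℕ} {r : PRule} (h : r ∈ prog N) :
    (∀ a ∈ r.1, IsProgPred a.1) ∧ IsProgPred r.2.1 ∧ ∀ v ∈ r.2.2, ∃ a ∈ r.1, v ∈ a.2 := by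
  have h4 : IsProgPred 4 := by simp [IsProgPred]
  have h5 : IsProgPred 5 := by simp [IsProgPred]
  have h6 : IsProgPred 6 := by simp [IsProgPred]
  have h7 : IsProgPred 7 := by simp [IsProgPred]
  rcases mem_prog h with h | ⟨c, d, h⟩
  · simp only [baseProg, List.mem_cons, List.not_mem_nil, or_false] at h
    rcases h with rfl | rfl | rfl | rfl | rfl | rfl | rfl | rfl | rfl | rfl | rfl <;>
      simp [isProgPred_codePred, h4, h5, h6, h7]
  · simp only [codeProg, List.mem_cons, List.not_mem_nil, or_false] at h
    rcases h with rfl | rfl | rfl | rfl | rfl | rfl <;>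
      simp [isProgPred_codePred, h4, h5, h7]

theorem dlRules_isD {c : Code} {r : SRule} (h : r ∈ dlRules c) : r.IsD := by
  simp only [dlRules, List.mem_append, List.mem_cons, List.not_mem_nil, or_false,
    List.mem_map] at h
  rcases h with (rfl | rfl | rfl | rfl | rfl | rfl) | ⟨r, hr, rfl⟩
  iterate 6
    simp [SRule.IsD, SRule.WF, SRule.headVars, SRule.bodyVars, rSucc, rZero, rDescend, rCount,
      rQuery, rHalt]
  exact progRule_isD hr

theorem allRules_wf {c : Code} {r : SRule} (h : r ∈ allRules c) : r.WF := by
  rcases List.mem_append.1 h with h | h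
  · simp only [List.mem_cons, List.not_mem_nil, or_false] at h
    rcases h with rfl | rfl | rfl
    exacts [rGrow_wf, rAct_isD.1, rEvent_wf]
  · exact (dlRules_isD h).1

theorem mem_rset_of_dlRules {c : Code} {r : SRule} (h : r ∈ dlRules c) : Rule.ofS r ∈ rset c :=
  mem_rset.2 ⟨r, List.mem_append_right _ h, rfl⟩

/-! ### Computability of the rule set -/

theorem primrec_codePred : Primrec codePred :=
  Primrec.nat_add.comp (Primrec.const 11) Primrec.encode

theorem primrec_codeProg : Primrec₂ codeProg := by
  have h1 : Primrec fun x : Code × Code => codePred x.1 := primrec_codePred.comp Primrec.fst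
  have h2 : Primrec fun x : Code × Code => codePred x.2 := primrec_codePred.comp Primrec.snd
  have h3 : Primrec fun x : Code × Code => codePred (x.1.pair x.2) :=
    primrec_codePred.comp Code.primrec₂_pair
  have h4 : Primrec fun x : Code × Code => codePred (x.1.comp x.2) :=
    primrec_codePred.comp Code.primrec₂_comp
  have h5 : Primrec fun x : Code × Code => codePred (x.1.prec x.2) :=
    primrec_codePred.comp Code.primrec₂_prec
  have h6 : Primrec fun x : Code × Code => codePred x.1.rfind' :=
    primrec_codePred.comp (Code.primrec_rfind'.comp Primrec.fst)
  unfold Primrec₂ codeProg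
  repeat with_reducible first
    | exact h1
    | exact h2
    | exact h3
    | exact h4
    | exact h5
    | exact h6
    | exact Primrec.const _
    | refine Primrec.pair ?_ ?_
    | refine Primrec.list_cons.comp ?_ ?_

theorem primrec_prog : Primrec prog := by
  refine Primrec.list_append.comp (Primrec.const _) ?_
  refine Primrec.list_flatMap Primrec.list_range ?_
  refine Primrec.list_flatMap (Primrec.list_range.comp Primrec.fst) ?_
  exact primrec_codeProg.comp ((Primrec.ofNat Code).comp (Primrec.snd.comp Primrec.fst))
    ((Primrec.ofNat Code).comp Primrec.snd)

theorem primrec_labelled : Primrec labelled :=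
  Primrec.pair Primrec.fst (Primrec.list_cons.comp (Primrec.const 0) Primrec.snd)

theorem primrec_progRule : Primrec progRule :=
  Primrec.pair (Primrec.list_map Primrec.fst (primrec_labelled.comp Primrec.snd).to₂)
    (Primrec.list_cons.comp (primrec_labelled.comp Primrec.snd) (Primrec.const []))

theorem primrec_allRules : Primrec allRules := by
  have h : Primrec fun c : Code => rHalt (codePred c) := by
    have := primrec_codePred
    unfold rHalt
    repeat first
      | exact Primrec.const _
      | exact primrec_codePred
      | refine Primrec.list_cons.comp ?_ ?_
      | refine Primrec.pair ?_ ?_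
  unfold allRules dlRules
  refine Primrec.list_append.comp (Primrec.const _) (Primrec.list_append.comp ?_
    (Primrec.list_map (primrec_prog.comp Primrec.encode) (primrec_progRule.comp Primrec.snd).to₂))
  repeat first
    | exact Primrec.const _
    | exact h
    | refine Primrec.list_cons.comp ?_ ?_

theorem primrec_inst_var : Primrec (inst .var) :=
  primrec_atom.comp Primrec.fst
    (Primrec.list_map Primrec.snd (primrec_var.comp Primrec.snd).to₂)

theorem primrec_toL : Primrec SRule.toL :=
  Primrec.pair (Primrec.list_map Primrec.fst (primrec_inst_var.comp Primrec.snd).to₂)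
    (Primrec.list_map Primrec.snd (primrec_inst_var.comp Primrec.snd).to₂)

theorem primrec_encode_rset : Primrec fun c => Encodable.encode (rset c) := by
  have h : Primrec fun c => (allRules c).map SRule.toL :=
    Primrec.list_map primrec_allRules (primrec_toL.comp Primrec.snd).to₂
  refine (primrec_ruleSetCode.comp h).of_eq fun c => ?_
  rw [← encode_ruleSet, List.map_map]
  · rfl
  · intro r hr
    obtain ⟨s, hs, rfl⟩ := List.mem_map.1 hr
    exact (allRules_wf hs).toL

/-! ### Triggers of the simulating rule set -/

/-- The output of `rGrow`. -/
def growOut (b x y : Term) : Finset Atom :=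
  {⟨1, [b, x, y]⟩, ⟨0, [b, y]⟩, ⟨1, [b, y, b]⟩, ⟨3, [y, b, b]⟩}

/-- The output of `rAct`. -/
def actOut (b : Term) : Finset Atom :=
  {⟨0, [b, b]⟩, ⟨2, [b, b]⟩, ⟨1, [b, b, b]⟩, ⟨3, [b, b, b]⟩}

/-- The output of `rEvent`. -/
def eventOut (x β o : Term) : Finset Atom :=
  {⟨3, [x, o, β]⟩, ⟨0, [β, o]⟩, ⟨2, [β, o]⟩, ⟨1, [β, o, β]⟩, ⟨3, [o, β, β]⟩}

section
variable {t : Trigger} {F : FactBase}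

theorem out_grow (ht : t.rule = Rule.ofS rGrow) :
    t.out = growOut (t.map 0) (t.map 1) (.var (t.freshVar 2)) := by
  have h0 := Trigger.ext_bodyVar rGrow_wf ht (v := 0) (by simp [SRule.bodyVars, rGrow])
  have h1 := Trigger.ext_bodyVar rGrow_wf ht (v := 1) (by simp [SRule.bodyVars, rGrow])
  have h2 := Trigger.ext_headVar rGrow_wf ht (v := 2) (by simp [SRule.headVars, rGrow])
    (by simp [SRule.bodyVars, rGrow])
  ext a
  rw [Trigger.mem_out_ofS rGrow_wf ht]
  simp [rGrow, growOut, inst, h0, h1, h2, eq_comm]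

theorem out_event (ht : t.rule = Rule.ofS rEvent) :
    t.out = eventOut (t.map 1) (.var (t.freshVar 2)) (.var (t.freshVar 3)) := by
  have h1 := Trigger.ext_bodyVar rEvent_wf ht (v := 1) (by simp [SRule.bodyVars, rEvent])
  have h2 := Trigger.ext_headVar rEvent_wf ht (v := 2) (by simp [SRule.headVars, rEvent])
    (by simp [SRule.bodyVars, rEvent])
  have h3 := Trigger.ext_headVar rEvent_wf ht (v := 3) (by simp [SRule.headVars, rEvent])
    (by simp [SRule.bodyVars, rEvent])
  ext a
  rw [Trigger.mem_out_ofS rEvent_wf ht]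
  simp [rEvent, eventOut, inst, h1, h2, h3, eq_comm]

theorem out_act (ht : t.rule = Rule.ofS rAct) : t.out = actOut (t.map 0) := by
  ext a
  rw [Trigger.mem_out_datalog rAct_isD ht]
  simp [rAct, actOut, inst, eq_comm]

theorem isOn_grow (ht : t.rule = Rule.ofS rGrow) :
    t.IsOn F ↔ (⟨0, [t.map 0, t.map 1]⟩ : Atom) ∈ F := by
  rw [Trigger.isOn_ofS rGrow_wf ht]
  simp [rGrow, inst]

theorem isOn_event (ht : t.rule = Rule.ofS rEvent) :
    t.IsOn F ↔ (⟨10, [t.map 0, t.map 1]⟩ : Atom) ∈ F := by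
  rw [Trigger.isOn_ofS rEvent_wf ht]
  simp [rEvent, inst]

theorem isOn_act (ht : t.rule = Rule.ofS rAct) :
    t.IsOn F ↔ (⟨0, [t.map 0, t.map 1]⟩ : Atom) ∈ F := by
  rw [Trigger.isOn_ofS rAct_isD.1 ht]
  simp [rAct, inst]

theorem rule_cases {c : Code} (h : t.rule ∈ rset c) :
    t.rule = Rule.ofS rGrow ∨ t.rule = Rule.ofS rAct ∨ t.rule = Rule.ofS rEvent ∨
      ∃ r ∈ dlRules c, t.rule = Rule.ofS r := by
  obtain ⟨r, hr, hrt⟩ := mem_rset.1 h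
  simp only [allRules, List.mem_append, List.mem_cons, List.not_mem_nil, or_false] at hr
  rcases hr with (rfl | rfl | rfl) | hr
  · exact .inl hrt.symm
  · exact .inr (.inl hrt.symm)
  · exact .inr (.inr (.inl hrt.symm))
  · exact .inr (.inr (.inr ⟨r, hr, hrt.symm⟩))

/-- The substitution sending a variable to a term and fixing the other variables. -/
theorem applyTerm_single {v : ℕ} {b u : Term} (hu : u ≠ .var v) :
    applyTerm (fun w => if w = v then b else .var w) u = u := by
  cases u with
  | const => rfl
  | var w => exact if_neg fun h : w = v => hu (h ▸ rfl)

theorem var_ne_of_mem {a : Atom} (ha : a ∈ F) {u : Term} (hu : u ∈ a.args) {v : ℕ}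
    (hv : v ∉ FactBase.vars F) : u ≠ .var v := fun h =>
  hv (FactBase.mem_vars.2 ⟨a, ha, h ▸ hu⟩)

theorem not_applicable_grow (ht : t.rule = Rule.ofS rGrow) (ho : t.IsOn F)
    (hf : t.freshVar 2 ∉ FactBase.vars F) (ha : actOut (t.map 0) ⊆ F)
    (hs : (⟨1, [t.map 0, t.map 1, t.map 0]⟩ : Atom) ∈ F) : ¬ Applicable .R t F := by
  rw [applicable_iff, not_not]
  have hb := (isOn_grow ht).1 ho
  have h0 := var_ne_of_mem hb (u := t.map 0) (by simp) hf
  have h1 := var_ne_of_mem hb (u := t.map 1) (by simp) hf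
  refine ⟨fun w => if w = t.freshVar 2 then t.map 0 else .var w, fun v hv => if_neg ?_, ?_⟩
  · rintro rfl
    exact hf hv
  · rw [out_grow ht]
    simp only [actOut, Finset.insert_subset_iff, Finset.singleton_subset_iff] at ha
    simp [growOut, Atom.subst, applyTerm_single h0, applyTerm_single h1, ha, hs]

theorem not_applicable_event (ht : t.rule = Rule.ofS rEvent) (ho : t.IsOn F)
    (hf2 : t.freshVar 2 ∉ FactBase.vars F) (hf3 : t.freshVar 3 ∉ FactBase.vars F)
    (ha : actOut (t.map 0) ⊆ F)
    (hs : (⟨3, [t.map 1, t.map 0, t.map 0]⟩ : Atom) ∈ F) : ¬ Applicable .R t F := by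
  rw [applicable_iff, not_not]
  have hb := (isOn_event ht).1 ho
  have h2 := var_ne_of_mem hb (u := t.map 1) (by simp) hf2
  have h3 := var_ne_of_mem hb (u := t.map 1) (by simp) hf3
  refine ⟨fun w => if w = t.freshVar 2 ∨ w = t.freshVar 3 then t.map 0 else .var w,
    fun v hv => if_neg ?_, ?_⟩
  · rintro (rfl | rfl)
    exacts [hf2 hv, hf3 hv]
  · rw [out_event ht]
    have h1 : applyTerm (fun w => if w = t.freshVar 2 ∨ w = t.freshVar 3 then t.map 0
        else .var w) (t.map 1) = t.map 1 := by
      cases h : t.map 1 with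
      | const => rfl
      | var w =>
        rw [h] at h2 h3
        exact if_neg (by rintro (rfl | rfl); exacts [h2 rfl, h3 rfl])
    simp only [actOut, Finset.insert_subset_iff, Finset.singleton_subset_iff] at ha
    simp [eventOut, Atom.subst, h1, ha, hs]

theorem applyTerm_fixed {σ : Subst} (hσ : ∀ v ∈ FactBase.vars F, σ v = .var v) {a : Atom}
    (ha : a ∈ F) {u : Term} (hu : u ∈ a.args) : applyTerm σ u = u := by
  cases u with
  | const => rfl
  | var v => exact hσ v (FactBase.mem_vars.2 ⟨a, ha, hu⟩)

theorem applicable_grow (ht : t.rule = Rule.ofS rGrow) (ho : t.IsOn F)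
    (hb : (⟨0, [t.map 0, t.map 0]⟩ : Atom) ∉ F)
    (hs : ∀ z, (⟨1, [t.map 0, t.map 1, z]⟩ : Atom) ∈ F → z = t.map 0) : Applicable .R t F := by
  rw [applicable_iff]
  rintro ⟨σ, hσ, h⟩
  have hb' := (isOn_grow ht).1 ho
  have h0 := applyTerm_fixed hσ hb' (u := t.map 0) (by simp)
  have h1 := applyTerm_fixed hσ hb' (u := t.map 1) (by simp)
  rw [out_grow ht] at h
  simp [growOut, Atom.subst, h0, h1] at h
  have := hs _ h.1
  rw [this] at h
  exact hb h.2.1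

theorem applicable_event (ht : t.rule = Rule.ofS rEvent) (ho : t.IsOn F)
    (hb : (⟨0, [t.map 0, t.map 0]⟩ : Atom) ∉ F)
    (hs : ∀ y z, (⟨3, [t.map 1, y, z]⟩ : Atom) ∈ F → y = t.map 0 ∧ z = t.map 0) :
    Applicable .R t F := by
  rw [applicable_iff]
  rintro ⟨σ, hσ, h⟩
  have h1 := applyTerm_fixed hσ ((isOn_event ht).1 ho) (u := t.map 1) (by simp)
  rw [out_event ht] at h
  simp [eventOut, Atom.subst, h1] at h
  have := hs _ _ h.1
  rw [this.1, this.2] at h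
  exact hb h.2.1

end

/-! ### Infinite runs of the simulating rule set -/

/-- A run of the simulating rule set in which all fresh variables are new. -/
structure FreshRun (c : Code) (fb : ℕ → FactBase) (tr : ℕ → Trigger) : Prop where
  run : IsRun (rset c) fb tr
  fresh : ∀ j z, (tr j).freshVar z ∉ FactBase.vars (fb j)

/-- The fresh term of a step. -/
def fv (tr : ℕ → Trigger) (j z : ℕ) : Term := .var ((tr j).freshVar z)

/-- The numbers of the stages opened by events. -/
inductive Num (tr : ℕ → Trigger) : Term → ℕ → Term → Prop
  | zero (j : ℕ) (hj : (tr j).rule = Rule.ofS rEvent) : Num tr (fv tr j 2) 0 (fv tr j 3)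
  | succ {b x : Term} {n : ℕ} (j : ℕ) (hj : (tr j).rule = Rule.ofS rGrow) (hb : (tr j).map 0 = b)
      (hx : (tr j).map 1 = x) (h : Num tr b n x) : Num tr b (n + 1) (fv tr j 2)

theorem rGrow_ne_rEvent : Rule.ofS rGrow ≠ Rule.ofS rEvent := by
  intro h
  have h1 : inst .var (0, [0, 1]) ∈ (Rule.ofS rEvent).body := by
    rw [← h, Rule.mem_body_ofS rGrow_wf]
    exact ⟨(0, [0, 1]), by simp [rGrow], rfl⟩
  rw [Rule.mem_body_ofS rEvent_wf] at h1
  simp [rEvent, inst] at h1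

section
variable {c : Code} {fb : ℕ → FactBase} {tr : ℕ → Trigger}

theorem FreshRun.eq_of_equiv (h : FreshRun c fb tr) {i j : ℕ} (he : (tr i).Equiv (tr j)) :
    i = j := by
  rcases lt_trichotomy i j with hlt | rfl | hlt
  · exact (h.run.not_equiv hlt he).elim
  · rfl
  · exact (h.run.not_equiv hlt he.symm).elim

theorem FreshRun.fv_inj (h : FreshRun c fb tr) {i j z w : ℕ} (he : fv tr i z = fv tr j w) :
    i = j ∧ z = w := by
  obtain ⟨h1, h2⟩ := Trigger.equiv_of_freshVar (Term.var.inj he)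
  exact ⟨h.eq_of_equiv h1, h2⟩

theorem FreshRun.fv_notMem (h : FreshRun c fb tr) (j z : ℕ) :
    fv tr j z ∉ FactBase.terms (fb 0) := by
  rintro ⟨a, ha, hu⟩
  exact h.fresh j z (FactBase.mem_vars.2 ⟨a, h.run.mono (Nat.zero_le j) ha, hu⟩)

theorem Num.elem {b x : Term} {n : ℕ} (h : Num tr b n x) :
    (∃ j, (tr j).rule = Rule.ofS rEvent ∧ x = fv tr j 3) ∨
      ∃ j, (tr j).rule = Rule.ofS rGrow ∧ x = fv tr j 2 := by
  cases h with
  | zero j hj => exact .inl ⟨j, hj, rfl⟩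
  | succ j hj => exact .inr ⟨j, hj, rfl⟩

theorem Num.label {b x : Term} {n : ℕ} (h : Num tr b n x) :
    ∃ j, (tr j).rule = Rule.ofS rEvent ∧ b = fv tr j 2 := by
  induction h with
  | zero j hj => exact ⟨j, hj, rfl⟩
  | succ _ _ _ _ _ ih => exact ih

/-- The labels of stages. -/
def IsLabel (fb : ℕ → FactBase) (tr : ℕ → Trigger) (b : Term) : Prop :=
  b ∈ FactBase.terms (fb 0) ∨ ∃ j, (tr j).rule = Rule.ofS rEvent ∧ b = fv tr j 2

theorem Num.notMem (hF : FreshRun c fb tr) {b x : Term} {n : ℕ} (h : Num tr b n x) :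
    x ∉ FactBase.terms (fb 0) := by
  rcases h.elem with ⟨j, _, rfl⟩ | ⟨j, _, rfl⟩ <;> exact hF.fv_notMem _ _

theorem Num.not_isLabel (hF : FreshRun c fb tr) {b x : Term} {n : ℕ} (h : Num tr b n x) :
    ¬ IsLabel fb tr x := by
  rintro (hx | ⟨i, hi, hx⟩)
  · exact h.notMem hF hx
  · rcases h.elem with ⟨j, hj, rfl⟩ | ⟨j, hj, rfl⟩
    · exact absurd (hF.fv_inj hx).2 (by norm_num)
    · obtain rfl := (hF.fv_inj hx).1
      exact rGrow_ne_rEvent (hj.symm.trans hi)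

theorem Num.isLabel {b x : Term} {n : ℕ} (h : Num tr b n x) : IsLabel fb tr b :=
  .inr h.label

theorem Num.zero_inv (hF : FreshRun c fb tr) {b : Term} {n i : ℕ} (h : Num tr b n (fv tr i 3)) :
    n = 0 ∧ b = fv tr i 2 := by
  generalize hx : fv tr i 3 = x at h
  cases h with
  | zero j hj =>
    obtain rfl := (hF.fv_inj hx).1
    exact ⟨rfl, rfl⟩
  | succ j hj => exact absurd (hF.fv_inj hx).2 (by norm_num)

theorem Num.succ_inv (hF : FreshRun c fb tr) {b : Term} {n i : ℕ} (h : Num tr b n (fv tr i 2)) :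
    b = (tr i).map 0 ∧ ∃ m, n = m + 1 ∧ Num tr b m ((tr i).map 1) := by
  generalize hx : fv tr i 2 = x at h
  cases h with
  | zero j hj => exact absurd (hF.fv_inj hx).2 (by norm_num)
  | succ j hj hb hx' h =>
    obtain rfl := (hF.fv_inj hx).1
    exact ⟨hb.symm, _, rfl, hx' ▸ h⟩

theorem Num.unique (hF : FreshRun c fb tr) {b b' x : Term} {n m : ℕ} (h : Num tr b n x)
    (h' : Num tr b' m x) : n = m := by
  induction h generalizing b' m with
  | zero j hj => exact (h'.zero_inv hF).1.symm
  | succ j hj hb hx h ih =>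
    obtain ⟨-, k, rfl, h1⟩ := h'.succ_inv hF
    rw [ih (hx ▸ h1)]

/-- The step `j` is an event opening the stage `b`, and unless the event takes place in an initial
stage, its number in that stage satisfies `P`. -/
def Opened (fb : ℕ → FactBase) (tr : ℕ → Trigger) (j : ℕ) (b : Term) (P : ℕ → Prop) : Prop :=
  (tr j).rule = Rule.ofS rEvent ∧ b = fv tr j 2 ∧
    ((tr j).map 0 ∉ FactBase.terms (fb 0) → ∃ m, Num tr ((tr j).map 0) m ((tr j).map 1) ∧ P m)

/-- `x` is a number of the stage `b`, or both occur in the initial factbase. -/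
def Dom (fb : ℕ → FactBase) (G : FactBase) (b x : Term) : Prop :=
  (b ∈ FactBase.terms (fb 0) ∧ x ∈ FactBase.terms (fb 0)) ∨ (⟨0, [b, x]⟩ : Atom) ∈ G

/-- The stage `b` is part of the initial factbase or has been closed. -/
def Free (fb : ℕ → FactBase) (G : FactBase) (b : Term) : Prop :=
  b ∈ FactBase.terms (fb 0) ∨ actOut b ⊆ G

/-- The atoms that can occur in a run. -/
inductive Good (c : Code) (fb : ℕ → FactBase) (tr : ℕ → Trigger) (G : FactBase) : Atom → Prop
  | initial {a : Atom} (h : ∀ u ∈ a.args, u ∈ FactBase.terms (fb 0)) : Good c fb tr G a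
  | num {b x : Term} (hb : IsLabel fb tr b) (h : (x = b ∧ actOut b ⊆ G) ∨
      ((⟨1, [b, x, b]⟩ : Atom) ∈ G ∧ (⟨3, [x, b, b]⟩ : Atom) ∈ G ∧
        (b ∉ FactBase.terms (fb 0) → ∃ n, Num tr b n x))) : Good c fb tr G ⟨0, [b, x]⟩
  | loop {b x : Term} (hb : IsLabel fb tr b) : Good c fb tr G ⟨1, [b, x, b]⟩
  | succ {j : ℕ} (hj : (tr j).rule = Rule.ofS rGrow) :
      Good c fb tr G ⟨1, [(tr j).map 0, (tr j).map 1, fv tr j 2]⟩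
  | zloop {b : Term} (hb : IsLabel fb tr b) : Good c fb tr G ⟨2, [b, b]⟩
  | zero {j : ℕ} (hj : (tr j).rule = Rule.ofS rEvent) :
      Good c fb tr G ⟨2, [fv tr j 2, fv tr j 3]⟩
  | lloop {b x : Term} : Good c fb tr G ⟨3, [x, b, b]⟩
  | link {j : ℕ} {b : Term} (hj : Opened fb tr j b fun _ => True) :
      Good c fb tr G ⟨3, [(tr j).map 1, fv tr j 3, fv tr j 2]⟩
  | prog {p : ℕ} {b : Term} {ts : List Term} (hp : IsProgPred p)
      (hd : ∀ u ∈ ts, Dom fb G b u) (h : Free fb G b ∨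
        ∃ ns, List.Forall₂ (Num tr b) ns ts ∧ Der (Encodable.encode c) p ns) :
      Good c fb tr G ⟨p, b :: ts⟩
  | desc {b y e : Term} (h : Free fb G b ∨ ∃ j n, Num tr b n y ∧ Opened fb tr j b fun m =>
      ∃ k, Num tr ((tr j).map 0) k e ∧ n + k = m) : Good c fb tr G ⟨8, [b, y, e]⟩
  | query {b x : Term} (hd : Dom fb G b x) (h : Free fb G b ∨ ∃ j n, Num tr b n x ∧
      Opened fb tr j b fun m => n = m + 1) : Good c fb tr G ⟨9, [b, x]⟩
  | halt {b x : Term} (hd : Dom fb G b x) (h : Free fb G b ∨ ∃ j n, Num tr b n x ∧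
      (c.eval n).Dom ∧ Opened fb tr j b fun m => n = m + 1) : Good c fb tr G ⟨10, [b, x]⟩

theorem Dom.mono {G G' : FactBase} (h : G ⊆ G') {b x : Term} (hd : Dom fb G b x) :
    Dom fb G' b x := hd.imp_right fun h' => h h'

theorem Free.mono {G G' : FactBase} (h : G ⊆ G') {b : Term} (hd : Free fb G b) :
    Free fb G' b := hd.imp_right fun h' => h'.trans h

theorem Good.mono {G G' : FactBase} (hG : G ⊆ G') {a : Atom} (h : Good c fb tr G a) :
    Good c fb tr G' a := by
  cases h with
  | initial h => exact .initial h
  | num hb h =>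
    exact .num hb (h.imp (fun h => ⟨h.1, h.2.trans hG⟩) fun h => ⟨hG h.1, hG h.2.1, h.2.2⟩)
  | loop hb => exact .loop hb
  | succ hj => exact .succ hj
  | zloop hb => exact .zloop hb
  | zero hj => exact .zero hj
  | lloop => exact .lloop
  | link hj => exact .link hj
  | prog hp hd h => exact .prog hp (fun u hu => (hd u hu).mono hG) (h.imp_left (Free.mono hG))
  | desc h => exact .desc (h.imp_left (Free.mono hG))
  | query hd h => exact .query (hd.mono hG) (h.imp_left (Free.mono hG))
  | halt hd h => exact .halt (hd.mono hG) (h.imp_left (Free.mono hG))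

section inversion
variable {G : FactBase} {b x y e : Term}

theorem Good.num_inv (h : Good c fb tr G ⟨0, [b, x]⟩) : IsLabel fb tr b ∧
    ((b ∈ FactBase.terms (fb 0) ∧ x ∈ FactBase.terms (fb 0)) ∨ (x = b ∧ actOut b ⊆ G) ∨
      ((⟨1, [b, x, b]⟩ : Atom) ∈ G ∧ (⟨3, [x, b, b]⟩ : Atom) ∈ G ∧
        (b ∉ FactBase.terms (fb 0) → ∃ n, Num tr b n x))) := by
  cases h with
  | initial h => simp at h; exact ⟨.inl h.1, .inl h⟩
  | num hb h => exact ⟨hb, .inr h⟩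
  | prog hp => simp [IsProgPred] at hp

theorem Good.num_inv' (h : Good c fb tr G ⟨0, [b, x]⟩) : Free fb G b ∨ ∃ n, Num tr b n x := by
  rcases h.num_inv.2 with h | h | h
  · exact .inl (.inl h.1)
  · exact .inl (.inr h.2)
  · by_cases hb : b ∈ FactBase.terms (fb 0)
    · exact .inl (.inl hb)
    · exact .inr (h.2.2 hb)

theorem Good.succ_inv (h : Good c fb tr G ⟨1, [b, x, y]⟩) :
    y ∈ FactBase.terms (fb 0) ∨ (y = b ∧ IsLabel fb tr b) ∨
      ∃ j, (tr j).rule = Rule.ofS rGrow ∧ b = (tr j).map 0 ∧ x = (tr j).map 1 ∧ y = fv tr j 2 := by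
  cases h with
  | initial h => simp at h; exact .inl h.2.2
  | loop hb => exact .inr (.inl ⟨rfl, hb⟩)
  | succ hj => exact .inr (.inr ⟨_, hj, rfl, rfl, rfl⟩)
  | prog hp => simp [IsProgPred] at hp

theorem Good.zero_inv (h : Good c fb tr G ⟨2, [b, e]⟩) :
    e ∈ FactBase.terms (fb 0) ∨ (e = b ∧ IsLabel fb tr b) ∨
      ∃ j, (tr j).rule = Rule.ofS rEvent ∧ b = fv tr j 2 ∧ e = fv tr j 3 := by
  cases h with
  | initial h => simp at h; exact .inl h.2
  | zloop hb => exact .inr (.inl ⟨rfl, hb⟩)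
  | zero hj => exact .inr (.inr ⟨_, hj, rfl, rfl⟩)
  | prog hp => simp [IsProgPred] at hp

theorem Good.link_inv (h : Good c fb tr G ⟨3, [x, e, b]⟩) :
    b ∈ FactBase.terms (fb 0) ∨ e = b ∨
      ∃ j, x = (tr j).map 1 ∧ e = fv tr j 3 ∧ Opened fb tr j b fun _ => True := by
  cases h with
  | initial h => simp at h; exact .inl h.2.2
  | lloop => exact .inr (.inl rfl)
  | link hj => exact .inr (.inr ⟨_, rfl, rfl, hj.1, rfl, hj.2.2⟩)
  | prog hp => simp [IsProgPred] at hp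

theorem Good.prog_inv {p : ℕ} {ts : List Term} (hp : IsProgPred p)
    (h : Good c fb tr G ⟨p, b :: ts⟩) : (∀ u ∈ ts, Dom fb G b u) ∧ (Free fb G b ∨
      ∃ ns, List.Forall₂ (Num tr b) ns ts ∧ Der (Encodable.encode c) p ns) := by
  cases h with
  | initial h =>
    have hb := h b List.mem_cons_self
    exact ⟨fun u hu => .inl ⟨hb, h u (List.mem_cons_of_mem _ hu)⟩, .inl (.inl hb)⟩
  | prog hp hd h => exact ⟨hd, h⟩
  | _ => simp [IsProgPred] at hp

theorem Good.desc_inv (h : Good c fb tr G ⟨8, [b, y, e]⟩) :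
    Free fb G b ∨ ∃ j n, Num tr b n y ∧ Opened fb tr j b fun m =>
      ∃ k, Num tr ((tr j).map 0) k e ∧ n + k = m := by
  cases h with
  | initial h => simp at h; exact .inl (.inl h.1)
  | desc h => exact h
  | prog hp => simp [IsProgPred] at hp

theorem Good.query_inv (h : Good c fb tr G ⟨9, [b, x]⟩) : Dom fb G b x ∧ (Free fb G b ∨
    ∃ j n, Num tr b n x ∧ Opened fb tr j b fun m => n = m + 1) := by
  cases h with
  | initial h => simp at h; exact ⟨.inl h, .inl (.inl h.1)⟩
  | query hd h => exact ⟨hd, h⟩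
  | prog hp => simp [IsProgPred] at hp

theorem Good.halt_inv (h : Good c fb tr G ⟨10, [b, x]⟩) : Dom fb G b x ∧ (Free fb G b ∨
    ∃ j n, Num tr b n x ∧ (c.eval n).Dom ∧ Opened fb tr j b fun m => n = m + 1) := by
  cases h with
  | initial h => simp at h; exact ⟨.inl h, .inl (.inl h.1)⟩
  | halt hd h => exact ⟨hd, h⟩
  | prog hp => simp [IsProgPred] at hp

end inversion

end

section
variable {c : Code} {fb : ℕ → FactBase} {tr : ℕ → Trigger}

theorem FreshRun.good_datalog {G G' : FactBase} (hF : FreshRun c fb tr)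
    (hG : ∀ a ∈ G, Good c fb tr G a) (hGG : G ⊆ G') {t : Trigger} (ho : t.IsOn G) {r : SRule}
    (hr : r ∈ dlRules c) (ht : t.rule = Rule.ofS r) : ∀ a ∈ t.out, Good c fb tr G' a := by
  suffices H : ∀ a ∈ t.out, Good c fb tr G a from fun a ha => (H a ha).mono hGG
  intro a ha
  rw [Trigger.mem_out_datalog (dlRules_isD hr) ht] at ha
  obtain ⟨x, hx, rfl⟩ := ha
  rw [Trigger.isOn_ofS (dlRules_isD hr).1 ht] at ho
  generalize t.map = τ at *
  simp only [dlRules, List.mem_append, List.mem_cons, List.not_mem_nil, or_false,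
    List.mem_map] at hr
  rcases hr with (rfl | rfl | rfl | rfl | rfl | rfl) | ⟨p, hp, rfl⟩
  · simp only [rSucc, List.mem_cons, List.not_mem_nil, or_false] at hx
    subst hx
    simp only [rSucc, List.forall_mem_cons, inst, List.map_cons, List.map_nil] at ho ⊢
    obtain ⟨hS, hx, hy, -⟩ := ho
    refine .prog (by simp [IsProgPred]) (by simpa using ⟨.inr hx, .inr hy⟩) ?_
    rcases (hG _ hx).num_inv' with h | ⟨n, hn⟩
    · exact .inl h
    rcases (hG _ hy).num_inv' with h | ⟨m, hm⟩
    · exact .inl h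
    right
    rcases (hG _ hS).succ_inv with h | ⟨h, hb⟩ | ⟨j, hj, h0, h1, h2⟩
    · exact (hm.notMem hF h).elim
    · exact (hm.not_isLabel hF (h ▸ hb)).elim
    · refine ⟨[n, n + 1], ?_, .succ n⟩
      have := Num.succ j hj h0.symm h1.symm hn
      rw [← h2] at this
      simp [hn, this]
  · simp only [rZero, List.mem_cons, List.not_mem_nil, or_false] at hx
    subst hx
    simp only [rZero, List.forall_mem_cons, inst, List.map_cons, List.map_nil] at ho ⊢
    obtain ⟨hZ, hx, -⟩ := ho
    refine .prog (by simp [IsProgPred]) (by simpa using .inr hx) ?_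
    rcases (hG _ hx).num_inv' with h | ⟨n, hn⟩
    · exact .inl h
    right
    rcases (hG _ hZ).zero_inv with h | ⟨h, hb⟩ | ⟨j, hj, h0, h1⟩
    · exact (hn.notMem hF h).elim
    · exact (hn.not_isLabel hF (h ▸ hb)).elim
    · obtain ⟨rfl, -⟩ := Num.zero_inv hF (h1 ▸ hn)
      exact ⟨[0], by simpa using hn, .zero⟩
  · simp only [rDescend, List.mem_cons, List.not_mem_nil, or_false] at hx
    subst hx
    simp only [rDescend, List.forall_mem_cons, inst, List.map_cons, List.map_nil] at ho ⊢
    obtain ⟨hL, hx, hZ, -⟩ := ho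
    apply Good.desc
    rcases (hG _ hx).num_inv' with h | ⟨n, hn⟩
    · exact .inl h
    rcases (hG _ hL).link_inv with h | h | ⟨j, h1, h3, hj, hb, ho⟩
    · exact .inl (.inl h)
    · exact (hn.not_isLabel hF (h ▸ hn.isLabel)).elim
    · refine .inr ⟨j, n, hn, hj, hb, fun h => ?_⟩
      obtain ⟨m, hm, -⟩ := ho h
      obtain ⟨rfl, -⟩ := Num.zero_inv hF (h3 ▸ hn)
      exact ⟨m, hm, m, h1 ▸ hm, by simp⟩
  · simp only [rCount, List.mem_cons, List.not_mem_nil, or_false] at hx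
    subst hx
    simp only [rCount, List.forall_mem_cons, inst, List.map_cons, List.map_nil] at ho ⊢
    obtain ⟨hW, hP, hS, -⟩ := ho
    apply Good.desc
    rcases (hG _ hW).desc_inv with h | ⟨j, n, hn, hj, hb, ho⟩
    · exact .inl h
    rcases ((hG _ hP).prog_inv (by simp [IsProgPred])).2 with h | ⟨ns, hns, hd⟩
    · exact .inl h
    simp only [List.forall₂_cons_right_iff, List.forall₂_nil_right_iff] at hns
    obtain ⟨a, _, ha, ⟨a', _, ha', rfl, rfl⟩, rfl⟩ := hns
    obtain rfl := meaning_succ.1 hd.sound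
    obtain rfl := hn.unique hF ha
    refine .inr ⟨j, _, ha', hj, hb, fun h => ?_⟩
    obtain ⟨m, hm, k, hk, hnk⟩ := ho h
    refine ⟨m, hm, ?_⟩
    rcases (hG _ hS).succ_inv with h | ⟨h, hb⟩ | ⟨i, hi, h0, h1, h2⟩
    · exact (hk.notMem hF h).elim
    · exact (hk.not_isLabel hF (h ▸ hb)).elim
    · obtain ⟨-, k', rfl, hk'⟩ := Num.succ_inv hF (h2 ▸ hk)
      exact ⟨k', h1 ▸ hk', by omega⟩
  · simp only [rQuery, List.mem_cons, List.not_mem_nil, or_false] at hx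
    subst hx
    simp only [rQuery, List.forall_mem_cons, inst, List.map_cons, List.map_nil] at ho ⊢
    obtain ⟨hW, hZ, hP, -⟩ := ho
    obtain ⟨hd, hP⟩ := (hG _ hP).prog_inv (by simp [IsProgPred])
    refine .query (hd _ (by simp)) ?_
    rcases (hG _ hW).desc_inv with h | ⟨j, n, hn, hj, hb, ho⟩
    · exact .inl h
    rcases hP with h | ⟨ns, hns, hd⟩
    · exact .inl h
    simp only [List.forall₂_cons_right_iff, List.forall₂_nil_right_iff] at hns
    obtain ⟨a, _, ha, ⟨a', _, ha', rfl, rfl⟩, rfl⟩ := hns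
    obtain rfl := meaning_succ.1 hd.sound
    obtain rfl := hn.unique hF ha
    refine .inr ⟨j, _, ha', hj, hb, fun h => ?_⟩
    obtain ⟨m, hm, k, hk, hnk⟩ := ho h
    refine ⟨m, hm, ?_⟩
    rcases (hG _ hZ).zero_inv with h | ⟨h, hb⟩ | ⟨i, hi, h0, h1⟩
    · exact (hk.notMem hF h).elim
    · exact (hk.not_isLabel hF (h ▸ hb)).elim
    · obtain ⟨rfl, -⟩ := Num.zero_inv hF (h1 ▸ hk)
      omega
  · simp only [rHalt, List.mem_cons, List.not_mem_nil, or_false] at hx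
    subst hx
    simp only [rHalt, List.forall_mem_cons, inst, List.map_cons, List.map_nil] at ho ⊢
    obtain ⟨hQ, hP, -⟩ := ho
    obtain ⟨hd, hQ⟩ := (hG _ hQ).query_inv
    refine .halt hd ?_
    rcases hQ with h | ⟨j, n, hn, hj⟩
    · exact .inl h
    rcases ((hG _ hP).prog_inv (isProgPred_codePred c)).2 with h | ⟨ns, hns, hd⟩
    · exact .inl h
    simp only [List.forall₂_cons_right_iff, List.forall₂_nil_right_iff] at hns
    obtain ⟨a, _, ha, ⟨a', _, ha', rfl, rfl⟩, rfl⟩ := hns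
    obtain rfl := hn.unique hF ha
    exact .inr ⟨j, n, hn, Part.dom_iff_mem.2 ⟨a', (der_codePred_iff le_rfl).1 hd⟩, hj⟩
  · simp only [progRule, List.mem_cons, List.not_mem_nil, or_false] at hx
    subst hx
    simp only [progRule, List.forall_mem_map, inst, labelled, List.map_cons] at ho ⊢
    obtain ⟨h1, h2, h3⟩ := prog_preds hp
    have hb := fun q hq => (hG _ (ho q hq)).prog_inv (h1 q hq)
    refine .prog h2 ?_ ?_
    · intro u hu
      obtain ⟨v, hv, rfl⟩ := List.mem_map.1 hu
      obtain ⟨q, hq, hvq⟩ := h3 v hv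
      exact (hb q hq).1 _ (List.mem_map_of_mem hvq)
    · by_cases hfree : Free fb G (τ 0)
      · exact .inl hfree
      right
      let ρ : ℕ → ℕ := fun v => if h : ∃ n, Num tr (τ 0) n (τ v) then h.choose else 0
      have hρ : ∀ v n, Num tr (τ 0) n (τ v) → ρ v = n := fun v n h => by
        have h' : ∃ n, Num tr (τ 0) n (τ v) := ⟨n, h⟩
        simp only [ρ, dif_pos h']
        exact h'.choose_spec.unique hF h
      have aux : ∀ {ns l}, List.Forall₂ (fun n v => Num tr (τ 0) n (τ v)) ns l →
          l.map ρ = ns ∧ ∀ v ∈ l, Num tr (τ 0) (ρ v) (τ v) := by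
        intro ns l h
        induction h with
        | nil => simp
        | cons h _ ih =>
          have := hρ _ _ h
          simp only [List.map_cons, List.forall_mem_cons, this, h, ih.1, true_and]
          exact ih.2
      have key : ∀ q ∈ p.1, Der (Encodable.encode c) q.1 (q.2.map ρ) ∧
          ∀ v ∈ q.2, Num tr (τ 0) (ρ v) (τ v) := by
        intro q hq
        obtain ⟨ns, hns, hd⟩ := (hb q hq).2.resolve_left hfree
        rw [List.forall₂_map_right_iff] at hns
        have := aux hns
        exact ⟨this.1 ▸ hd, this.2⟩
      refine ⟨p.2.2.map ρ, ?_, .rule p hp ρ fun q hq => (key q hq).1⟩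
      rw [List.forall₂_map_left_iff, List.forall₂_map_right_iff, List.forall₂_same]
      intro v hv
      obtain ⟨q, hq, hvq⟩ := h3 v hv
      exact (key q hq).2 v hvq

theorem FreshRun.blocked_grow (hF : FreshRun c fb tr) {j : ℕ}
    (hG : ∀ a ∈ fb j, Good c fb tr (fb j) a) (hj : (tr j).rule = Rule.ofS rGrow) :
    ((tr j).map 0 ∈ FactBase.terms (fb 0) ∧ (tr j).map 1 ∈ FactBase.terms (fb 0)) ∨
      ¬ actOut ((tr j).map 0) ⊆ fb j := by
  by_contra! hc
  have ha := (hF.run j).1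
  have hN := (isOn_grow hj).1 ha.2.1
  refine not_applicable_grow hj ha.2.1 (hF.fresh j 2) hc.2 ?_ ha.2.2
  rcases (hG _ hN).num_inv.2 with h | h | h
  · exact (hc.1 h.1 h.2).elim
  · rw [h.1]
    exact h.2 (by simp [actOut])
  · exact h.1

theorem FreshRun.blocked_event (hF : FreshRun c fb tr) {j : ℕ}
    (hG : ∀ a ∈ fb j, Good c fb tr (fb j) a) (hj : (tr j).rule = Rule.ofS rEvent) :
    ((tr j).map 0 ∈ FactBase.terms (fb 0) ∧ (tr j).map 1 ∈ FactBase.terms (fb 0)) ∨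
      ¬ actOut ((tr j).map 0) ⊆ fb j := by
  by_contra! hc
  have ha := (hF.run j).1
  have hE := (isOn_event hj).1 ha.2.1
  refine not_applicable_event hj ha.2.1 (hF.fresh j 2) (hF.fresh j 3) hc.2 ?_ ha.2.2
  rcases (hG _ hE).halt_inv.1 with h | hN
  · exact (hc.1 h.1 h.2).elim
  rcases (hG _ hN).num_inv.2 with h | h | h
  · exact (hc.1 h.1 h.2).elim
  · rw [h.1]
    exact h.2 (by simp [actOut])
  · exact h.2.1

theorem FreshRun.event_num (hF : FreshRun c fb tr) {j : ℕ}
    (hG : ∀ a ∈ fb j, Good c fb tr (fb j) a) (hj : (tr j).rule = Rule.ofS rEvent)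
    (hb : (tr j).map 0 ∉ FactBase.terms (fb 0)) : ∃ i n, Num tr ((tr j).map 0) n ((tr j).map 1) ∧
      (c.eval n).Dom ∧ Opened fb tr i ((tr j).map 0) fun m => n = m + 1 := by
  have hE := (isOn_event hj).1 (hF.run j).1.2.1
  have hact := (hF.blocked_event hG hj).resolve_left fun h => hb h.1
  exact (hG _ hE).halt_inv.2.resolve_left fun h => h.elim hb hact

theorem FreshRun.good (hF : FreshRun c fb tr) (k : ℕ) :
    ∀ a ∈ fb k, Good c fb tr (fb k) a := by
  induction k with
  | zero => exact fun a ha => .initial fun u hu => ⟨a, ha, hu⟩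
  | succ k ih =>
    obtain ⟨⟨hr, ho, happ⟩, hstep⟩ := hF.run k
    have hsub : fb k ⊆ fb (k + 1) := hstep ▸ Finset.subset_union_left
    have hout : (tr k).out ⊆ fb (k + 1) := hstep ▸ Finset.subset_union_right
    intro a ha
    rw [hstep, Finset.mem_union] at ha
    rcases ha with ha | ha
    · exact (ih a ha).mono hsub
    rcases rule_cases hr with h | h | h | ⟨r, hr, h⟩
    · have hN := (isOn_grow h).1 ho
      obtain ⟨hb, hx⟩ := (ih _ hN).num_inv
      rw [out_grow h] at ha hout
      simp only [growOut, Finset.insert_subset_iff, Finset.singleton_subset_iff] at hout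
      simp only [growOut, Finset.mem_insert, Finset.mem_singleton] at ha
      rcases ha with rfl | rfl | rfl | rfl
      · exact .succ h
      · refine .num hb (.inr ⟨hout.2.2.1, hout.2.2.2, fun hb' => ?_⟩)
        rcases hx with hx | hx | hx
        · exact (hb' hx.1).elim
        · exact ((hF.blocked_grow ih h).elim (fun h => hb' h.1) fun h => h hx.2).elim
        · obtain ⟨n, hn⟩ := hx.2.2 hb'
          exact ⟨n + 1, .succ k h rfl rfl hn⟩
      · exact .loop hb
      · exact .lloop
    · obtain ⟨hb, -⟩ := (ih _ ((isOn_act h).1 ho)).num_inv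
      rw [out_act h] at ha hout
      simp only [actOut, Finset.mem_insert, Finset.mem_singleton] at ha
      rcases ha with rfl | rfl | rfl | rfl
      · exact .num hb (.inl ⟨rfl, hout⟩)
      · exact .zloop hb
      · exact .loop hb
      · exact .lloop
    · rw [out_event h] at ha hout
      simp only [eventOut, Finset.insert_subset_iff, Finset.singleton_subset_iff] at hout
      simp only [eventOut, Finset.mem_insert, Finset.mem_singleton] at ha
      have hb : IsLabel fb tr (fv tr k 2) := .inr ⟨k, h, rfl⟩
      rcases ha with rfl | rfl | rfl | rfl | rfl
      · refine .link ⟨h, rfl, fun hb' => ?_⟩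
        obtain ⟨_, n, hn, -⟩ := hF.event_num ih h hb'
        exact ⟨n, hn, trivial⟩
      · exact .num hb (.inr ⟨hout.2.2.2.1, hout.2.2.2.2, fun _ => ⟨0, .zero k h⟩⟩)
      · exact .zero h
      · exact .loop hb
      · exact .lloop
    · exact hF.good_datalog ih hsub ho hr h a ha

end

section
variable {c : Code} {fb : ℕ → FactBase} {tr : ℕ → Trigger}

/-- The step `j` applies `rGrow` or `rEvent` in the stage `b`. -/
def InStage (tr : ℕ → Trigger) (b : Term) (j : ℕ) : Prop :=
  ((tr j).rule = Rule.ofS rGrow ∨ (tr j).rule = Rule.ofS rEvent) ∧ (tr j).map 0 = b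

theorem FreshRun.blocked (hF : FreshRun c fb tr) {j : ℕ} {b : Term} (hj : InStage tr b j) :
    (b ∈ FactBase.terms (fb 0) ∧ (tr j).map 1 ∈ FactBase.terms (fb 0)) ∨
      ¬ actOut b ⊆ fb j := by
  obtain ⟨hj | hj, rfl⟩ := hj
  · exact hF.blocked_grow (hF.good j) hj
  · exact hF.blocked_event (hF.good j) hj

theorem FreshRun.occurs (hF : FreshRun c fb tr) {j : ℕ} {b : Term} (hj : InStage tr b j) :
    (b ∈ FactBase.terms (fb 0) ∧ (tr j).map 1 ∈ FactBase.terms (fb 0)) ∨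
      (⟨0, [b, (tr j).map 1]⟩ : Atom) ∈ fb j := by
  have ho := (hF.run j).1.2.1
  obtain ⟨hj | hj, rfl⟩ := hj
  · exact .inr ((isOn_grow hj).1 ho)
  · exact (hF.good j _ ((isOn_event hj).1 ho)).halt_inv.1

theorem FreshRun.exists_closed (hF : FreshRun c fb tr) (hfair : FairRun (rset c) fb) {b x : Term} {k : ℕ}
    (hN : (⟨0, [b, x]⟩ : Atom) ∈ fb k) : ∃ K, actOut b ⊆ fb K := by
  let t : Trigger := ⟨Rule.ofS rAct, fun v => if v = 0 then b else x⟩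
  have ho : ∀ {F : FactBase}, (⟨0, [b, x]⟩ : Atom) ∈ F → t.IsOn F := fun h => (isOn_act rfl).2 h
  have ht : t.out = actOut b := out_act rfl
  by_cases ha : actOut b ⊆ fb k
  · exact ⟨k, ha⟩
  have happ : Applicable .R t (fb k) :=
    (applicable_of_datalog rAct_isD rfl (ho hN)).2 (ht ▸ ha)
  obtain ⟨j, hj, hn⟩ := hfair k t
    ⟨mem_rset.2 ⟨rAct, by simp [allRules], rfl⟩, ho hN, happ⟩
  refine ⟨j, ?_⟩
  by_contra hc
  exact hn ((applicable_of_datalog rAct_isD rfl (ho (hF.run.mono hj.le hN))).2 (ht ▸ hc))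

theorem FreshRun.finite_initial (hF : FreshRun c fb tr) :
    {j | InStage tr ((tr j).map 0) j ∧ (tr j).map 0 ∈ FactBase.terms (fb 0) ∧
      (tr j).map 1 ∈ FactBase.terms (fb 0)}.Finite := by
  refine (hF.run.finite_of_terms (FactBase.terms_finite (fb 0))).subset ?_
  rintro j ⟨⟨hj | hj, -⟩, h0, h1⟩ v hv
  · rw [hj, Rule.mem_vars_body_ofS rGrow_wf] at hv
    simp [SRule.bodyVars, rGrow] at hv
    rcases hv with rfl | rfl <;> assumption
  · rw [hj, Rule.mem_vars_body_ofS rEvent_wf] at hv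
    simp [SRule.bodyVars, rEvent] at hv
    rcases hv with rfl | rfl <;> assumption

theorem FreshRun.finite_stage (hF : FreshRun c fb tr) (hfair : FairRun (rset c) fb) (b : Term) :
    {j | InStage tr b j}.Finite := by
  by_cases h : ∃ k x, (⟨0, [b, x]⟩ : Atom) ∈ fb k
  · obtain ⟨k, x, hN⟩ := h
    obtain ⟨K, hK⟩ := hF.exists_closed hfair hN
    refine (hF.finite_initial.union (Set.finite_Iio K)).subset fun j hj => ?_
    rcases hF.blocked hj with h | h
    · exact .inl (by rw [Set.mem_ofPred_eq, hj.2]; exact ⟨hj, h⟩)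
    · exact .inr (Set.mem_Iio.2 (lt_of_not_ge fun hle => h (hK.trans (hF.run.mono hle))))
  · refine hF.finite_initial.subset fun j hj => ?_
    rcases hF.occurs hj with h' | h'
    · rw [Set.mem_ofPred_eq, hj.2]; exact ⟨hj, h'⟩
    · exact (h ⟨_, _, h'⟩).elim

theorem FreshRun.infinite_events (hF : FreshRun c fb tr) (hfair : FairRun (rset c) fb) :
    {j | (tr j).rule = Rule.ofS rEvent}.Infinite := by
  intro hfin
  have hlab : {b | IsLabel fb tr b}.Finite := by
    refine ((FactBase.terms_finite (fb 0)).union (hfin.image fun j => fv tr j 2)).subset ?_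
    rintro b (hb | ⟨j, hj, rfl⟩)
    exacts [.inl hb, .inr ⟨j, hj, rfl⟩]
  obtain ⟨K, hK⟩ := ((hlab.biUnion fun b _ => hF.finite_stage hfair b).union hfin).bddAbove
  refine hF.run.no_datalog (K + 1) fun i hi => ?_
  have hi' := fun h => (show ¬ i ≤ K by omega) (hK h)
  rcases rule_cases (hF.run i).1.1 with h | h | h | ⟨r, hr, h⟩
  · refine (hi' (.inl ?_)).elim
    have := (hF.good i _ ((isOn_grow h).1 (hF.run i).1.2.1)).num_inv.1
    exact Set.mem_biUnion this (⟨.inl h, rfl⟩ : InStage tr _ i)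
  · exact ⟨_, rAct_isD, h⟩
  · exact (hi' (.inr h)).elim
  · exact ⟨r, dlRules_isD hr, h⟩

theorem FreshRun.infinite_dom (hF : FreshRun c fb tr) (hfair : FairRun (rset c) fb) :
    {n | (c.eval n).Dom}.Infinite := by
  intro hfin
  obtain ⟨M, hM⟩ := hfin.bddAbove
  have key : ∀ m, {j | (tr j).rule = Rule.ofS rEvent ∧ ((tr j).map 0 ∈ FactBase.terms (fb 0) ∨
      ∃ n < m, Num tr ((tr j).map 0) n ((tr j).map 1))}.Finite := by
    intro m
    induction m with
    | zero =>
      refine ((FactBase.terms_finite (fb 0)).biUnion fun b _ => hF.finite_stage hfair b).subset ?_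
      rintro j ⟨hj, hb | ⟨n, hn, -⟩⟩
      · exact Set.mem_biUnion hb (⟨.inr hj, rfl⟩ : InStage tr _ j)
      · omega
    | succ m ih =>
      refine (ih.union (ih.biUnion fun i _ => hF.finite_stage hfair (fv tr i 2))).subset ?_
      rintro j ⟨hj, hb⟩
      by_cases hb' : (tr j).map 0 ∈ FactBase.terms (fb 0)
      · exact .inl ⟨hj, .inl hb'⟩
      obtain ⟨n, hn, hnum⟩ := hb.resolve_left hb'
      obtain ⟨i, n', hnum', -, hi, h0, hop⟩ := hF.event_num (hF.good j) hj hb'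
      obtain rfl := hnum.unique hF hnum'
      refine .inr (Set.mem_biUnion (x := i) ⟨hi, or_iff_not_imp_left.2 fun h => ?_⟩
        (⟨.inr hj, h0⟩ : InStage tr _ j))
      obtain ⟨m', hm', rfl⟩ := hop h
      exact ⟨m', by omega, hm'⟩
  refine hF.infinite_events hfair ((key (M + 1)).subset fun j hj => ⟨hj, ?_⟩)
  refine or_iff_not_imp_left.2 fun h => ?_
  obtain ⟨-, n, hn, hd, -⟩ := hF.event_num (hF.good j) hj h
  exact ⟨n, Nat.lt_succ_of_le (hM hd), hn⟩

end

/-- If the simulating rule set has an infinite fair derivation, then the simulated code halts on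
infinitely many inputs. -/
theorem infinite_dom_of_not_CTall {c : Code} (h : ¬ CTall .R (rset c)) :
    {n | (c.eval n).Dom}.Infinite := by
  obtain ⟨fb, tr, hrun, hfair⟩ := not_CTall_iff.1 h
  obtain ⟨k, hk⟩ := hrun.exists_fresh
  have hF : FreshRun c (fun i => fb (k + i)) fun i => tr (k + i) :=
    ⟨hrun.shift k, fun j z => hk _ (Nat.le_add_right _ _) z⟩
  refine hF.infinite_dom fun i t ht => ?_
  obtain ⟨j, hj, hn⟩ := hfair _ t ht
  exact ⟨j - k, by omega, by simpa [Nat.add_sub_cancel' (by omega : k ≤ j)] using hn⟩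

/-! ### An infinite derivation simulating a total code -/

theorem prog_head {N : ℕ} {r : PRule} (h : r ∈ prog N) :
    (r.2.1 = 6 ∨ r.2.1 = 7 ∨ 11 ≤ r.2.1) ∧ 0 ∉ r.2.2 ∧ ∀ a ∈ r.1, 0 ∉ a.2 := by
  have hc : ∀ c, 11 ≤ codePred c := fun c => by simp [codePred]
  rcases mem_prog h with h | ⟨c, d, h⟩
  · simp only [baseProg, List.mem_cons, List.not_mem_nil, or_false] at h
    rcases h with rfl | rfl | rfl | rfl | rfl | rfl | rfl | rfl | rfl | rfl | rfl <;> simp [hc]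
  · simp only [codeProg, List.mem_cons, List.not_mem_nil, or_false] at h
    rcases h with rfl | rfl | rfl | rfl | rfl | rfl <;> simp [hc]

theorem dlRules_cases {c : Code} {r : SRule} (h : r ∈ dlRules c) :
    r = rSucc ∨ r = rQuery ∨ r = rHalt (codePred c) ∨
      ∀ x ∈ r.2, x.1 = 5 ∨ x.1 = 6 ∨ x.1 = 7 ∨ x.1 = 8 ∨ 11 ≤ x.1 := by
  simp only [dlRules, List.mem_append, List.mem_cons, List.not_mem_nil, or_false,
    List.mem_map] at h
  rcases h with (rfl | rfl | rfl | rfl | rfl | rfl) | ⟨p, hp, rfl⟩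
  · simp
  · simp [rZero]
  · simp [rDescend]
  · simp [rCount]
  · simp
  · simp
  · have := (prog_head hp).1
    refine .inr (.inr (.inr ?_))
    simp [progRule, labelled]
    omega

theorem LStep.mem_of_pred {c : Code} {F G : FactBase} (h : LStep (rset c) (dlRules c) F G)
    {a : Atom} (ha : a ∈ G) (hp : a.pred < 4) : a ∈ F := by
  obtain ⟨r, hr, t, ht, -, rfl⟩ := h
  refine (Finset.mem_union.1 ha).resolve_right fun ha => ?_
  obtain ⟨x, hx, rfl⟩ := (Trigger.mem_out_datalog (dlRules_isD hr) ht).1 ha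
  simp only [inst] at hp
  rcases dlRules_cases hr with rfl | rfl | rfl | h
  · simp [rSucc] at hx; simp [hx] at hp
  · simp [rQuery] at hx; simp [hx] at hp
  · simp [rHalt] at hx; simp [hx] at hp
  · have := h x hx
    omega

theorem mem_of_reflTransGen {c : Code} {F G : FactBase}
    (h : Relation.ReflTransGen (LStep (rset c) (dlRules c)) F G) {a : Atom} (ha : a ∈ G)
    (hp : a.pred < 4) : a ∈ F := by
  induction h with
  | refl => exact ha
  | tail _ h ih => exact ih (h.mem_of_pred ha hp)

theorem subset_of_reflTransGen {𝓡 : RuleSet} {F G : FactBase}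
    (h : Relation.ReflTransGen (Step 𝓡) F G) : F ⊆ G := by
  induction h with
  | refl => exact subset_rfl
  | tail _ h ih =>
    obtain ⟨t, -, rfl⟩ := h
    exact ih.trans Finset.subset_union_left

/-- Properties preserved by all derivations from a suitable factbase. -/
structure Inv (G : FactBase) : Prop where
  fresh : ∀ v ∈ FactBase.vars G, ∃ (t : Trigger) (z : ℕ), v = t.freshVar z ∧ t.out ⊆ G
  num : ∀ b x, (⟨0, [b, x]⟩ : Atom) ∈ G →
    (⟨1, [b, x, b]⟩ : Atom) ∈ G ∧ (⟨3, [x, b, b]⟩ : Atom) ∈ G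
  succ : ∀ b x y, (⟨4, [b, x, y]⟩ : Atom) ∈ G → (⟨0, [b, y]⟩ : Atom) ∈ G
  query : ∀ b x, (⟨9, [b, x]⟩ : Atom) ∈ G → (⟨0, [b, x]⟩ : Atom) ∈ G
  halt : ∀ b x, (⟨10, [b, x]⟩ : Atom) ∈ G → (⟨0, [b, x]⟩ : Atom) ∈ G

theorem Inv.out_subset {G : FactBase} (h : Inv G) {t : Trigger} {z : ℕ}
    (hz : t.freshVar z ∈ FactBase.vars G) : t.out ⊆ G := by
  obtain ⟨s, w, hs, ho⟩ := h.fresh _ hz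
  rwa [(Trigger.equiv_of_freshVar hs).1.out]

theorem Inv.step {c : Code} {G G' : FactBase} (h : Inv G) (hs : Step (rset c) G G') : Inv G' := by
  obtain ⟨t, ⟨hr, ho, -⟩, rfl⟩ := hs
  have hsub : G ⊆ G ∪ t.out := Finset.subset_union_left
  have hout : t.out ⊆ G ∪ t.out := Finset.subset_union_right
  suffices H : (∀ b x, (⟨0, [b, x]⟩ : Atom) ∈ t.out →
        (⟨1, [b, x, b]⟩ : Atom) ∈ t.out ∧ (⟨3, [x, b, b]⟩ : Atom) ∈ t.out) ∧
      (∀ b x y, (⟨4, [b, x, y]⟩ : Atom) ∈ t.out → (⟨0, [b, y]⟩ : Atom) ∈ G) ∧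
      (∀ b x, (⟨9, [b, x]⟩ : Atom) ∈ t.out → (⟨0, [b, x]⟩ : Atom) ∈ G) ∧
      (∀ b x, (⟨10, [b, x]⟩ : Atom) ∈ t.out → (⟨0, [b, x]⟩ : Atom) ∈ G) by
    refine ⟨fun v hv => ?_, fun b x hx => ?_, fun b x y hx => ?_, fun b x hx => ?_,
      fun b x hx => ?_⟩
    · have hold : v ∈ FactBase.vars G → ∃ (s : Trigger) (z : ℕ), v = s.freshVar z ∧
          s.out ⊆ G ∪ t.out := fun hv =>
        let ⟨s, z, hs, hsG⟩ := h.fresh v hv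
        ⟨s, z, hs, hsG.trans hsub⟩
      rw [FactBase.vars_union, Finset.mem_union] at hv
      rcases hv with hv | hv
      · exact hold hv
      · rcases ho.vars_out hv with hv | ⟨z, -, hz⟩
        · exact hold hv
        · exact ⟨t, z, hz, hout⟩
    · rcases Finset.mem_union.1 hx with hx | hx
      · exact (h.num b x hx).imp (fun h => hsub h) fun h => hsub h
      · exact (H.1 b x hx).imp (fun h => hout h) fun h => hout h
    · exact hsub ((Finset.mem_union.1 hx).elim (h.succ b x y) (H.2.1 b x y))
    · exact hsub ((Finset.mem_union.1 hx).elim (h.query b x) (H.2.2.1 b x))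
    · exact hsub ((Finset.mem_union.1 hx).elim (h.halt b x) (H.2.2.2 b x))
  rcases rule_cases hr with ht | ht | ht | ⟨r, hr, ht⟩
  · rw [out_grow ht]
    simp +contextual [growOut]
  · rw [out_act ht]
    simp +contextual [actOut]
  · rw [out_event ht]
    simp +contextual [eventOut]
  · simp only [Trigger.mem_out_datalog (dlRules_isD hr) ht]
    rw [Trigger.isOn_ofS (dlRules_isD hr).1 ht] at ho
    rcases dlRules_cases hr with rfl | rfl | rfl | hp
    · simp only [rSucc, List.forall_mem_cons, inst, List.map_cons, List.map_nil] at ho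
      simpa [rSucc, inst] using ho.2.2.1
    · simp only [rQuery, List.forall_mem_cons, inst, List.map_cons, List.map_nil] at ho
      simpa [rQuery, inst] using h.succ _ _ _ ho.2.2.1
    · simp only [rHalt, List.forall_mem_cons, inst, List.map_cons, List.map_nil] at ho
      simpa [rHalt, inst] using h.query _ _ ho.1
    · refine ⟨?_, ?_, ?_, ?_⟩
      all_goals
        intros
        rename_i hx
        obtain ⟨x, hx, he⟩ := hx
        have := congrArg Atom.pred he
        simp only [inst] at this
        have := hp x hx
        omega

theorem Inv.reflTransGen {c : Code} {G G' : FactBase} (h : Inv G)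
    (hs : Relation.ReflTransGen (Step (rset c)) G G') : Inv G' := by
  induction hs with
  | refl => exact h
  | tail _ hs ih => exact ih.step hs

/-- Closure under the Datalog rules. -/
def Sat (c : Code) (G : FactBase) : Prop :=
  ∀ r ∈ dlRules c, ∀ τ : Subst, (∀ x ∈ r.1, inst τ x ∈ G) → ∀ x ∈ r.2, inst τ x ∈ G

/-- The terms `y 0, …, y m` are the first numbers of the stage `b`. -/
structure Chain (G : FactBase) (b : Term) (y : ℕ → Term) (m : ℕ) : Prop where
  zero : (⟨2, [b, y 0]⟩ : Atom) ∈ G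
  num : ∀ i ≤ m, (⟨0, [b, y i]⟩ : Atom) ∈ G
  succ : ∀ i < m, (⟨1, [b, y i, y (i + 1)]⟩ : Atom) ∈ G

theorem Chain.mem_succ {c : Code} {G : FactBase} {b : Term} {y : ℕ → Term} {m : ℕ}
    (h : Chain G b y m) (hG : Sat c G) {i : ℕ} (hi : i < m) :
    (⟨4, [b, y i, y (i + 1)]⟩ : Atom) ∈ G := by
  simpa [rSucc, inst] using hG rSucc (by simp [dlRules])
    (fun v => if v = 0 then b else if v = 1 then y i else y (i + 1))
    (by simpa [rSucc, inst] using ⟨h.succ i hi, h.num i hi.le, h.num _ hi⟩)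

theorem Der.eventually_mem {c : Code} {p : ℕ} {ns : List ℕ} (h : Der (Encodable.encode c) p ns) :
    ∀ᶠ m in Filter.atTop, ∀ G b y, Sat c G → Chain G b y m → (⟨p, b :: ns.map y⟩ : Atom) ∈ G := by
  induction h with
  | succ n =>
    filter_upwards [Filter.eventually_gt_atTop n] with m hm G b y hG hy
    exact hy.mem_succ hG hm
  | zero =>
    refine .of_forall fun m G b y hG hy => ?_
    simpa [rZero, inst] using hG rZero (by simp [dlRules])
      (fun v => if v = 0 then b else y 0)
      (by simpa [rZero, inst] using ⟨hy.zero, hy.num 0 (Nat.zero_le m)⟩)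
  | rule r hr ρ _ ih =>
    have := (Filter.eventually_all_finite r.1.finite_toSet).2 ih
    filter_upwards [this] with m hm G b y hG hy
    obtain ⟨-, h1, h2⟩ := prog_head hr
    have hτ : ∀ l : List ℕ, 0 ∉ l →
        l.map (fun v => if v = 0 then b else y (ρ v)) = (l.map ρ).map y := fun l hl => by
      simp only [List.map_map, List.map_inj_left, Function.comp]
      exact fun v hv => if_neg fun h : v = 0 => hl (h ▸ hv)
    have := hG (progRule r) (List.mem_append_right _ (List.mem_map_of_mem hr))
      (fun v => if v = 0 then b else y (ρ v))
    simp only [progRule, List.forall_mem_map, inst, labelled, List.map_cons, if_true,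
      List.forall_mem_singleton, hτ _ h1] at this
    refine this fun a ha => ?_
    rw [hτ _ (h2 a ha)]
    exact hm a ha G b y hG hy

theorem exists_sat (c : Code) (G : FactBase) :
    ∃ G', Relation.ReflTransGen (LStep (rset c) (dlRules c)) G G' ∧ Sat c G' := by
  obtain ⟨G', h, hG'⟩ := exists_saturation (𝓡 := rset c) (fun r hr => dlRules_isD hr)
    (fun r hr => mem_rset_of_dlRules hr) G
  refine ⟨G', h, fun r hr τ hτ x hx => ?_⟩
  refine hG' ⟨Rule.ofS r, τ⟩ r hr rfl ((Trigger.isOn_ofS (dlRules_isD hr).1 rfl).2 hτ) ?_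
  exact (Trigger.mem_out_datalog (dlRules_isD hr) rfl).2 ⟨x, hx, rfl⟩

theorem Sat.out_subset {c : Code} {G : FactBase} (h : Sat c G) {r : SRule} (hr : r ∈ dlRules c)
    {t : Trigger} (ht : t.rule = Rule.ofS r) (ho : t.IsOn G) : t.out ⊆ G := by
  intro a ha
  obtain ⟨x, hx, rfl⟩ := (Trigger.mem_out_datalog (dlRules_isD hr) ht).1 ha
  exact h r hr _ ((Trigger.isOn_ofS (dlRules_isD hr).1 ht).1 ho) x hx

/-- The numbers of the stage of `o` are `e 0, …, e d`, where `o` is the zero of the stage `b`. -/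
structure Parent (G : FactBase) (b o : Term) (d : ℕ) (e : ℕ → Term) (β : Term) : Prop where
  link : (⟨3, [e d, o, b]⟩ : Atom) ∈ G
  zero : (⟨2, [β, e 0]⟩ : Atom) ∈ G
  succ : ∀ i < d, (⟨1, [β, e i, e (i + 1)]⟩ : Atom) ∈ G

/-- All stages except `b` are closed, and `o` is the only number of `b`. -/
structure LiveAt (G : FactBase) (b o : Term) : Prop where
  inv : Inv G
  closed : ∀ β x, (⟨0, [β, x]⟩ : Atom) ∈ G → β ≠ b → actOut β ⊆ G
  num : (⟨0, [b, o]⟩ : Atom) ∈ G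
  zero : (⟨2, [b, o]⟩ : Atom) ∈ G
  notMem : (⟨0, [b, b]⟩ : Atom) ∉ G
  succ : ∀ x y, (⟨1, [b, x, y]⟩ : Atom) ∈ G → y = b

/-- `G'` arises from `G` by extending the numbers of the stage `b` to `y 0, …, y m`. -/
structure Grown (c : Code) (G : FactBase) (b : Term) (y : ℕ → Term) (m : ℕ) (G' : FactBase) :
    Prop where
  steps : Relation.ReflTransGen (Step (rset c)) G G'
  chain : Chain G' b y m
  notMem : (⟨0, [b, b]⟩ : Atom) ∉ G'
  succ : ∀ z, (⟨1, [b, y m, z]⟩ : Atom) ∈ G' → z = b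
  num : ∀ β x, (⟨0, [β, x]⟩ : Atom) ∈ G' → β ≠ b → (⟨0, [β, x]⟩ : Atom) ∈ G
  link : ∀ i < m, ∀ u v, (⟨3, [y (i + 1), u, v]⟩ : Atom) ∈ G' → u = b ∧ v = b

theorem LiveAt.exists_grown {c : Code} {G : FactBase} {b o : Term} (h : LiveAt G b o) (m : ℕ) :
    ∃ y G', y 0 = o ∧ Grown c G b y m G' := by
  induction m with
  | zero =>
    exact ⟨fun _ => o, G, rfl, .refl, ⟨h.zero, fun _ _ => h.num, by simp⟩, h.notMem, h.succ o,
      fun _ _ h _ => h, by simp⟩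
  | succ m ih =>
    obtain ⟨y, G', h0, hG⟩ := ih
    have hinv := h.inv.reflTransGen hG.steps
    let t : Trigger := ⟨Rule.ofS rGrow, fun v => if v = 0 then b else y m⟩
    have hN := hG.chain.num m le_rfl
    have hon : t.IsOn G' := (isOn_grow rfl).2 hN
    have hstep : Step (rset c) G' (G' ∪ t.out) := by
      refine ⟨t, ⟨mem_rset.2 ⟨rGrow, by simp [allRules], rfl⟩, hon, ?_⟩, rfl⟩
      exact applicable_grow rfl hon hG.notMem hG.succ
    have hout : t.out = growOut b (y m) (.var (t.freshVar 2)) := out_grow rfl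
    have hfresh : t.freshVar 2 ∉ FactBase.vars G' := fun hf => by
      have := hinv.out_subset hf
      rw [hout] at this
      simp only [growOut, Finset.insert_subset_iff, Finset.singleton_subset_iff] at this
      have he := hG.succ _ this.1
      exact hG.notMem (he ▸ this.2.1)
    rw [hout] at hstep
    have hw : ∀ a ∈ G', Term.var (t.freshVar 2) ∉ a.args := fun a ha hu =>
      var_ne_of_mem ha hu hfresh rfl
    generalize Term.var (t.freshVar 2) = w at hstep hw
    have hbw : b ≠ w := fun h => hw _ hN (by simp [h])
    have hyw : ∀ i ≤ m, y i ≠ w := fun i hi h => hw _ (hG.chain.num i hi) (by simp [h])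
    have hsub : G' ⊆ G' ∪ growOut b (y m) w := Finset.subset_union_left
    have hnew : growOut b (y m) w ⊆ G' ∪ growOut b (y m) w := Finset.subset_union_right
    simp only [growOut, Finset.insert_subset_iff, Finset.singleton_subset_iff] at hnew
    refine ⟨fun i => if i ≤ m then y i else w, _, by simpa using h0, hG.steps.tail hstep,
      ⟨by simpa using .inl hG.chain.zero, fun i hi => ?_, fun i hi => ?_⟩, ?_, fun z hz => ?_,
      fun β x hx hβ => ?_, fun i hi u v huv => ?_⟩
    · by_cases hi' : i ≤ m
      · simpa only [if_pos hi'] using hsub (hG.chain.num i hi')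
      · simp only [if_neg hi']
        exact hnew.2.1
    · rcases Nat.lt_succ_iff_lt_or_eq.1 hi with hi' | rfl
      · simpa only [if_pos hi'.le, if_pos (Nat.succ_le_of_lt hi')] using hsub (hG.chain.succ i hi')
      · simp only [le_refl, if_true, Nat.succ_le_iff, lt_irrefl, if_false]
        exact hnew.1
    · simpa [hG.notMem, growOut] using hbw
    · simp only [Nat.succ_le_iff, lt_irrefl, if_false, Finset.mem_union] at hz
      rcases hz with hz | hz
      · exact (hw _ hz (by simp)).elim
      · simpa [growOut, (hyw m le_rfl).symm] using hz
    · rcases Finset.mem_union.1 hx with hx | hx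
      · exact hG.num β x hx hβ
      · simp [growOut, hβ] at hx
    · rcases Finset.mem_union.1 huv with huv | huv
      · rcases Nat.lt_succ_iff_lt_or_eq.1 hi with hi' | rfl
        · rw [if_pos (Nat.succ_le_of_lt hi')] at huv
          exact hG.link i hi' u v huv
        · exact (hw _ huv (by simp)).elim
      · simp [growOut] at huv
        exact huv.2

theorem Parent.halt {c : Code} {G : FactBase} {b o β : Term} {d m : ℕ} {e y : ℕ → Term}
    (hp : Parent G b o d e β) (h0 : y 0 = o) (hy : Chain G b y m) (hG : Sat c G) (hd : d < m)
    {z : ℕ} (hz : (⟨codePred c, [b, y (d + 1), y z]⟩ : Atom) ∈ G) :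
    (⟨10, [b, y (d + 1)]⟩ : Atom) ∈ G := by
  subst h0
  have hW : ∀ i ≤ d, (⟨8, [b, y i, e (d - i)]⟩ : Atom) ∈ G := by
    intro i
    induction i with
    | zero =>
      intro _
      simpa [rDescend, inst] using hG rDescend (by simp [dlRules])
        (fun v => if v = 0 then b else if v = 1 then e d else y 0)
        (by simpa [rDescend, inst] using ⟨hp.link, hy.num 0 (Nat.zero_le _), hy.zero⟩)
    | succ i ih =>
      intro hi
      have := hp.succ (d - (i + 1)) (by omega)
      rw [show d - (i + 1) + 1 = d - i by omega] at this
      simpa [rCount, inst] using hG rCount (by simp [dlRules])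
        (fun v => if v = 0 then b else if v = 1 then y i else if v = 2 then e (d - i) else
          if v = 3 then y (i + 1) else if v = 4 then β else e (d - (i + 1)))
        (by simpa [rCount, inst] using ⟨ih (by omega), hy.mem_succ hG (by omega), this⟩)
  have hQ : (⟨9, [b, y (d + 1)]⟩ : Atom) ∈ G := by
    simpa [rQuery, inst] using hG rQuery (by simp [dlRules])
      (fun v => if v = 0 then b else if v = 1 then y d else if v = 2 then e 0 else
        if v = 3 then y (d + 1) else β)
      (by simpa [rQuery, inst] using
        ⟨by simpa using hW d le_rfl, hp.zero, hy.mem_succ hG hd⟩)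
  simpa [rHalt, inst] using hG (rHalt (codePred c)) (by simp [dlRules])
    (fun v => if v = 0 then b else if v = 1 then y (d + 1) else y z)
    (by simpa [rHalt, inst] using ⟨hQ, hz⟩)

/-- The factbases from which the simulation continues. -/
def Live (G : FactBase) : Prop := ∃ b o, LiveAt G b o ∧ ∃ d e β, Parent G b o d e β

/-- The simulation passes to a new stage. -/
theorem LiveAt.exists_next {c : Code} {G₀ G : FactBase} {b o : Term} {d m : ℕ} {y : ℕ → Term}
    (h : LiveAt G₀ b o) (h0 : y 0 = o) (hG : Grown c G₀ b y m G) (hd : d < m)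
    (hE : (⟨10, [b, y (d + 1)]⟩ : Atom) ∈ G) :
    ∃ G', Relation.TransGen (Step (rset c)) G G' ∧ Live G' ∧
      ∀ β x, (⟨0, [β, x]⟩ : Atom) ∈ G₀ → actOut β ⊆ G' := by
  have hinv := h.inv.reflTransGen hG.steps
  let t : Trigger := ⟨Rule.ofS rEvent, fun v => if v = 0 then b else y (d + 1)⟩
  have hon : t.IsOn G := (isOn_event rfl).2 hE
  have hstep : Step (rset c) G (G ∪ t.out) := by
    refine ⟨t, ⟨mem_rset.2 ⟨rEvent, by simp [allRules], rfl⟩, hon, ?_⟩, rfl⟩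
    exact applicable_event rfl hon hG.notMem (hG.link d hd)
  have hout : t.out = eventOut (y (d + 1)) (.var (t.freshVar 2)) (.var (t.freshVar 3)) :=
    out_event rfl
  have hfresh : ∀ z, t.freshVar z ∉ FactBase.vars G := fun z hf => by
    have := hinv.out_subset hf
    rw [hout] at this
    simp only [eventOut, Finset.insert_subset_iff, Finset.singleton_subset_iff] at this
    have he := hG.link d hd _ _ this.1
    rw [he.1, he.2] at this
    exact hG.notMem this.2.1
  have hne : Term.var (t.freshVar 2) ≠ Term.var (t.freshVar 3) := fun h =>
    absurd (Trigger.equiv_of_freshVar (Term.var.inj h)).2 (by norm_num)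
  have hw : ∀ z, ∀ a ∈ G, Term.var (t.freshVar z) ∉ a.args := fun z a ha hu =>
    var_ne_of_mem ha hu (hfresh z) rfl
  rw [hout] at hstep
  have hwβ := hw 2
  have hwo := hw 3
  generalize Term.var (t.freshVar 2) = β' at *
  generalize Term.var (t.freshVar 3) = o' at *
  have hb0 : (⟨0, [b, o]⟩ : Atom) ∈ G := h0 ▸ hG.chain.num 0 (Nat.zero_le _)
  have hbβ : b ≠ β' := fun h => hwβ _ hb0 (by simp [h])
  set G' := G ∪ eventOut (y (d + 1)) β' o' with hG'
  have hsub : G ⊆ G' := Finset.subset_union_left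
  have hnew : eventOut (y (d + 1)) β' o' ⊆ G' := Finset.subset_union_right
  let s : Trigger := ⟨Rule.ofS rAct, fun v => if v = 0 then b else o⟩
  have hson : s.IsOn G' := (isOn_act rfl).2 (hsub hb0)
  have hsout : s.out = actOut b := out_act rfl
  have hbb : (⟨0, [b, b]⟩ : Atom) ∉ G' := by
    simp [hG', hG.notMem, eventOut, hbβ]
  have hstep' : Step (rset c) G' (G' ∪ s.out) := by
    refine ⟨s, ⟨mem_rset.2 ⟨rAct, by simp [allRules], rfl⟩, hson, ?_⟩, rfl⟩
    refine (applicable_of_datalog rAct_isD rfl hson).2 fun hs => hbb (hs ?_)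
    simp [hsout, actOut]
  rw [hsout] at hstep'
  have hsub' : G' ⊆ G' ∪ actOut b := Finset.subset_union_left
  have hact : actOut b ⊆ G' ∪ actOut b := Finset.subset_union_right
  have hG0 : ∀ γ x, (⟨0, [γ, x]⟩ : Atom) ∈ G → actOut γ ⊆ G' ∪ actOut b := fun γ x hx => by
    by_cases hγ : γ = b
    · rwa [hγ]
    · exact (h.closed γ x (hG.num γ x hx hγ) hγ).trans
        ((subset_of_reflTransGen hG.steps).trans (hsub.trans hsub'))
  simp only [eventOut, Finset.insert_subset_iff, Finset.singleton_subset_iff] at hnew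
  refine ⟨_, .tail (.single hstep) hstep', ⟨β', o', ⟨(hinv.step hstep).step hstep', ?_,
    hsub' hnew.2.1, hsub' hnew.2.2.1, ?_, ?_⟩, d + 1, y, b, hsub' hnew.1,
    hsub' (hsub hG.chain.zero), fun i hi => hsub' (hsub (hG.chain.succ i (by omega)))⟩,
    fun γ x hx => hG0 γ x (subset_of_reflTransGen hG.steps hx)⟩
  · intro γ x hx hγ
    simp only [hG', Finset.mem_union, or_assoc] at hx
    rcases hx with hx | hx | hx
    · exact hG0 γ x hx
    · simp [eventOut, hγ] at hx
    · simp [actOut] at hx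
      rwa [hx.1]
  · simp only [hG', Finset.mem_union, or_assoc, not_or]
    exact ⟨fun hx => hwβ _ hx (by simp), by simp [eventOut, hne], by simp [actOut, hbβ.symm]⟩
  · intro x z hx
    simp only [hG', Finset.mem_union, or_assoc] at hx
    rcases hx with hx | hx | hx
    · exact (hwβ _ hx (by simp)).elim
    · simp [eventOut] at hx
      exact hx.2
    · simp [actOut, hbβ.symm] at hx

theorem Grown.saturate {c : Code} {G₀ G G' : FactBase} {b : Term} {y : ℕ → Term} {m : ℕ}
    (h : Grown c G₀ b y m G) (hs : Relation.ReflTransGen (LStep (rset c) (dlRules c)) G G') :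
    Grown c G₀ b y m G' := by
  have hs' := Relation.ReflTransGen.mono (fun _ _ h => h.step) _ _ hs
  have hsub := subset_of_reflTransGen hs'
  exact ⟨h.steps.trans hs', ⟨hsub h.chain.zero, fun i hi => hsub (h.chain.num i hi),
      fun i hi => hsub (h.chain.succ i hi)⟩,
    fun ha => h.notMem (mem_of_reflTransGen hs ha (by norm_num)),
    fun z ha => h.succ z (mem_of_reflTransGen hs ha (by norm_num)),
    fun β x ha => h.num β x (mem_of_reflTransGen hs ha (by norm_num)),
    fun i hi u v ha => h.link i hi u v (mem_of_reflTransGen hs ha (by norm_num))⟩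

theorem Live.progress {c : Code} (hc : ∀ n, (c.eval n).Dom) {G : FactBase} (h : Live G) :
    ∃ G', Live G' ∧ Relation.TransGen (Step (rset c)) G G' ∧
      ∀ t, CanApply (rset c) G t → ¬ Applicable .R t G' := by
  obtain ⟨b, o, hG, d, e, β, hp⟩ := h
  obtain ⟨z, hz⟩ := Part.dom_iff_mem.1 (hc (d + 1))
  obtain ⟨m, hm, hd⟩ := (((der_codePred_iff le_rfl).2 hz).eventually_mem.and
    (Filter.eventually_gt_atTop d)).exists
  obtain ⟨y, G₁, h0, hG₁⟩ := hG.exists_grown (c := c) m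
  obtain ⟨G₂, hs, hsat⟩ := exists_sat c G₁
  have hG₂ := hG₁.saturate hs
  have hsub := subset_of_reflTransGen hG₂.steps
  have hp₂ : Parent G₂ b o d e β :=
    ⟨hsub hp.link, hsub hp.zero, fun i hi => hsub (hp.succ i hi)⟩
  obtain ⟨G₃, hs₃, hlive, hact⟩ := hG.exists_next h0 hG₂ hd
    (hp₂.halt h0 hG₂.chain hsat hd (z := z) (hm G₂ b y hsat hG₂.chain))
  have hsub₃ := subset_of_reflTransGen hs₃.to_reflTransGen
  have hinv := (hG.inv.reflTransGen hG₂.steps).reflTransGen hs₃.to_reflTransGen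
  refine ⟨G₃, hlive, hs₃.trans_right hG₂.steps, fun t ⟨hr, ho, _⟩ happ => ?_⟩
  have hfresh : ∀ z, t.freshVar z ∉ FactBase.vars G₃ := fun z hz =>
    happ.not_subset (hinv.out_subset hz)
  have hsubG : G ⊆ G₃ := hsub.trans hsub₃
  have ho₃ : t.IsOn G₃ := fun a ha => hsubG (ho a ha)
  rcases rule_cases hr with ht | ht | ht | ⟨r, hr, ht⟩
  · have hN := (isOn_grow ht).1 ho
    exact not_applicable_grow ht ho₃ (hfresh 2) (hact _ _ hN) (hsubG (hG.inv.num _ _ hN).1) happ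
  · refine happ.not_subset ?_
    rw [out_act ht]
    exact hact _ _ ((isOn_act ht).1 ho)
  · have hN := hG.inv.halt _ _ ((isOn_event ht).1 ho)
    exact not_applicable_event ht ho₃ (hfresh 2) (hfresh 3) (hact _ _ hN)
      (hsubG (hG.inv.num _ _ hN).2) happ
  · exact happ.not_subset
      ((hsat.out_subset hr ht fun a ha => hsub (ho a ha)).trans hsub₃)

/-- The factbase from which the simulation starts. -/
def startBase (b o : Term) : FactBase :=
  {⟨0, [b, o]⟩, ⟨2, [b, o]⟩, ⟨1, [b, o, b]⟩, ⟨3, [o, b, b]⟩, ⟨3, [o, o, b]⟩}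

theorem live_startBase : Live (startBase (.const 0) (.const 1)) := by
  refine ⟨.const 0, .const 1, ⟨⟨fun v hv => ?_, ?_, ?_, ?_, ?_⟩, ?_, ?_, ?_, ?_, ?_⟩,
    0, fun _ => .const 1, .const 0, ?_, ?_, ?_⟩
  · obtain ⟨a, ha, hv⟩ := FactBase.mem_vars.1 hv
    simp only [startBase, Finset.mem_insert, Finset.mem_singleton] at ha
    rcases ha with rfl | rfl | rfl | rfl | rfl <;> simp at hv
  all_goals simp +contextual [startBase]

/-- If the simulated code is total, then the simulating rule set has an infinite fair
derivation. -/
theorem not_CTall_of_total {c : Code} (hc : ∀ n, (c.eval n).Dom) : ¬ CTall .R (rset c) :=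
  not_CTall_of_live Live live_startBase fun _ hG t =>
    let ⟨G', h1, h2, h3⟩ := Live.progress hc hG
    ⟨G', h1, h2, h3 t⟩

end simulation

/-- No computable function maps every rule set to an
atomic-head rule set while exactly preserving termination of the restricted
chase (membership in `CT_R^∀`). -/
theorem statement19 :
    ¬ ∃ (f : RuleSet → RuleSet) (g : ℕ → ℕ),
        Computable g ∧
        (∀ 𝓡 : RuleSet, g (Encodable.encode 𝓡) = Encodable.encode (f 𝓡)) ∧
        (∀ 𝓡 : RuleSet, ∀ R ∈ f 𝓡, R.IsAtomicHead) ∧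
        (∀ 𝓡 : RuleSet, CTall Variant.R 𝓡 ↔ CTall Variant.R (f 𝓡)) := by
  rintro ⟨f, g, hg, hfg, hatom, hiff⟩
  obtain ⟨Ψ, hΨ, hΨ'⟩ := exists_partrec_CTall
  have hF : Partrec₂ fun (c : Nat.Partrec.Code) (x : ℕ) => Ψ (g (Encodable.encode (rset c))) x :=
    hΨ.comp ((hg.comp primrec_encode_rset.to_comp).comp Computable.fst) Computable.snd
  obtain ⟨c, hc⟩ := Nat.Partrec.Code.fixed_point₂ hF
  obtain ⟨h1, h2⟩ := hΨ' (f (rset c)) (hatom _)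
  rw [← hfg, ← hiff] at h1 h2
  by_cases h : CTall .R (rset c)
  · exact not_CTall_of_total (fun n => by rw [hc]; exact h1 h n) h
  · refine h (h2 ?_)
    have := infinite_dom_of_not_CTall h
    rwa [hc] at this

end
end ExRules
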